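/- arXiv:1310.7379 — 3 statements merged into one kernel-verified Lean document; each statement's English description precedes it below -/
import Mathlib

section
/- Let (W,S) be a finite Coxeter system and F an automorphism of W with F(S) = S. For every F-conjugacy class O of W and every w ∈ O, there exists an element x ∈ O of minimal length in O such that w → x. -/
/-- `x` and `y` are `F`-conjugate: `y = w⁻¹ · x · F(w)` for some `w`. -/
def FConj {W : Type*} [Group W] (F : W ≃* W) (x y : W) : Prop :=
  ∃ w : W, y = w⁻¹ * x * F w

/-- The elementary step `x →_s y` of twisted cyclic shift: `y = s · x · F(s)` for a simple
reflection `s`, with `ℓ(y) ≤ ℓ(x)`. -/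
def CyclicShiftStep {B : Type*} {W : Type*} [Group W] {M : CoxeterMatrix B}
    (cs : CoxeterSystem M W) (F : W ≃* W) (x y : W) : Prop :=
  ∃ s : B, y = cs.simple s * x * F (cs.simple s) ∧ cs.length y ≤ cs.length x

section Helpers
open Finset

namespace GP

/-- A finite central arrangement (given by normal vectors) with an isometry permuting it. -/
structure Arr (E T : Type*) [NormedAddCommGroup E] [InnerProductSpace ℝ E] where
  α : T → E
  g : E ≃ₗᵢ[ℝ] E
  p : Equiv.Perm T
  hne : ∀ t, α t ≠ 0
  hlin : ∀ t t', t ≠ t' → LinearIndependent ℝ ![α t, α t']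
  hp : ∀ t, g (α t) = α (p t) ∨ g (α t) = - α (p t)

namespace Arr

variable {E T : Type*} [NormedAddCommGroup E] [InnerProductSpace ℝ E] (A : Arr E T)

/-- Evaluation of the normal vector. -/
noncomputable def h (x : E) (t : T) : ℝ := inner ℝ x (A.α t)

/-- Number of hyperplanes separating `x` and `g x`. -/
noncomputable def d (Φ : Finset T) (x : E) : ℕ :=
  (Φ.filter (fun t => A.h x t * A.h (A.g x) t < 0)).card

/-- Elementary step between generic points. -/
def Step (Φ : Finset T) (x y : E) : Prop :=
  (∀ t ∈ Φ, A.h y t ≠ 0) ∧ (Φ.filter (fun t => A.h x t * A.h y t < 0)).card ≤ 1 ∧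
    A.d Φ y ≤ A.d Φ x

lemma h_add (x y : E) (t : T) : A.h (x + y) t = A.h x t + A.h y t := by
  simp [h, inner_add_left]

lemma h_smul (c : ℝ) (x : E) (t : T) : A.h (c • x) t = c * A.h x t := by
  simp [h, inner_smul_left]

lemma h_cases (t : T) : (∀ x, A.h (A.g x) (A.p t) = A.h x t) ∨
    (∀ x, A.h (A.g x) (A.p t) = - A.h x t) := by
  rcases A.hp t with e | e
  · left; intro x
    rw [h, ← e, LinearIsometryEquiv.inner_map_map]; rfl
  · right; intro x
    have e2 : A.α (A.p t) = A.g (- A.α t) := by rw [map_neg, e, neg_neg]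
    rw [h, e2, LinearIsometryEquiv.inner_map_map, inner_neg_right]; rfl

lemma h_gg (x y : E) (t : T) :
    A.h (A.g x) (A.p t) * A.h (A.g y) (A.p t) = A.h x t * A.h y t := by
  rcases A.h_cases t with e | e <;> rw [e, e]; ring

lemma h_g_ne (x : E) (t : T) : A.h (A.g x) (A.p t) ≠ 0 ↔ A.h x t ≠ 0 := by
  rcases A.h_cases t with e | e <;> rw [e]; simp

variable {A}

lemma same_g {Φ : Finset T} (hΦ : ∀ t, A.p t ∈ Φ ↔ t ∈ Φ) {x y : E}
    (hxy : ∀ t ∈ Φ, 0 < A.h x t * A.h y t) : ∀ t ∈ Φ, 0 < A.h (A.g x) t * A.h (A.g y) t := by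
  intro t ht
  obtain ⟨t', rfl⟩ := A.p.surjective t
  rw [h_gg]; exact hxy _ ((hΦ _).1 ht)

lemma mul_neg_iff_of_same {a b c e : ℝ} (h1 : 0 < a * c) (h2 : 0 < b * e) :
    a * b < 0 ↔ c * e < 0 := by
  rcases pos_and_pos_or_neg_and_neg_of_mul_pos h1 with ⟨p, q⟩ | ⟨p, q⟩ <;>
  rcases pos_and_pos_or_neg_and_neg_of_mul_pos h2 with ⟨r, s⟩ | ⟨r, s⟩ <;>
  simp [mul_neg_iff, p, q, r, s, p.not_gt, q.not_gt, r.not_gt, s.not_gt]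

lemma d_congr {Φ : Finset T} (hΦ : ∀ t, A.p t ∈ Φ ↔ t ∈ Φ) {x y : E}
    (hxy : ∀ t ∈ Φ, 0 < A.h x t * A.h y t) : A.d Φ x = A.d Φ y := by
  unfold d
  congr 1
  apply Finset.filter_congr
  intro t ht
  exact mul_neg_iff_of_same (hxy t ht) (same_g hΦ hxy t ht)

lemma step_of_same {Φ : Finset T} (hΦ : ∀ t, A.p t ∈ Φ ↔ t ∈ Φ) {x y : E}
    (hxy : ∀ t ∈ Φ, 0 < A.h x t * A.h y t) : A.Step Φ x y := by
  refine ⟨fun t ht h0 => ?_, ?_, (d_congr hΦ hxy).ge⟩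
  · have := hxy t ht; rw [h0] at this; simp at this
  · rw [Finset.filter_eq_empty_iff.2]; · simp
    intro t ht; exact not_lt.2 (hxy t ht).le

lemma d_eq_sum (Φ : Finset T) (x : E) :
    A.d Φ x = ∑ t ∈ Φ, if A.h x t * A.h (A.g x) t < 0 then 1 else 0 := by
  rw [d, Finset.card_filter]

/-- crossing lemma -/
lemma d_cross [DecidableEq T] {Φ : Finset T} (hΦ : ∀ t, A.p t ∈ Φ ↔ t ∈ Φ) {u v m : E} {t0 : T}
    (ht0 : t0 ∈ Φ) (hu : ∀ t ∈ Φ, t ≠ t0 → 0 < A.h u t * A.h m t)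
    (hv : ∀ t ∈ Φ, t ≠ t0 → 0 < A.h v t * A.h m t) (huv : A.h u t0 * A.h v t0 < 0)
    (hc : A.p t0 ≠ t0 → ¬ (A.h v t0 * A.h (A.g m) t0 < 0 ∧ A.h v t0 * A.h (A.g.symm m) t0 < 0)) :
    A.d Φ v ≤ A.d Φ u := by
  have huv' : ∀ t ∈ Φ, t ≠ t0 → 0 < A.h u t * A.h v t := by
    intro t ht hne
    have := mul_pos (hu t ht hne) (hv t ht hne)
    have h2 : 0 < (A.h u t * A.h v t) * (A.h m t)^2 := by nlinarith
    exact pos_of_mul_pos_left h2 (sq_nonneg _)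
  have key : ∀ x y : E, (∀ t ∈ Φ, t ≠ t0 → 0 < A.h x t * A.h y t) → ∀ t ∈ Φ, t ≠ A.p t0 →
      0 < A.h (A.g x) t * A.h (A.g y) t := by
    intro x y hxy t ht hne
    obtain ⟨t', rfl⟩ := A.p.surjective t
    rw [h_gg]; exact hxy _ ((hΦ _).1 ht) (fun e => hne (by rw [e]))
  have huvg := key u v huv'
  have hug := key u m hu
  have hvg := key v m hv
  by_cases hp : A.p t0 = t0
  · apply le_of_eq
    unfold d; congr 1
    apply Finset.filter_congr
    intro t ht
    by_cases e : t = t0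
    · subst e
      have h1 := h_gg A u v t
      rw [hp] at h1
      rcases h_cases A t with e | e <;> rw [hp] at e <;> rw [e, e]
      · constructor <;> intro h <;> nlinarith [sq_nonneg (A.h u t), sq_nonneg (A.h v t)]
      · have : A.h u t ≠ 0 := fun h0 => by simp [h0] at huv
        have h' : A.h v t ≠ 0 := fun h0 => by simp [h0] at huv
        have := sq_pos_of_ne_zero this
        have := sq_pos_of_ne_zero h'
        constructor <;> intro h <;> nlinarith
    · exact (mul_neg_iff_of_same (huv' t ht e) (huvg t ht (by rw [hp]; exact e))).symm
  · specialize hc hp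
    have ht1 : A.p t0 ∈ Φ := (hΦ _).2 ht0
    have split : ∀ x, A.d Φ x = (if A.h x t0 * A.h (A.g x) t0 < 0 then 1 else 0) +
        ((if A.h x (A.p t0) * A.h (A.g x) (A.p t0) < 0 then 1 else 0) +
        ∑ t ∈ (Φ.erase t0).erase (A.p t0), if A.h x t * A.h (A.g x) t < 0 then 1 else 0) := by
      intro x
      rw [d_eq_sum, Finset.add_sum_erase _ (fun t => if A.h x t * A.h (A.g x) t < 0 then 1 else 0)
        (Finset.mem_erase.2 ⟨hp, ht1⟩),
        Finset.add_sum_erase _ (fun t => if A.h x t * A.h (A.g x) t < 0 then 1 else 0) ht0]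
    rw [split u, split v]
    have hrest : (∑ t ∈ (Φ.erase t0).erase (A.p t0), if A.h v t * A.h (A.g v) t < 0 then 1 else 0)
      = ∑ t ∈ (Φ.erase t0).erase (A.p t0), if A.h u t * A.h (A.g u) t < 0 then 1 else 0 := by
      apply Finset.sum_congr rfl
      intro t ht
      simp only [Finset.mem_erase] at ht
      have := mul_neg_iff_of_same (huv' t ht.2.2 ht.2.1) (huvg t ht.2.2 ht.1)
      simp only [this]
    rw [hrest]
    have hsym : ∀ x, A.h x (A.p t0) * A.h (A.g x) (A.p t0) = A.h (A.g.symm x) t0 * A.h x t0 := by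
      intro x
      have := A.h_gg (A.g.symm x) x t0
      simpa using this
    have h1 := hug t0 ht0 (Ne.symm hp)
    have h2 := hvg t0 ht0 (Ne.symm hp)
    have h3 := hu (A.p t0) ht1 hp
    have h4 := hv (A.p t0) ht1 hp
    have h3' : 0 < A.h (A.g.symm u) t0 * A.h (A.g.symm m) t0 := by
      rw [← h_gg]; simpa using h3
    have h4' : 0 < A.h (A.g.symm v) t0 * A.h (A.g.symm m) t0 := by
      rw [← h_gg]; simpa using h4
    rw [hsym, hsym]
    have hmn : A.h (A.g m) t0 ≠ 0 := fun h0 => by simp [h0] at h1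
    have hmn' : A.h (A.g.symm m) t0 ≠ 0 := fun h0 => by simp [h0] at h3'
    have hvne : A.h v t0 ≠ 0 := fun h0 => by simp [h0] at huv
    have hune : A.h u t0 ≠ 0 := fun h0 => by simp [h0] at huv
    generalize A.h (A.g m) t0 = a at *
    generalize A.h (A.g.symm m) t0 = b at *
    generalize A.h v t0 = v0 at *
    generalize A.h u t0 = u0 at *
    have e1 : ∀ y c : ℝ, 0 < c * a → (y * c < 0 ↔ y * a < 0) := fun y c hh => by
      rcases pos_and_pos_or_neg_and_neg_of_mul_pos hh with ⟨p, q⟩ | ⟨p, q⟩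
      · rw [mul_neg_iff, mul_neg_iff]; grind
      · rw [mul_neg_iff, mul_neg_iff]; grind
    have e2 : ∀ y c : ℝ, 0 < c * b → (c * y < 0 ↔ y * b < 0) := fun y c hh => by
      rcases pos_and_pos_or_neg_and_neg_of_mul_pos hh with ⟨p, q⟩ | ⟨p, q⟩
      · rw [mul_neg_iff, mul_neg_iff]; grind
      · rw [mul_neg_iff, mul_neg_iff]; grind
    rw [if_congr (e1 _ _ h1) rfl rfl, if_congr (e1 _ _ h2) rfl rfl,
      if_congr (e2 _ _ h3') rfl rfl, if_congr (e2 _ _ h4') rfl rfl]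
    have e3 : ∀ c : ℝ, c ≠ 0 → (u0 * c < 0 ↔ ¬ v0 * c < 0) := fun c hh => by
      rw [mul_neg_iff] at huv
      rcases lt_or_gt_of_ne hh with hc | hc <;> rcases huv with ⟨p, q⟩ | ⟨p, q⟩ <;>
        simp [mul_neg_iff, p, q, hc, p.not_gt, q.not_gt, hc.not_gt]
    rw [if_congr (e3 _ hmn) rfl rfl, if_congr (e3 _ hmn') rfl rfl]
    split_ifs <;> first | omega | tauto

end Arr
end GP

namespace GP

lemma sturm_step {a b a' b' : ℝ} (ha : a ≠ 0) (hb : b ≠ 0) (ha' : a' ≠ 0) (hb' : b' ≠ 0)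
    (hC : 0 ≤ a * b' - a' * b) :
    (if a * a' < 0 then 1 else 0 : ℤ) - (if b * b' < 0 then 1 else 0) =
    (if a' * b' < 0 then 1 else 0) - (if a * b < 0 then 1 else 0) := by
  rcases lt_or_gt_of_ne ha with h1 | h1 <;> rcases lt_or_gt_of_ne hb with h2 | h2 <;>
  rcases lt_or_gt_of_ne ha' with h3 | h3 <;> rcases lt_or_gt_of_ne hb' with h4 | h4 <;>
  simp [mul_neg_iff, h1, h2, h3, h4, h1.not_gt, h2.not_gt, h3.not_gt, h4.not_gt]
  all_goals exfalso
  all_goals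
    have q1 := mul_pos (abs_pos.2 ha) (abs_pos.2 hb')
    have q2 := mul_pos (abs_pos.2 ha') (abs_pos.2 hb)
    simp only [abs_of_neg, abs_of_pos, h1, h2, h3, h4] at q1 q2
    linarith

lemma sturm_aux {a b : ℕ → ℝ} {lam : ℝ} (ha : ∀ k, a k ≠ 0) (hb : ∀ k, b k ≠ 0)
    (ra : ∀ k, a (k + 2) + a k = lam * a (k + 1)) (rb : ∀ k, b (k + 2) + b k = lam * b (k + 1))
    (hC : 0 ≤ a 0 * b 1 - a 1 * b 0) (n : ℕ) :
    |(∑ k ∈ Finset.range n, if a k * a (k + 1) < 0 then 1 else 0 : ℤ) -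
      ∑ k ∈ Finset.range n, if b k * b (k + 1) < 0 then 1 else 0| ≤ 1 := by
  have hk : ∀ k, a k * b (k + 1) - a (k + 1) * b k = a 0 * b 1 - a 1 * b 0 := by
    intro k
    induction k with
    | zero => simp
    | succ k ih =>
      rw [← ih]
      have h1 : a (k + 2) = lam * a (k + 1) - a k := by linarith [ra k]
      have h2 : b (k + 2) = lam * b (k + 1) - b k := by linarith [rb k]
      rw [show k + 1 + 1 = k + 2 from rfl, h1, h2]; ring
  rw [← Finset.sum_sub_distrib]
  rw [Finset.sum_congr rfl (fun k _ => sturm_step (ha k) (hb k) (ha (k+1)) (hb (k+1))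
    (by rw [hk]; exact hC)), Finset.sum_range_sub (fun k => (if a k * b k < 0 then 1 else 0 : ℤ))]
  split_ifs <;> simp

lemma sturm {a b : ℕ → ℝ} {lam : ℝ} (ha : ∀ k, a k ≠ 0) (hb : ∀ k, b k ≠ 0)
    (ra : ∀ k, a (k + 2) + a k = lam * a (k + 1)) (rb : ∀ k, b (k + 2) + b k = lam * b (k + 1))
    (n : ℕ) :
    |(∑ k ∈ Finset.range n, if a k * a (k + 1) < 0 then 1 else 0 : ℤ) -
      ∑ k ∈ Finset.range n, if b k * b (k + 1) < 0 then 1 else 0| ≤ 1 := by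
  rcases le_total 0 (a 0 * b 1 - a 1 * b 0) with h | h
  · exact sturm_aux ha hb ra rb h n
  · rw [abs_sub_comm]; exact sturm_aux hb ha rb ra (by linarith) n

namespace Arr
variable {E T : Type*} [NormedAddCommGroup E] [InnerProductSpace ℝ E] {A : Arr E T}

lemma d_g {Φ : Finset T} (hΦ : ∀ t, A.p t ∈ Φ ↔ t ∈ Φ) (x : E) : A.d Φ (A.g x) = A.d Φ x := by
  rw [d_eq_sum, d_eq_sum]
  symm
  apply Finset.sum_equiv A.p (fun t => (hΦ t).symm)
  intro t _
  rw [h_gg]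

lemma gen_g {Φ : Finset T} (hΦ : ∀ t, A.p t ∈ Φ ↔ t ∈ Φ) {x : E} (hx : ∀ t ∈ Φ, A.h x t ≠ 0) :
    ∀ t ∈ Φ, A.h (A.g x) t ≠ 0 := by
  intro t ht
  obtain ⟨t', rfl⟩ := A.p.surjective t
  rw [h_g_ne]; exact hx _ ((hΦ _).1 ht)

lemma d_const {Φ : Finset T} (hΦ : ∀ t, A.p t ∈ Φ ↔ t ∈ Φ) {x y : E} {lam : ℝ}
    (hx : ∀ t ∈ Φ, A.h x t ≠ 0) (hy : ∀ t ∈ Φ, A.h y t ≠ 0)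
    (rx : A.g (A.g x) + x = lam • A.g x) (ry : A.g (A.g y) + y = lam • A.g y) :
    A.d Φ x = A.d Φ y := by
  have gen : ∀ z : E, (∀ t ∈ Φ, A.h z t ≠ 0) → ∀ k, ∀ t ∈ Φ, A.h (A.g^[k] z) t ≠ 0 := by
    intro z hz k
    induction k with
    | zero => exact hz
    | succ k ih => rw [Function.iterate_succ_apply']; exact gen_g hΦ ih
  have dk : ∀ (z : E) k, A.d Φ (A.g^[k] z) = A.d Φ z := by
    intro z k
    induction k with
    | zero => rfl
    | succ k ih => rw [Function.iterate_succ_apply', d_g hΦ, ih]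
  have hrec : ∀ z : E, A.g (A.g z) + z = lam • A.g z → ∀ k t,
      A.h (A.g^[k+2] z) t + A.h (A.g^[k] z) t = lam * A.h (A.g^[k+1] z) t := by
    intro z hz k t
    rw [← h_smul, ← h_add]
    congr 1
    induction k with
    | zero => exact hz
    | succ k ih =>
      simp only [Function.iterate_succ_apply'] at ih ⊢
      rw [← map_add, ih, map_smul]
  have tot : ∀ (z : E) (n : ℕ), (n * A.d Φ z : ℤ) = ∑ t ∈ Φ, ∑ k ∈ Finset.range n,
      if A.h (A.g^[k] z) t * A.h (A.g^[k+1] z) t < 0 then 1 else 0 := by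
    intro z n
    rw [Finset.sum_comm]
    have : ∀ k ∈ Finset.range n, (∑ t ∈ Φ, if A.h (A.g^[k] z) t * A.h (A.g^[k+1] z) t < 0
        then (1 : ℤ) else 0) = A.d Φ z := by
      intro k _
      rw [← dk z k, d_eq_sum]
      push_cast
      apply Finset.sum_congr rfl
      intro t _
      rw [Function.iterate_succ_apply']
    rw [Finset.sum_congr rfl this]; simp
  have bound : ∀ n : ℕ, |(n : ℤ) * ((A.d Φ x : ℤ) - A.d Φ y)| ≤ Φ.card := by
    intro n
    rw [mul_sub, tot, tot, ← Finset.sum_sub_distrib]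
    refine (Finset.abs_sum_le_sum_abs _ _).trans ?_
    refine (Finset.sum_le_card_nsmul _ _ 1 ?_).trans (by simp)
    intro t ht
    exact sturm (fun k => gen x hx k t ht) (fun k => gen y hy k t ht) (fun k => hrec x rx k t)
      (fun k => hrec y ry k t) n
  have b := bound (Φ.card + 1)
  by_contra hne
  have h1 : 1 ≤ |(A.d Φ x : ℤ) - A.d Φ y| := Int.one_le_abs (by omega)
  rw [abs_mul, abs_of_nonneg (by positivity)] at b
  push_cast at b
  nlinarith

end Arr
end GP

namespace GP
open Filter Topology

section flow
variable {E : Type*} [NormedAddCommGroup E] [InnerProductSpace ℝ E]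
  {n : ℕ} (b : OrthonormalBasis (Fin n) ℝ E) (μ : Fin n → ℝ)

/-- the (rescaled) gradient flow in an eigenbasis -/
noncomputable def flow (s : ℝ) (y : E) : E := ∑ i, (Real.exp (s * μ i) * inner ℝ (b i) y) • b i

lemma flow_inner (s : ℝ) (y z : E) :
    inner ℝ (flow b μ s y) z = ∑ i, Real.exp (s * μ i) * (inner ℝ (b i) y * inner ℝ (b i) z) := by
  rw [flow, sum_inner]
  apply Finset.sum_congr rfl
  intro i _
  rw [inner_smul_left]; simp; ring

lemma inner_b_flow (s : ℝ) (y : E) (i : Fin n) :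
    inner ℝ (b i) (flow b μ s y) = Real.exp (s * μ i) * inner ℝ (b i) y := by
  rw [real_inner_comm, flow_inner]
  rw [Finset.sum_eq_single i]
  · simp
  · intro j _ hj
    rw [orthonormal_iff_ite.1 b.orthonormal j i]; simp [hj]
  · simp

lemma flow_zero (y : E) : flow b μ 0 y = y := by
  simp only [flow, zero_mul, Real.exp_zero, one_mul]
  exact b.sum_repr' y

lemma flow_neg (s : ℝ) (y : E) : flow b μ (-s) (flow b μ s y) = y := by
  conv_rhs => rw [← b.sum_repr' y]
  rw [flow]
  apply Finset.sum_congr rfl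
  intro i _
  rw [inner_b_flow, ← mul_assoc, ← Real.exp_add]; simp

lemma flow_contDiff : ContDiff ℝ 1 (fun q : ℝ × E => flow b μ q.1 q.2) := by
  unfold flow
  apply ContDiff.sum
  intro i _
  apply ContDiff.smul _ contDiff_const
  apply ContDiff.mul
  · exact Real.contDiff_exp.comp (contDiff_fst.mul contDiff_const)
  · exact contDiff_const.inner ℝ contDiff_snd

lemma flow_analytic (y z : E) (s0 : ℝ) : AnalyticAt ℝ (fun s => inner ℝ (flow b μ s y) z) s0 := by
  simp only [flow_inner]
  fun_prop

lemma flow_cont (y z : E) : Continuous (fun s => inner ℝ (flow b μ s y) z) := by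
  simp only [flow_inner]
  fun_prop

lemma flow_deriv (g : E ≃ₗᵢ[ℝ] E) (hb : ∀ i, g (b i) + g.symm (b i) = μ i • b i) (y z : E) (s : ℝ) :
    HasDerivAt (fun s => inner ℝ (flow b μ s y) z)
      (inner ℝ (g (flow b μ s y)) z + inner ℝ (g.symm (flow b μ s y)) z) s := by
  have e : inner ℝ (g (flow b μ s y)) z + inner ℝ (g.symm (flow b μ s y)) z =
      ∑ i, (Real.exp (s * μ i) * μ i) * (inner ℝ (b i) y * inner ℝ (b i) z) := by
    rw [← inner_add_left]
    have : g (flow b μ s y) + g.symm (flow b μ s y) =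
        ∑ i, (Real.exp (s * μ i) * inner ℝ (b i) y) • (μ i • b i) := by
      simp only [flow, map_sum, map_smul, ← Finset.sum_add_distrib, ← smul_add, hb]
    rw [this, sum_inner]
    apply Finset.sum_congr rfl
    intro i _
    rw [inner_smul_left, inner_smul_left]; simp; ring
  rw [e]
  simp only [flow_inner]
  apply HasDerivAt.fun_sum
  intro i _
  apply HasDerivAt.mul_const
  have := ((hasDerivAt_id s).mul_const (μ i)).exp
  simpa using this

lemma exists_eigenbasis [FiniteDimensional ℝ E] (g : E ≃ₗᵢ[ℝ] E) :
    ∃ (n : ℕ) (b : OrthonormalBasis (Fin n) ℝ E) (μ : Fin n → ℝ),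
      ∀ i, g (b i) + g.symm (b i) = μ i • b i := by
  let N : E →ₗ[ℝ] E := (g.toLinearEquiv : E →ₗ[ℝ] E) + (g.symm.toLinearEquiv : E →ₗ[ℝ] E)
  have hN : N.IsSymmetric := by
    intro x y
    simp only [N, LinearMap.add_apply, inner_add_left, inner_add_right]
    have h1 : inner ℝ (g x) y = inner ℝ x (g.symm y) := by
      rw [← g.inner_map_map x (g.symm y)]; simp
    have h2 : inner ℝ (g.symm x) y = inner ℝ x (g y) := by
      rw [← g.inner_map_map (g.symm x) y]; simp
    have := congrArg₂ (· + ·) h1 h2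
    simp only [add_comm (inner ℝ x (g.symm y))] at this
    exact this
  refine ⟨_, hN.eigenvectorBasis rfl, hN.eigenvalues rfl, fun i => ?_⟩
  have := hN.apply_eigenvectorBasis rfl i
  exact this

lemma dense_good [FiniteDimensional ℝ E] (hE : 0 < Module.finrank ℝ E) {T : Type*} [Finite T]
    (α : T → E) (hlin : ∀ t t', t ≠ t' → LinearIndependent ℝ ![α t, α t'])
    {Z : Type*} [Finite Z] (z : Z → E) (hz : ∀ i, z i ≠ 0) :
    Dense {y : E | (∀ t t' s, t ≠ t' → inner ℝ (flow b μ s y) (α t) = 0 →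
      inner ℝ (flow b μ s y) (α t') = 0 → False) ∧ ∀ i, inner ℝ y (z i) ≠ 0} := by
  let B1 : {q : T × T // q.1 ≠ q.2} → Set E := fun q =>
    Set.range (fun v : ℝ × (Submodule.span ℝ (Set.range ![α q.1.1, α q.1.2]))ᗮ =>
      flow b μ (-v.1) (v.2 : E))
  let B2 : Z → Set E := fun i => Set.range (fun v : (Submodule.span ℝ {z i})ᗮ => (v : E))
  have d1 : ∀ q, dimH (B1 q) ≤ ((Module.finrank ℝ E - 1 : ℕ) : ENNReal) := by
    intro q
    refine (ContDiff.dimH_range_le ?_).trans ?_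
    · have h1 : ContDiff ℝ 1 (fun v : ℝ × (Submodule.span ℝ (Set.range ![α q.1.1, α q.1.2]))ᗮ =>
        ((-v.1, (v.2 : E)) : ℝ × E)) := by
        apply ContDiff.prodMk
        · exact contDiff_fst.neg
        · exact ((Submodule.span ℝ (Set.range ![α q.1.1, α q.1.2]))ᗮ.subtypeL.contDiff).comp
            contDiff_snd
      exact (flow_contDiff b μ).comp h1
    · rw [Module.finrank_prod, Module.finrank_self]
      have h2 := Submodule.finrank_add_finrank_orthogonal
        (Submodule.span ℝ (Set.range ![α q.1.1, α q.1.2]))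
      rw [finrank_span_eq_card (hlin _ _ q.2)] at h2
      simp only [Fintype.card_fin] at h2
      norm_cast
      omega
  have d2 : ∀ i, dimH (B2 i) ≤ ((Module.finrank ℝ E - 1 : ℕ) : ENNReal) := by
    intro i
    refine (ContDiff.dimH_range_le ?_).trans ?_
    · exact (Submodule.span ℝ {z i})ᗮ.subtypeL.contDiff
    · have h2 := Submodule.finrank_add_finrank_orthogonal (Submodule.span ℝ {z i})
      rw [finrank_span_singleton (hz i)] at h2
      norm_cast
      omega
  have hd : Dense ((⋃ q, B1 q) ∪ (⋃ i, B2 i))ᶜ := by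
    apply dense_compl_of_dimH_lt_finrank
    rw [dimH_union, dimH_iUnion, dimH_iUnion]
    have : ((Module.finrank ℝ E - 1 : ℕ) : ENNReal) < Module.finrank ℝ E := by
      norm_cast; omega
    exact (max_le (iSup_le d1) (iSup_le d2)).trans_lt this
  refine hd.mono ?_
  intro y hy
  simp only [Set.mem_compl_iff, Set.mem_union, Set.mem_iUnion, not_or, not_exists] at hy
  refine ⟨fun t t' s hne h1 h2 => hy.1 ⟨(t, t'), hne⟩ ⟨(s, ⟨flow b μ s y, ?_⟩), ?_⟩, fun i hi =>
    hy.2 i ⟨⟨y, ?_⟩, rfl⟩⟩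
  · rw [Submodule.mem_orthogonal']
    intro u hu
    refine Submodule.span_induction ?_ ?_ ?_ ?_ hu
    · rintro _ ⟨j, rfl⟩
      fin_cases j
      · exact h1
      · exact h2
    · simp
    · intro a c _ _ ha hc; rw [inner_add_right, ha, hc, add_zero]
    · intro r a _ ha; rw [inner_smul_right, ha, mul_zero]
  · exact flow_neg b μ s y
  · rw [Submodule.mem_orthogonal_singleton_iff_inner_left]; exact hi

end flow

end GP

namespace GP
open Filter Topology
namespace Arr
variable {E T : Type*} [NormedAddCommGroup E] [InnerProductSpace ℝ E] {A : Arr E T}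
  {n : ℕ} {b : OrthonormalBasis (Fin n) ℝ E} {μ : Fin n → ℝ}

lemma right_sign {f : ℝ → ℝ} {D s0 : ℝ} (hf : HasDerivAt f D s0) (h0 : f s0 = 0) (hD : D ≠ 0) :
    ∀ᶠ s in 𝓝[>] s0, 0 < D * f s := by
  have h1 := hasDerivAt_iff_tendsto_slope.1 hf
  have h2 : ∀ᶠ s in 𝓝[≠] s0, 0 < D * slope f s0 s := by
    have h3 : Tendsto (fun s => D * slope f s0 s) (𝓝[≠] s0) (𝓝 (D * D)) := h1.const_mul D
    exact h3.eventually (lt_mem_nhds (mul_self_pos.2 hD))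
  have h4 : ∀ᶠ s in 𝓝[>] s0, 0 < D * slope f s0 s :=
    h2.filter_mono (nhdsWithin_mono _ (fun x hx => ne_of_gt hx))
  filter_upwards [h4, self_mem_nhdsWithin] with s hs hs'
  rw [slope_def_field, h0, sub_zero] at hs
  have : 0 < s - s0 := sub_pos.2 hs'
  have h5 := mul_pos hs this
  rwa [mul_assoc, div_mul_cancel₀ _ this.ne'] at h5

lemma local_step {Φ : Finset T} (hΦ : ∀ t, A.p t ∈ Φ ↔ t ∈ Φ)
    (hb : ∀ i, A.g (b i) + A.g.symm (b i) = μ i • b i) {y : E}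
    (hy : ∀ t t' s, t ≠ t' → A.h (flow b μ s y) t = 0 → A.h (flow b μ s y) t' = 0 → False)
    (s0 : ℝ) :
    ∃ ε > 0, ∀ s' s'', s0 - ε < s' → s' ≤ s0 → s0 ≤ s'' → s'' < s0 + ε →
      (∀ t ∈ Φ, A.h (flow b μ s' y) t ≠ 0) → (∀ t ∈ Φ, A.h (flow b μ s'' y) t ≠ 0) →
      A.Step Φ (flow b μ s' y) (flow b μ s'' y) := by
  classical
  have hc : ∀ t, Continuous (fun s => A.h (flow b μ s y) t) := fun t => flow_cont b μ y _
  have ev1 : ∀ᶠ s in 𝓝 s0, ∀ t ∈ Φ, A.h (flow b μ s0 y) t ≠ 0 →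
      0 < A.h (flow b μ s y) t * A.h (flow b μ s0 y) t := by
    rw [Finset.eventually_all]
    intro t _
    by_cases h0 : A.h (flow b μ s0 y) t = 0
    · exact Eventually.of_forall (fun _ h => absurd h0 h)
    · have : Tendsto (fun s => A.h (flow b μ s y) t * A.h (flow b μ s0 y) t) (𝓝 s0)
        (𝓝 (A.h (flow b μ s0 y) t * A.h (flow b μ s0 y) t)) :=
        ((hc t).tendsto s0).mul_const _
      filter_upwards [this.eventually (lt_mem_nhds (mul_self_pos.2 h0))] with s hs _ using hs
  let D : T → ℝ := fun t => A.h (A.g (flow b μ s0 y)) t + A.h (A.g.symm (flow b μ s0 y)) t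
  have ev2 : ∀ᶠ s in 𝓝[>] s0, ∀ t ∈ Φ, A.h (flow b μ s0 y) t = 0 → D t ≠ 0 →
      0 < D t * A.h (flow b μ s y) t := by
    rw [Finset.eventually_all]
    intro t _
    by_cases h0 : A.h (flow b μ s0 y) t = 0
    · by_cases hD : D t = 0
      · exact Eventually.of_forall (fun _ _ h => absurd hD h)
      · filter_upwards [right_sign (flow_deriv b μ A.g hb y (A.α t) s0) h0 hD] with s hs _ _ using hs
    · exact Eventually.of_forall (fun _ h => absurd h h0)
  obtain ⟨ε1, hε1, H1⟩ := Metric.eventually_nhds_iff.1 ev1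
  rw [eventually_nhdsWithin_iff] at ev2
  obtain ⟨ε2, hε2, H2⟩ := Metric.eventually_nhds_iff.1 ev2
  refine ⟨min ε1 ε2, lt_min hε1 hε2, ?_⟩
  intro s' s'' hs1 hs2 hs3 hs4 hg1 hg2
  have m1 := min_le_left ε1 ε2
  have m2 := min_le_right ε1 ε2
  have K1 := @H1 s' (by rw [Real.dist_eq, abs_lt]; constructor <;> linarith)
  have K2 := @H1 s'' (by rw [Real.dist_eq, abs_lt]; constructor <;> linarith)
  have K3 := @H2 s'' (by rw [Real.dist_eq, abs_lt]; constructor <;> linarith)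
  have comb : ∀ t ∈ Φ, A.h (flow b μ s0 y) t ≠ 0 →
      0 < A.h (flow b μ s' y) t * A.h (flow b μ s'' y) t := by
    intro t ht h0
    have h2 : 0 < (A.h (flow b μ s' y) t * A.h (flow b μ s'' y) t) * (A.h (flow b μ s0 y) t)^2 := by
      nlinarith [mul_pos (K1 t ht h0) (K2 t ht h0)]
    exact pos_of_mul_pos_left h2 (sq_nonneg _)
  by_cases hgen : ∀ t ∈ Φ, A.h (flow b μ s0 y) t ≠ 0
  · exact step_of_same hΦ (fun t ht => comb t ht (hgen t ht))
  push Not at hgen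
  obtain ⟨t0, ht0, h0⟩ := hgen
  have hother : ∀ t ∈ Φ, t ≠ t0 → A.h (flow b μ s0 y) t ≠ 0 := fun t _ hne h => hy t t0 s0 hne h h0
  have hlt : s0 < s'' := lt_of_le_of_ne hs3 (fun e => hg2 t0 ht0 (e ▸ h0))
  by_cases hsame : 0 < A.h (flow b μ s' y) t0 * A.h (flow b μ s'' y) t0
  · refine step_of_same hΦ (fun t ht => ?_)
    by_cases e : t = t0
    · rw [e]; exact hsame
    · exact comb t ht (hother t ht e)
  have hopp : A.h (flow b μ s' y) t0 * A.h (flow b μ s'' y) t0 < 0 :=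
    lt_of_le_of_ne (not_lt.1 hsame) (mul_ne_zero (hg1 t0 ht0) (hg2 t0 ht0))
  refine ⟨hg2, ?_, ?_⟩
  · refine (Finset.card_le_card (t := {t0}) ?_).trans (by simp)
    intro t ht
    rw [Finset.mem_filter] at ht
    rw [Finset.mem_singleton]
    by_contra e
    exact absurd ht.2 (not_lt.2 (comb t ht.1 (hother t ht.1 e)).le)
  · refine d_cross (m := flow b μ s0 y) hΦ ht0 (fun t ht e => K1 t ht (hother t ht e))
      (fun t ht e => K2 t ht (hother t ht e)) hopp ?_
    rintro _ ⟨q1, q2⟩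
    have q3 : A.h (flow b μ s'' y) t0 * D t0 < 0 := by simp only [D]; linarith
    have hD : D t0 ≠ 0 := fun e => by simp [e] at q3
    have := K3 hlt t0 ht0 h0 hD
    linarith

lemma gen_right {Φ : Finset T} {y : E} (hgen : ∀ t ∈ Φ, A.h y t ≠ 0) (s0 : ℝ) :
    ∀ᶠ s in 𝓝[>] s0, ∀ t ∈ Φ, A.h (flow b μ s y) t ≠ 0 := by
  rw [Finset.eventually_all]
  intro t ht
  have han : AnalyticOnNhd ℝ (fun s => A.h (flow b μ s y) t) Set.univ :=
    fun s _ => flow_analytic b μ y (A.α t) s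
  rcases (han s0 trivial).eventually_eq_zero_or_eventually_ne_zero with h | h
  · exfalso
    have := han.eqOn_zero_of_preconnected_of_eventuallyEq_zero isPreconnected_univ
      (Set.mem_univ s0) h (Set.mem_univ 0)
    simp only [flow_zero] at this
    exact hgen t ht this
  · exact h.filter_mono (nhdsWithin_mono _ (fun x hx => ne_of_gt hx))

lemma reach_flow {Φ : Finset T} (hΦ : ∀ t, A.p t ∈ Φ ↔ t ∈ Φ)
    (hb : ∀ i, A.g (b i) + A.g.symm (b i) = μ i • b i) {y : E}
    (hy : ∀ t t' s, t ≠ t' → A.h (flow b μ s y) t = 0 → A.h (flow b μ s y) t' = 0 → False)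
    (hgen : ∀ t ∈ Φ, A.h y t ≠ 0) {S : ℝ} (hS : 0 ≤ S)
    (hgS : ∀ t ∈ Φ, A.h (flow b μ S y) t ≠ 0) :
    Relation.ReflTransGen (A.Step Φ) y (flow b μ S y) := by
  let X : Set ℝ := {s | 0 ≤ s ∧ s ≤ S ∧ (∀ t ∈ Φ, A.h (flow b μ s y) t ≠ 0) ∧
    Relation.ReflTransGen (A.Step Φ) y (flow b μ s y)}
  have h0 : (0 : ℝ) ∈ X := by
    refine ⟨le_rfl, hS, ?_, ?_⟩ <;> rw [flow_zero]
    exact hgen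
  have hbd : BddAbove X := ⟨S, fun s hs => hs.2.1⟩
  set c := sSup X
  have hcS : c ≤ S := csSup_le ⟨0, h0⟩ (fun s hs => hs.2.1)
  have hc0 : 0 ≤ c := le_csSup hbd h0
  obtain ⟨ε, hε, H⟩ := local_step hΦ hb hy c
  obtain ⟨s', hs', hlt⟩ := exists_lt_of_lt_csSup ⟨0, h0⟩ (show c - ε < sSup X by
    change c - ε < c; linarith)
  have hle : s' ≤ c := le_csSup hbd hs'
  have go : ∀ s'', c ≤ s'' → s'' < c + ε → (∀ t ∈ Φ, A.h (flow b μ s'' y) t ≠ 0) →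
      Relation.ReflTransGen (A.Step Φ) y (flow b μ s'' y) := fun s'' h1 h2 h3 =>
    hs'.2.2.2.tail (H s' s'' hlt hle h1 h2 hs'.2.2.1 h3)
  rcases hcS.eq_or_lt with e | hlt2
  · rw [← e] at hgS ⊢
    exact go c le_rfl (by linarith) hgS
  · exfalso
    have e1 := gen_right (b := b) (μ := μ) hgen c
    have e2 : ∀ᶠ s in 𝓝[>] c, s < min S (c + ε) :=
      eventually_nhdsWithin_of_eventually_nhds (gt_mem_nhds (lt_min hlt2 (by linarith)))
    obtain ⟨s, ⟨q1, q2⟩, q3⟩ := ((e1.and e2).and self_mem_nhdsWithin).exists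
    have q3' : c < s := q3
    have : s ∈ X := ⟨by linarith, (q2.le.trans (min_le_left _ _)), q1,
      go s q3'.le (q2.trans_le (min_le_right _ _)) q1⟩
    exact absurd (le_csSup hbd this) (not_le.2 q3')

end Arr
end GP

namespace GP
open Filter Topology
namespace Arr
variable {E T : Type*} [NormedAddCommGroup E] [InnerProductSpace ℝ E] {A : Arr E T}

lemma flow_main [FiniteDimensional ℝ E] [Finite T] {Φ : Finset T} (hΦ : ∀ t, A.p t ∈ Φ ↔ t ∈ Φ)
    (hne : Φ.Nonempty) :
    ∃ lam : ℝ, (∃ t ∈ Φ, ∃ q, A.g q + A.g.symm q = lam • q ∧ A.h q t ≠ 0) ∧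
      ∀ x, (∀ t ∈ Φ, A.h x t ≠ 0) → ∃ y p, Relation.ReflTransGen (A.Step Φ) x y ∧
        (∀ t ∈ Φ, A.h y t ≠ 0) ∧ A.g p + A.g.symm p = lam • p ∧
        ∀ t ∈ Φ, (∃ q, A.g q + A.g.symm q = lam • q ∧ A.h q t ≠ 0) → 0 < A.h p t * A.h y t := by
  classical
  obtain ⟨n, b, μ, hb⟩ := exists_eigenbasis A.g
  have hexp : ∀ q t, A.h q t = ∑ i, inner ℝ (b i) q * inner ℝ (b i) (A.α t) := by
    intro q t
    have := flow_inner b μ 0 q (A.α t)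
    simpa [flow_zero, h] using this
  let I : Finset (Fin n) := Finset.univ.filter (fun i => ∃ t ∈ Φ, A.h (b i) t ≠ 0)
  have hI : I.Nonempty := by
    obtain ⟨t, ht⟩ := hne
    by_contra hcon
    rw [Finset.not_nonempty_iff_eq_empty, Finset.filter_eq_empty_iff] at hcon
    apply A.hne t
    rw [← b.sum_repr' (A.α t)]
    apply Finset.sum_eq_zero
    intro i _
    have := hcon (Finset.mem_univ i)
    push Not at this
    rw [show inner ℝ (b i) (A.α t) = 0 from this t ht, zero_smul]
  obtain ⟨i0, hi0, hmax⟩ := I.exists_max_image μ hI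
  set lam := μ i0 with hlam
  refine ⟨lam, ?_, ?_⟩
  · obtain ⟨_, t, ht, h1⟩ := Finset.mem_filter.1 hi0
    exact ⟨t, ht, b i0, hb i0, h1⟩
  -- the projection to the eigenspace
  let P : E → E := fun y => ∑ i, (if μ i = lam then inner ℝ (b i) y else 0) • b i
  have hPK : ∀ y, A.g (P y) + A.g.symm (P y) = lam • P y := by
    intro y
    simp only [P, map_sum, map_smul, ← Finset.sum_add_distrib, ← smul_add, hb, Finset.smul_sum]
    apply Finset.sum_congr rfl
    intro i _
    split_ifs with h
    · rw [h, smul_comm]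
    · simp
  have hPin : ∀ y z, inner ℝ (P y) z =
      ∑ i, if μ i = lam then inner ℝ (b i) y * inner ℝ (b i) z else 0 := by
    intro y z
    simp only [P, sum_inner, inner_smul_left]
    apply Finset.sum_congr rfl
    intro i _
    split_ifs <;> simp
  have hPsym : ∀ y z, inner ℝ (P y) z = inner ℝ y (P z) := by
    intro y z
    rw [real_inner_comm _ y, hPin, hPin]
    apply Finset.sum_congr rfl
    intro i _
    split_ifs <;> ring
  have hbP : ∀ q, A.g q + A.g.symm q = lam • q → ∀ i, μ i ≠ lam → inner ℝ (b i) q = 0 := by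
    intro q hq i hi
    have h1 : inner ℝ (A.g (b i)) q = inner ℝ (b i) (A.g.symm q) := by
      rw [← A.g.inner_map_map (b i) (A.g.symm q)]; simp
    have h2 : inner ℝ (A.g.symm (b i)) q = inner ℝ (b i) (A.g q) := by
      rw [← A.g.inner_map_map (A.g.symm (b i)) q]; simp
    have h3 : inner ℝ (A.g (b i) + A.g.symm (b i)) q = inner ℝ (b i) (A.g q + A.g.symm q) := by
      rw [inner_add_left, inner_add_right, h1, h2, add_comm]
    rw [hb, hq, inner_smul_left, inner_smul_right] at h3
    simp only [conj_trivial] at h3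
    have h4 : (μ i - lam) * inner ℝ (b i) q = 0 := by linarith
    rcases mul_eq_zero.1 h4 with h | h
    · exact absurd (sub_eq_zero.1 h) hi
    · exact h
  have hPα : ∀ t, (∃ q, A.g q + A.g.symm q = lam • q ∧ A.h q t ≠ 0) → P (A.α t) ≠ 0 := by
    rintro t ⟨q, hq, hqt⟩ h0
    apply hqt
    have : inner ℝ q (P (A.α t)) = A.h q t := by
      rw [← hPsym, hPin, hexp]
      apply Finset.sum_congr rfl
      intro i _
      split_ifs with h
      · rfl
      · rw [hbP q hq i h, zero_mul]
    rw [← this, h0, inner_zero_right]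
  intro x hx
  have hE : 0 < Module.finrank ℝ E := by
    rw [Module.finrank_pos_iff_exists_ne_zero]
    obtain ⟨t, _⟩ := hne
    exact ⟨A.α t, A.hne t⟩
  have hd := dense_good b μ hE A.α A.hlin
    (Z := {t : T // ∃ q, A.g q + A.g.symm q = lam • q ∧ A.h q t ≠ 0})
    (fun t => P (A.α t.1)) (fun t => hPα t.1 t.2)
  let U : Set E := {y | ∀ t ∈ Φ, 0 < A.h x t * A.h y t}
  have hU : IsOpen U := by
    have : U = ⋂ t ∈ Φ, {y | 0 < A.h x t * A.h y t} := by ext; simp [U]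
    rw [this]
    apply isOpen_biInter_finset
    intro t _
    apply isOpen_lt continuous_const
    unfold h
    fun_prop
  obtain ⟨y, hyU, hy1, hy2⟩ := hd.inter_open_nonempty U hU
    ⟨x, fun t ht => mul_self_pos.2 (hx t ht)⟩
  have hygen : ∀ t ∈ Φ, A.h y t ≠ 0 := fun t ht h0 => by
    have := hyU t ht; rw [h0] at this; simp at this
  -- asymptotics
  have hlim : ∀ t ∈ Φ, Tendsto (fun s => Real.exp (-(s * lam)) * A.h (flow b μ s y) t) atTop
      (𝓝 (A.h (P y) t)) := by
    intro t ht
    have e1 : A.h (P y) t = ∑ i, if μ i = lam then inner ℝ (b i) y * inner ℝ (b i) (A.α t) else 0 :=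
      hPin y _
    rw [e1]
    simp only [h, flow_inner, Finset.mul_sum]
    apply tendsto_finsetSum
    intro i _
    have e2 : ∀ s : ℝ, Real.exp (-(s * lam)) * (Real.exp (s * μ i) *
        (inner ℝ (b i) y * inner ℝ (b i) (A.α t))) =
        Real.exp ((μ i - lam) * s) * (inner ℝ (b i) y * inner ℝ (b i) (A.α t)) := by
      intro s
      rw [← mul_assoc, ← Real.exp_add]; congr 2; ring
    simp only [e2]
    split_ifs with h
    · simp [h]
    · by_cases hi : i ∈ I
      · have hlt : μ i - lam < 0 := sub_neg.2 (lt_of_le_of_ne (hmax i hi) h)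
        have : Tendsto (fun s : ℝ => Real.exp ((μ i - lam) * s)) atTop (𝓝 0) :=
          Real.tendsto_exp_atBot.comp (tendsto_id.const_mul_atTop_of_neg hlt)
        simpa using this.mul_const (inner ℝ (b i) y * inner ℝ (b i) (A.α t))
      · have : inner ℝ (b i) (A.α t) = 0 := by
          by_contra hcon
          exact hi (Finset.mem_filter.2 ⟨Finset.mem_univ _, t, ht, hcon⟩)
        simp [this]
  have hev : ∀ᶠ s in atTop, ∀ t ∈ Φ, (∃ q, A.g q + A.g.symm q = lam • q ∧ A.h q t ≠ 0) →
      0 < A.h (P y) t * A.h (flow b μ s y) t := by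
    rw [Finset.eventually_all]
    intro t ht
    by_cases hq : ∃ q, A.g q + A.g.symm q = lam • q ∧ A.h q t ≠ 0
    · have hne : A.h (P y) t ≠ 0 := by
        have := hy2 ⟨t, hq⟩
        rwa [h, hPsym]
      have := (hlim t ht).const_mul (A.h (P y) t)
      filter_upwards [this.eventually (lt_mem_nhds (mul_self_pos.2 hne))] with s hs _
      have h5 : 0 < Real.exp (-(s * lam)) * (A.h (P y) t * A.h (flow b μ s y) t) := by
        linarith
      exact pos_of_mul_pos_right h5 (Real.exp_pos _).le
    · exact Eventually.of_forall (fun _ h => absurd h hq)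
  obtain ⟨S0, hS0⟩ := eventually_atTop.1 hev
  obtain ⟨S, hS1, hS2⟩ := ((gen_right (b := b) (μ := μ) hygen (max S0 0)).and
    self_mem_nhdsWithin).exists
  have hS2' : max S0 0 < S := hS2
  refine ⟨flow b μ S y, P y, ?_, hS1, hPK y, hS0 S ((le_max_left _ _).trans hS2'.le)⟩
  exact (Relation.ReflTransGen.single (step_of_same hΦ hyU)).trans
    (reach_flow hΦ hb hy1 hygen ((le_max_right _ _).trans hS2'.le) hS1)

lemma exists_lift {Φ : Finset T} {q u : E} (hu : ∀ t ∈ Φ, A.h q t = 0 → A.h u t ≠ 0) :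
    ∃ u', (∀ t ∈ Φ, A.h u' t ≠ 0) ∧ (∀ t ∈ Φ, A.h q t = 0 → 0 < A.h u t * A.h u' t) ∧
      ∀ t ∈ Φ, A.h q t ≠ 0 → 0 < A.h q t * A.h u' t := by
  have ev : ∀ᶠ e in 𝓝[>] (0 : ℝ), ∀ t ∈ Φ, A.h q t ≠ 0 → 0 < A.h q t * A.h (q + e • u) t := by
    rw [Finset.eventually_all]
    intro t _
    by_cases h0 : A.h q t = 0
    · exact Eventually.of_forall (fun _ h => absurd h0 h)
    · have hc : Continuous (fun e : ℝ => A.h q t * A.h (q + e • u) t) := by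
        simp only [h_add, h_smul]; fun_prop
      have := hc.tendsto 0
      simp only [zero_smul, add_zero] at this
      exact eventually_nhdsWithin_of_eventually_nhds
        ((this.eventually (lt_mem_nhds (mul_self_pos.2 h0))).mono (fun _ h _ => h))
  obtain ⟨e, he, hpos⟩ := (ev.and self_mem_nhdsWithin).exists
  have hpos' : (0 : ℝ) < e := hpos
  have h2 : ∀ t ∈ Φ, A.h q t = 0 → 0 < A.h u t * A.h (q + e • u) t := by
    intro t ht h0
    rw [h_add, h_smul, h0, zero_add]
    have := mul_pos hpos' (mul_self_pos.2 (hu t ht h0))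
    linarith
  refine ⟨q + e • u, ?_, h2, he⟩
  intro t ht hz
  by_cases h0 : A.h q t = 0
  · have := h2 t ht h0; rw [hz] at this; simp at this
  · have := he t ht h0; rw [hz] at this; simp at this

theorem arr_main [FiniteDimensional ℝ E] [Finite T] (A : Arr E T) (Φ : Finset T) :
    (∀ t, A.p t ∈ Φ ↔ t ∈ Φ) → ∀ x, (∀ t ∈ Φ, A.h x t ≠ 0) →
    ∃ y, Relation.ReflTransGen (A.Step Φ) x y ∧ (∀ t ∈ Φ, A.h y t ≠ 0) ∧
      ∀ z, (∀ t ∈ Φ, A.h z t ≠ 0) → A.d Φ y ≤ A.d Φ z := by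
  classical
  induction Φ using Finset.strongInduction with
  | H Φ ih =>
  intro hΦ x hx
  rcases Φ.eq_empty_or_nonempty with rfl | hne
  · exact ⟨x, .refl, hx, fun z _ => by simp [d]⟩
  obtain ⟨lam, ⟨t1, ht1, q1, hq1, hqt1⟩, H⟩ := flow_main hΦ hne
  let R : T → Prop := fun t => ∃ q, A.g q + A.g.symm q = lam • q ∧ A.h q t ≠ 0
  have hR : ∀ t, R (A.p t) ↔ R t := by
    intro t
    constructor
    · rintro ⟨q, h1, h2⟩
      refine ⟨A.g.symm q, ?_, ?_⟩
      · have := congrArg A.g.symm h1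
        rw [map_add, map_smul] at this
        simpa using this
      · rw [← h_g_ne]; simpa using h2
    · rintro ⟨q, h1, h2⟩
      refine ⟨A.g q, ?_, ?_⟩
      · have := congrArg A.g h1
        rw [map_add, map_smul] at this
        simpa using this
      · rw [h_g_ne]; exact h2
  let Φ' := Φ.filter (fun t => ¬ R t)
  let Ψ := Φ.filter R
  have hΦ' : ∀ t, A.p t ∈ Φ' ↔ t ∈ Φ' := by
    intro t; simp only [Φ', Finset.mem_filter, hΦ, hR]
  have hΨ : ∀ t, A.p t ∈ Ψ ↔ t ∈ Ψ := by
    intro t; simp only [Ψ, Finset.mem_filter, hΦ, hR]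
  have hsub : Φ' ⊂ Φ := by
    rw [Finset.ssubset_iff_subset_ne]
    refine ⟨Finset.filter_subset _ _, fun e => ?_⟩
    rw [← e] at ht1
    exact (Finset.mem_filter.1 ht1).2 ⟨q1, hq1, hqt1⟩
  have dsplit : ∀ z, A.d Φ z = A.d Ψ z + A.d Φ' z := by
    intro z
    rw [d_eq_sum, d_eq_sum, d_eq_sum]
    exact (Finset.sum_filter_add_sum_filter_not Φ R _).symm
  have hrec : ∀ q, A.g q + A.g.symm q = lam • q → A.g (A.g q) + q = lam • A.g q := by
    intro q h1
    have := congrArg A.g h1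
    rw [map_add, map_smul] at this
    simpa using this
  obtain ⟨y, p, hxy, hy, hpK, hpy⟩ := H x hx
  have hpΨ : ∀ t ∈ Φ, R t → A.h p t ≠ 0 := fun t ht hr h0 => by
    have := hpy t ht hr; rw [h0] at this; simp at this
  have hpΦ' : ∀ t, ¬ R t → A.h p t = 0 := fun t hr => by
    by_contra h0; exact hr ⟨p, hpK, h0⟩
  obtain ⟨z, hyz, hz, hzmin⟩ := ih Φ' hsub hΦ' y (fun t ht => hy t (Finset.mem_filter.1 ht).1)
  -- lifting
  let Lft : E → E → Prop := fun u u' => (∀ t ∈ Φ', 0 < A.h u t * A.h u' t) ∧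
    ∀ t ∈ Ψ, 0 < A.h p t * A.h u' t
  have Lgen : ∀ u u', Lft u u' → ∀ t ∈ Φ, A.h u' t ≠ 0 := by
    rintro u u' ⟨h1, h2⟩ t ht h0
    by_cases hr : R t
    · have := h2 t (Finset.mem_filter.2 ⟨ht, hr⟩); rw [h0] at this; simp at this
    · have := h1 t (Finset.mem_filter.2 ⟨ht, hr⟩); rw [h0] at this; simp at this
  have Lex : ∀ u, (∀ t ∈ Φ', A.h u t ≠ 0) → ∃ u', Lft u u' := by
    intro u hu
    obtain ⟨u', _, h1, h2⟩ := exists_lift (A := A) (Φ := Φ) (q := p) (u := u) (fun t ht h0 =>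
      hu t (Finset.mem_filter.2 ⟨ht, fun hr => hpΨ t ht hr h0⟩))
    refine ⟨u', fun t ht => ?_, fun t ht => ?_⟩
    · rw [Finset.mem_filter] at ht
      exact h1 t ht.1 (hpΦ' t ht.2)
    · rw [Finset.mem_filter] at ht
      exact h2 t ht.1 (hpΨ t ht.1 ht.2)
  have Ld : ∀ u u', Lft u u' → A.d Φ u' = A.d Ψ p + A.d Φ' u := by
    rintro u u' ⟨h1, h2⟩
    rw [dsplit, ← d_congr hΨ h2, ← d_congr hΦ' h1]
  have Lstep : ∀ u v u' v', Lft u u' → Lft v v' → A.Step Φ' u v → A.Step Φ u' v' := by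
    rintro u v u' v' hu hv ⟨_, s2, s3⟩
    refine ⟨Lgen _ _ hv, ?_, ?_⟩
    · refine (Finset.card_le_card ?_).trans s2
      intro t ht
      rw [Finset.mem_filter] at ht
      by_cases hr : R t
      · exfalso
        have m : t ∈ Ψ := Finset.mem_filter.2 ⟨ht.1, hr⟩
        have p1 := mul_pos (hu.2 t m) (hv.2 t m)
        have p2 := mul_self_pos.2 (hpΨ t ht.1 hr)
        have : (A.h u' t * A.h v' t) * (A.h p t * A.h p t) < 0 := mul_neg_of_neg_of_pos ht.2 p2
        linarith
      · have m : t ∈ Φ' := Finset.mem_filter.2 ⟨ht.1, hr⟩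
        rw [Finset.mem_filter]
        exact ⟨m, (mul_neg_iff_of_same (hu.1 t m) (hv.1 t m)).2 ht.2⟩
    · rw [Ld _ _ hu, Ld _ _ hv]; omega
  have hyL : Lft y y := by
    refine ⟨fun t ht => mul_self_pos.2 (hy t (Finset.mem_filter.1 ht).1), fun t ht => ?_⟩
    rw [Finset.mem_filter] at ht
    exact hpy t ht.1 ht.2
  have Lreach : ∀ z, Relation.ReflTransGen (A.Step Φ') y z →
      ∃ z', Lft z z' ∧ Relation.ReflTransGen (A.Step Φ) y z' := by
    intro z hz
    induction hz with
    | refl => exact ⟨y, hyL, .refl⟩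
    | @tail u v _ huv ih2 =>
      obtain ⟨u', hu', hr⟩ := ih2
      obtain ⟨v', hv'⟩ := Lex v huv.1
      exact ⟨v', hv', hr.tail (Lstep _ _ _ _ hu' hv' huv)⟩
  obtain ⟨z', hzz', hyz'⟩ := Lreach z hyz
  refine ⟨z', hxy.trans hyz', Lgen _ _ hzz', ?_⟩
  intro m hm
  obtain ⟨y2, p2, hmy2, hy2, hp2K, hp2y⟩ := H m hm
  have hmono : ∀ m', Relation.ReflTransGen (A.Step Φ) m m' → A.d Φ m' ≤ A.d Φ m := by
    intro m' hm'
    induction hm' with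
    | refl => rfl
    | tail _ h1 h2 => exact h1.2.2.trans h2
  refine le_trans ?_ (hmono _ hmy2)
  have e1 : A.d Ψ p2 = A.d Ψ y2 := d_congr hΨ (fun t ht => by
    rw [Finset.mem_filter] at ht; exact hp2y t ht.1 ht.2)
  have e2 : A.d Ψ p = A.d Ψ p2 := by
    refine d_const hΨ (fun t ht => ?_) (fun t ht => ?_) (hrec _ hpK) (hrec _ hp2K)
    · rw [Finset.mem_filter] at ht; exact hpΨ t ht.1 ht.2
    · rw [Finset.mem_filter] at ht
      intro h0
      have := hp2y t ht.1 ht.2; rw [h0] at this; simp at this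
  rw [Ld _ _ hzz', dsplit y2, ← e1, ← e2]
  have := hzmin y2 (fun t ht => hy2 t (Finset.mem_filter.1 ht).1)
  omega

end Arr
end GP

namespace GP
open CoxeterSystem

section rep
variable {B : Type*} (M : CoxeterMatrix B)

/-- `2 β(e_i, ·)` for the Tits form `β`. -/
noncomputable def phi (i : B) : (B →₀ ℝ) →ₗ[ℝ] ℝ :=
  Finsupp.linearCombination ℝ (fun j => -(2 * Real.cos (Real.pi / M i j)))

/-- basis vector -/
noncomputable def e (i : B) : B →₀ ℝ := Finsupp.single i 1

/-- simple reflection -/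
noncomputable def sig (i : B) : Module.End ℝ (B →₀ ℝ) :=
  LinearMap.id - (phi M i).smulRight (e i)

lemma phi_e (i j : B) : phi M i (e j) = -(2 * Real.cos (Real.pi / M i j)) := by
  simp [phi, e]

lemma phi_self (i : B) : phi M i (e i) = 2 := by
  rw [phi_e, M.diagonal]; simp

lemma sig_apply (i : B) (v : B →₀ ℝ) : sig M i v = v - phi M i v • e i := by
  simp [sig]

lemma sig_self (i : B) : sig M i (e i) = - e i := by
  rw [sig_apply, phi_self, two_smul]; abel

lemma sig_sq (i : B) : sig M i * sig M i = 1 := by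
  ext1 v
  apply LinearMap.ext
  intro r
  simp only [LinearMap.comp_apply, Module.End.mul_apply, Module.End.one_apply]
  rw [sig_apply M i (sig M i _), sig_apply, map_sub, map_smul, phi_self]
  simp only [smul_eq_mul]
  module

/-- Chebyshev-like recursion -/
noncomputable def u (c : ℝ) : ℕ → ℝ
  | 0 => 0
  | 1 => 1
  | (k + 2) => 2 * c * u c (k + 1) - u c k

lemma u_sin (θ : ℝ) (k : ℕ) : u (Real.cos θ) k * Real.sin θ = Real.sin (k * θ) := by
  induction k using Nat.twoStepInduction with
  | zero => simp [u]
  | one => simp [u]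
  | more k h1 h2 =>
    rw [u, sub_mul, mul_assoc, h2, h1]
    have e1 : ((k + 1 + 1 : ℕ) : ℝ) * θ = ((k + 1 : ℕ) : ℝ) * θ + θ := by push_cast; ring
    have e2 : (k : ℝ) * θ = ((k + 1 : ℕ) : ℝ) * θ - θ := by push_cast; ring
    rw [e1, e2, Real.sin_add, Real.sin_sub]; ring

lemma u_one (k : ℕ) : u 1 k = k := by
  induction k using Nat.twoStepInduction with
  | zero => simp [u]
  | one => simp [u]
  | more k h1 h2 => rw [u, h1, h2]; push_cast; ring

lemma sin_pos_of {m : ℕ} (hm : 2 ≤ m) : 0 < Real.sin (Real.pi / m) := by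
  have : (2 : ℝ) ≤ m := by exact_mod_cast hm
  apply Real.sin_pos_of_pos_of_lt_pi
  · exact div_pos Real.pi_pos (by linarith)
  · rw [div_lt_iff₀ (by linarith)]; nlinarith [Real.pi_pos]

lemma u_nonneg {m : ℕ} (hm : m ≠ 1) {k : ℕ} (hk : m ≠ 0 → k ≤ m) :
    0 ≤ u (Real.cos (Real.pi / m)) k := by
  by_cases h0 : m = 0
  · subst h0; simp [u_one]
  · have h2 : 2 ≤ m := by omega
    have hs := sin_pos_of h2
    have h3 := u_sin (Real.pi / m) k
    have hm' : (0 : ℝ) < m := by exact_mod_cast (by omega : 0 < m)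
    have h4 : 0 ≤ Real.sin (k * (Real.pi / m)) := by
      apply Real.sin_nonneg_of_nonneg_of_le_pi
      · have := Real.pi_pos; positivity
      · rw [← mul_div_assoc, div_le_iff₀ hm']
        have : (k : ℝ) ≤ m := by exact_mod_cast hk h0
        nlinarith [Real.pi_pos]
    rw [← h3] at h4
    exact nonneg_of_mul_nonneg_left h4 hs

/-- twice the cosine -/
noncomputable abbrev cc (i j : B) : ℝ := Real.cos (Real.pi / M i j)

lemma cc_symm (i j : B) : cc M i j = cc M j i := by
  unfold cc; rw [M.symmetric]

lemma sig_comb_left (i j : B) (x y : ℝ) :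
    sig M i (x • e i + y • e j) = (2 * cc M i j * y - x) • e i + y • e j := by
  rw [sig_apply, map_add, map_smul, map_smul, phi_self, phi_e]
  simp only [smul_eq_mul]
  module

lemma pow_apply (i j : B) (k : ℕ) : ((sig M i * sig M j) ^ k) (e i) =
    u (cc M i j) (2 * k + 1) • e i + u (cc M i j) (2 * k) • e j := by
  induction k with
  | zero => simp [u]
  | succ k ih =>
    rw [pow_succ', Module.End.mul_apply, ih, Module.End.mul_apply, add_comm, sig_comb_left,
      add_comm, sig_comb_left, cc_symm M j i]
    rw [show 2 * (k + 1) + 1 = (2 * k + 1) + 2 by ring, show 2 * (k + 1) = (2 * k) + 2 by ring]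
    rw [u, u]

lemma pow_e (i j : B) (hij : i ≠ j) : ((sig M i * sig M j) ^ (M i j)) (e i) = e i := by
  by_cases h0 : M i j = 0
  · rw [h0]; simp
  have h1 := M.off_diagonal i j hij
  have hs := sin_pos_of (show 2 ≤ M i j by omega)
  have hm : (M i j : ℝ) ≠ 0 := by exact_mod_cast h0
  rw [pow_apply]
  have a1 := u_sin (Real.pi / M i j) (2 * M i j)
  have a2 := u_sin (Real.pi / M i j) (2 * M i j + 1)
  have e1 : ((2 * M i j : ℕ) : ℝ) * (Real.pi / M i j) = 2 * Real.pi := by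
    push_cast; field_simp
  have e2 : ((2 * M i j + 1 : ℕ) : ℝ) * (Real.pi / M i j) = Real.pi / M i j + 2 * Real.pi := by
    push_cast; field_simp; ring
  rw [e1, Real.sin_two_pi] at a1
  rw [e2, Real.sin_add_two_pi] at a2
  have b1 : u (cc M i j) (2 * M i j) = 0 := (mul_eq_zero.1 a1).resolve_right hs.ne'
  have b2 : u (cc M i j) (2 * M i j + 1) = 1 := by
    have : (u (cc M i j) (2 * M i j + 1) - 1) * Real.sin (Real.pi / M i j) = 0 := by
      rw [sub_mul, one_mul]; exact sub_eq_zero.2 a2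
    linarith [(mul_eq_zero.1 this).resolve_right hs.ne']
  rw [b1, b2]; simp

lemma pow_swap (i j : B) (k : ℕ) :
    (sig M i * sig M j) ^ k * (sig M j * sig M i) ^ k = 1 := by
  have h : (sig M i * sig M j) * (sig M j * sig M i) = 1 := by
    rw [mul_assoc, ← mul_assoc (sig M j), sig_sq, one_mul, sig_sq]
  have h' : (sig M j * sig M i) * (sig M i * sig M j) = 1 := by
    rw [mul_assoc, ← mul_assoc (sig M i), sig_sq, one_mul, sig_sq]
  have hc : Commute (sig M i * sig M j) (sig M j * sig M i) := by
    rw [Commute, SemiconjBy, h, h']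
  rw [← hc.mul_pow, h, one_pow]

lemma liftable : M.IsLiftable (sig M) := by
  intro i j
  by_cases hij : i = j
  · subst hij; rw [sig_sq, one_pow]
  by_cases h0 : M i j = 0
  · rw [h0, pow_zero]
  have h1 := M.off_diagonal i j hij
  have hs := sin_pos_of (show 2 ≤ M i j by omega)
  have hi := pow_e M i j hij
  have hj : ((sig M i * sig M j) ^ (M i j)) (e j) = e j := by
    have := pow_e M j i (Ne.symm hij)
    rw [M.symmetric j i] at this
    conv_lhs => rw [← this, ← Module.End.mul_apply, pow_swap]
    simp
  apply LinearMap.ext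
  intro v
  set c := cc M i j with hc
  have hdet : 1 - c ^ 2 ≠ 0 := by
    have := Real.sin_sq_add_cos_sq (Real.pi / M i j)
    have h3 : c ^ 2 = Real.cos (Real.pi / M i j) ^ 2 := rfl
    nlinarith
  -- decomposition
  let a := (phi M i v + c * phi M j v) / (2 * (1 - c ^ 2))
  let b := (phi M j v + c * phi M i v) / (2 * (1 - c ^ 2))
  set r := v - (a • e i + b • e j) with hr
  have r1 : phi M i r = 0 := by
    rw [hr, map_sub, map_add, map_smul, map_smul, phi_self, phi_e]
    simp only [smul_eq_mul, a, b]
    rw [show Real.cos (Real.pi / M i j) = c from rfl]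
    field_simp; ring
  have r2 : phi M j r = 0 := by
    rw [hr, map_sub, map_add, map_smul, map_smul, phi_self, phi_e, M.symmetric j i]
    simp only [smul_eq_mul, a, b]
    rw [show Real.cos (Real.pi / M i j) = c from rfl]
    field_simp; ring
  have fix : ∀ k : ℕ, ((sig M i * sig M j) ^ k) r = r := by
    intro k
    induction k with
    | zero => simp
    | succ k ih =>
      rw [pow_succ', Module.End.mul_apply, ih, Module.End.mul_apply, sig_apply M j, r2, zero_smul,
        sub_zero, sig_apply, r1, zero_smul, sub_zero]
  have hv : v = r + (a • e i + b • e j) := by rw [hr]; abel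
  rw [hv, map_add, map_add, map_smul, map_smul, hi, hj, fix]; simp

variable {W : Type*} [Group W] {M} (cs : CoxeterSystem M W)

/-- the geometric representation -/
noncomputable def rho : W →* Module.End ℝ (B →₀ ℝ) := cs.lift ⟨sig M, liftable M⟩

lemma rho_simple (i : B) : rho cs (cs.simple i) = sig M i := by
  rw [rho]; exact cs.lift_apply_simple (liftable M) i

lemma rho_mul (w w' : W) (v : B →₀ ℝ) : rho cs (w * w') v = rho cs w (rho cs w' v) := by
  rw [map_mul]; rfl

lemma rho_inv_rho (w : W) (v : B →₀ ℝ) : rho cs w⁻¹ (rho cs w v) = v := by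
  rw [← rho_mul]; simp

lemma rho_rho_inv (w : W) (v : B →₀ ℝ) : rho cs w (rho cs w⁻¹ v) = v := by
  rw [← rho_mul]; simp

lemma rho_alt (i j : B) (k : ℕ) : rho cs (cs.wordProd (alternatingWord i j k)) (e i) =
    if Even k then u (cc M i j) (k + 1) • e i + u (cc M i j) k • e j
    else u (cc M i j) (k + 1) • e j + u (cc M i j) k • e i := by
  induction k with
  | zero => simp [alternatingWord, u]
  | succ k ih =>
    rw [alternatingWord_succ', cs.wordProd_cons, rho_mul, ih, rho_simple]
    by_cases hk : Even k
    · have : ¬ Even (k + 1) := by rw [Nat.even_add_one]; simpa using hk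
      rw [if_pos hk, if_pos hk, if_neg this, add_comm, sig_comb_left, cc_symm M j i, u]
    · have : Even (k + 1) := by rw [Nat.even_add_one]; exact hk
      rw [if_neg hk, if_neg hk, if_pos this, add_comm, sig_comb_left, u]

lemma e_nonneg (i : B) : 0 ≤ (e i : B →₀ ℝ) := by
  rw [e]; simp

theorem rho_pos : ∀ (n : ℕ) (w : W), cs.length w = n → ∀ i, ¬ cs.IsRightDescent w i →
    0 ≤ rho cs w (e i) := by
  intro n
  induction n using Nat.strong_induction_on with
  | _ n ih =>
  intro w hw i hi
  by_cases h1 : w = 1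
  · rw [h1]; simpa using e_nonneg i
  obtain ⟨j, hj⟩ := cs.exists_rightDescent_of_ne_one h1
  have hij : i ≠ j := fun h => hi (h ▸ hj)
  classical
  let Q : ℕ → Prop := fun k => ∃ v, w = v * cs.wordProd (alternatingWord i j k) ∧
    cs.length w = cs.length v + k
  have hQ1 : Q 1 := by
    refine ⟨w * cs.simple j, ?_, ?_⟩
    · simp [alternatingWord]
    · rw [cs.isRightDescent_iff] at hj; omega
  set k := Nat.findGreatest Q n with hk
  have hn1 : 1 ≤ n := by
    obtain ⟨v, _, h⟩ := hQ1; omega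
  have hQk : Q k := Nat.findGreatest_spec hn1 hQ1
  have hk1 : 1 ≤ k := Nat.le_findGreatest hn1 hQ1
  obtain ⟨v, hv, hl⟩ := hQk
  have hmax : ¬ Q (k + 1) := by
    intro h
    have : k + 1 ≤ n := by obtain ⟨v, _, h⟩ := h; omega
    have := Nat.le_findGreatest this h
    omega
  have nd1 : ¬ cs.IsRightDescent v (if Even k then j else i) := by
    intro h
    rw [cs.isRightDescent_iff] at h
    apply hmax
    refine ⟨v * cs.simple (if Even k then j else i), ?_, by omega⟩
    rw [alternatingWord_succ', cs.wordProd_cons, hv]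
    simp [mul_assoc]
  have nd2 : ¬ cs.IsRightDescent v (if Even k then i else j) := by
    intro h
    rw [cs.isRightDescent_iff] at h
    obtain ⟨k', hk'⟩ : ∃ k', k = k' + 1 := ⟨k - 1, by omega⟩
    have hpar : (if Even k then i else j) = (if Even k' then j else i) := by
      have hE : Even k ↔ ¬ Even k' := by rw [hk', Nat.even_add_one]
      by_cases h : Even k' <;> simp [hE, h]
    rw [hpar] at h
    have e1 : w = (v * cs.simple (if Even k' then j else i)) *
        cs.wordProd (alternatingWord i j k') := by
      rw [hv, hk', alternatingWord_succ', cs.wordProd_cons]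
      simp [mul_assoc]
    have l1 := cs.length_mul_le (v * cs.simple (if Even k' then j else i))
      (cs.wordProd (alternatingWord i j k'))
    have l2 := cs.length_wordProd_le (alternatingWord i j k')
    rw [length_alternatingWord] at l2
    rw [← e1] at l1
    omega
  have ndi : ¬ cs.IsRightDescent v i := by
    by_cases h : Even k <;> simp only [h, if_true, if_false] at nd1 nd2 <;> assumption
  have ndj : ¬ cs.IsRightDescent v j := by
    by_cases h : Even k <;> simp only [h, if_true, if_false] at nd1 nd2 <;> assumption
  have hvi := ih (cs.length v) (by omega) v rfl i ndi
  have hvj := ih (cs.length v) (by omega) v rfl j ndj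
  have hkm : M i j ≠ 0 → k + 1 ≤ M i j := by
    intro h0
    by_contra hcon
    have r := cs.not_isReduced_alternatingWord j i (m := k + 1) (by rwa [M.symmetric])
      (by rw [M.symmetric]; omega)
    rw [alternatingWord_succ] at r
    have l2 := cs.length_wordProd_le ((alternatingWord i j k).concat i)
    rw [CoxeterSystem.IsReduced] at r
    have l3 : ((alternatingWord i j k).concat i).length = k + 1 := by simp
    have l4 := cs.length_mul_le v (cs.wordProd ((alternatingWord i j k).concat i))
    rw [cs.wordProd_concat, ← mul_assoc, ← hv] at l4
    rw [cs.not_isRightDescent_iff] at hi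
    rw [cs.wordProd_concat] at r l2
    omega
  have hm1 := M.off_diagonal i j hij
  have p1 : 0 ≤ u (cc M i j) (k + 1) := u_nonneg hm1 hkm
  have p2 : 0 ≤ u (cc M i j) k := u_nonneg hm1 (fun h => by have := hkm h; omega)
  rw [hv, rho_mul, rho_alt]
  split_ifs <;> rw [map_add, map_smul, map_smul] <;>
    exact add_nonneg (smul_nonneg p1 (by assumption)) (smul_nonneg p2 (by assumption))

theorem rho_neg (w : W) (i : B) (h : cs.IsRightDescent w i) : rho cs w (e i) ≤ 0 := by
  rw [cs.isRightDescent_iff_not_isRightDescent_mul] at h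
  have := rho_pos cs _ _ rfl i h
  rw [rho_mul, rho_simple, sig_self, map_neg] at this
  simpa using this

lemma e_ne (i : B) : (e i : B →₀ ℝ) ≠ 0 := by simp [e]

lemma simple_inj : Function.Injective cs.simple := by
  intro i j hij
  by_contra hne
  have h1 := rho_simple cs i
  rw [hij, rho_simple] at h1
  have h2 := congrArg (fun f => f (e i) i) h1
  simp only [sig_self, sig_apply M j] at h2
  simp [e, hne, Finsupp.single_apply, Ne.symm hne] at h2
  norm_num at h2

lemma order_simple (i j : B) (hij : i ≠ j) (k : ℕ) (hk : (cs.simple i * cs.simple j) ^ k = 1) :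
    M i j ∣ k := by
  have h1 := congrArg (fun w => rho cs w (e i)) hk
  simp only [map_pow, map_mul, rho_simple, map_one, pow_apply, Module.End.one_apply] at h1
  have hi := congrArg (fun f => f i) h1
  have hj := congrArg (fun f => f j) h1
  simp [e, Finsupp.single_apply, hij, Ne.symm hij] at hi hj
  by_cases h0 : M i j = 0
  · unfold cc at hj
    rw [h0] at hj ⊢
    simp [u_one] at hj
    simp [hj]
  have h1 := M.off_diagonal i j hij
  have hm : (M i j : ℝ) ≠ 0 := by exact_mod_cast h0
  have a1 := u_sin (Real.pi / M i j) (2 * k)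
  have a2 := u_sin (Real.pi / M i j) (2 * k + 1)
  unfold cc at hi hj
  have hs := sin_pos_of (show 2 ≤ M i j by omega)
  rw [hj, zero_mul] at a1
  rw [hi, one_mul] at a2
  have e2 : ((2 * k + 1 : ℕ) : ℝ) * (Real.pi / M i j) = ((2 * k : ℕ) : ℝ) * (Real.pi / M i j)
    + Real.pi / M i j := by push_cast; ring
  rw [e2, Real.sin_add, ← a1, zero_mul, zero_add] at a2
  have a3 : Real.cos (((2 * k : ℕ) : ℝ) * (Real.pi / M i j)) = 1 := by
    have : (Real.cos (((2 * k : ℕ) : ℝ) * (Real.pi / M i j)) - 1) * Real.sin (Real.pi / M i j) = 0 := by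
      linarith
    linarith [(mul_eq_zero.1 this).resolve_right hs.ne']
  rw [Real.cos_eq_one_iff] at a3
  obtain ⟨n, hn⟩ := a3
  have : (n : ℝ) * M i j = k := by
    push_cast at hn
    field_simp at hn
    linarith
  have h5 : n * (M i j : ℤ) = k := by exact_mod_cast this
  have : (M i j : ℤ) ∣ k := ⟨n, by rw [← h5, mul_comm]⟩
  exact_mod_cast this

end rep
end GP

namespace GP
open CoxeterSystem

section roots
variable {B W : Type*} [Group W] {M : CoxeterMatrix B}

/-- twice the Tits form -/
noncomputable def beta (M : CoxeterMatrix B) : (B →₀ ℝ) →ₗ[ℝ] (B →₀ ℝ) →ₗ[ℝ] ℝ :=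
  Finsupp.linearCombination ℝ (phi M)

lemma beta_e (i : B) : beta M (e i) = phi M i := by
  simp [beta, e]

lemma beta_symm (v w : B →₀ ℝ) : beta M v w = beta M w v := by
  have : beta M = (beta M).flip := by
    apply Finsupp.lhom_ext'
    intro i
    apply LinearMap.ext_ring
    apply Finsupp.lhom_ext'
    intro j
    apply LinearMap.ext_ring
    change beta M (e i) (e j) = beta M (e j) (e i)
    rw [beta_e, beta_e, phi_e, phi_e, M.symmetric]
  conv_lhs => rw [this]
  rfl

lemma beta_sig (i : B) (v w : B →₀ ℝ) : beta M (sig M i v) (sig M i w) = beta M v w := by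
  rw [sig_apply, sig_apply]
  simp only [map_sub, map_smul, LinearMap.sub_apply, LinearMap.smul_apply, beta_e, phi_self,
    smul_eq_mul]
  rw [beta_symm v (e i), beta_e]; ring

variable (cs : CoxeterSystem M W)

lemma beta_rho (x : W) (v w : B →₀ ℝ) : beta M (rho cs x v) (rho cs x w) = beta M v w := by
  induction x using cs.simple_induction_left with
  | one => simp
  | mul_simple_left x i ih => rw [rho_mul, rho_mul, rho_simple, beta_sig, ih]

/-- roots -/
def IsRoot (v : B →₀ ℝ) : Prop := ∃ w i, v = rho cs w (e i)

/-- positive roots -/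
abbrev PR := {v : B →₀ ℝ // IsRoot cs v ∧ 0 ≤ v}

variable {cs}

lemma IsRoot.beta {v : B →₀ ℝ} (h : IsRoot cs v) : beta M v v = 2 := by
  obtain ⟨w, i, rfl⟩ := h
  rw [beta_rho, beta_e, phi_self]

lemma IsRoot.ne {v : B →₀ ℝ} (h : IsRoot cs v) : v ≠ 0 := by
  rintro rfl
  have := h.beta
  simp at this

lemma IsRoot.rho {v : B →₀ ℝ} (h : IsRoot cs v) (w : W) : IsRoot cs (rho cs w v) := by
  obtain ⟨w', i, rfl⟩ := h
  exact ⟨w * w', i, by rw [rho_mul]⟩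

lemma isRoot_e (i : B) : IsRoot cs (e i) := ⟨1, i, by simp⟩

lemma IsRoot.neg {v : B →₀ ℝ} (h : IsRoot cs v) : IsRoot cs (-v) := by
  obtain ⟨w', i, rfl⟩ := h
  exact ⟨w' * cs.simple i, i, by rw [rho_mul, rho_simple, sig_self, map_neg]⟩

lemma IsRoot.pos_or {v : B →₀ ℝ} (h : IsRoot cs v) : 0 ≤ v ∨ 0 ≤ -v := by
  obtain ⟨w, i, rfl⟩ := h
  by_cases hd : cs.IsRightDescent w i
  · right; simpa using rho_neg cs w i hd
  · left; exact rho_pos cs _ w rfl i hd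

lemma not_both {v : B →₀ ℝ} (h : IsRoot cs v) (h1 : 0 ≤ v) (h2 : 0 ≤ -v) : False :=
  h.ne (le_antisymm (by simpa using h2) h1)

lemma IsRoot.prop {v v' : B →₀ ℝ} (h : IsRoot cs v) (h' : IsRoot cs v') (p : 0 ≤ v) (p' : 0 ≤ v')
    (c : ℝ) (hc : v = c • v') : v = v' := by
  have h1 := h.beta
  rw [hc, map_smul, map_smul, LinearMap.smul_apply, h'.beta] at h1
  simp only [smul_eq_mul] at h1
  have h2 : (c - 1) * (c + 1) = 0 := by linarith
  rcases mul_eq_zero.1 h2 with h3 | h3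
  · rw [hc, show c = 1 by linarith, one_smul]
  · rw [show c = -1 by linarith, neg_one_smul] at hc
    exact (not_both h p (by rw [hc, neg_neg]; exact p')).elim

lemma sig_pos {v : B →₀ ℝ} (h : IsRoot cs v) (p : 0 ≤ v) (i : B) (hv : v ≠ e i) :
    IsRoot cs (sig M i v) ∧ 0 ≤ sig M i v := by
  have hr : IsRoot cs (sig M i v) := by rw [← rho_simple cs]; exact h.rho _
  refine ⟨hr, ?_⟩
  rcases hr.pos_or with h1 | h1
  · exact h1
  exfalso
  apply hv
  apply h.prop (isRoot_e i) p (e_nonneg i) (v i)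
  ext j
  by_cases hj : i = j
  · subst hj; simp [e]
  · have h2 := h1 j
    have h3 := p j
    rw [sig_apply] at h2
    simp [e, hj] at h2 h3 ⊢
    linarith

lemma pos_of_simple {f : (B →₀ ℝ) →ₗ[ℝ] ℝ} (hf : ∀ i, 0 < f (e i)) {v : B →₀ ℝ} (p : 0 ≤ v)
    (h : v ≠ 0) : 0 < f v := by
  have hv : f v = ∑ i ∈ v.support, v i * f (e i) := by
    conv_lhs => rw [← Finsupp.sum_single v, Finsupp.sum, map_sum]
    apply Finset.sum_congr rfl
    intro i _
    rw [e, ← smul_eq_mul, ← map_smul]; simp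
  rw [hv]
  apply Finset.sum_pos
  · intro i hi
    have : v i ≠ 0 := by simpa using hi
    exact mul_pos (lt_of_le_of_ne (p i) this.symm) (hf i)
  · simpa using h

variable (cs)

lemma finite_B {B W : Type*} [Group W] {M : CoxeterMatrix B} (cs : CoxeterSystem M W)
    [Finite W] : Finite B := Finite.of_injective cs.simple (simple_inj cs)

lemma finite_PR [Finite W] : Finite (PR cs) := by
  have := finite_B cs
  have h1 : (Set.range (fun p : W × B => rho cs p.1 (e p.2))).Finite := Set.finite_range _
  apply (h1.subset _ : {v | IsRoot cs v ∧ 0 ≤ v}.Finite)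
  rintro v ⟨⟨w, i, rfl⟩, _⟩
  exact ⟨(w, i), rfl⟩

lemma exists_perm [Finite W] (G : (B →₀ ℝ) →ₗ[ℝ] (B →₀ ℝ)) (hG : Function.Injective G)
    (hr : ∀ v, IsRoot cs v → IsRoot cs (G v)) :
    ∃ p : Equiv.Perm (PR cs), ∀ t, G t.1 = (p t).1 ∨ G t.1 = -(p t).1 := by
  have := finite_PR cs
  have h1 : ∀ t : PR cs, ∃ t' : PR cs, G t.1 = t'.1 ∨ G t.1 = -t'.1 := by
    intro t
    rcases (hr _ t.2.1).pos_or with h | h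
    · exact ⟨⟨_, hr _ t.2.1, h⟩, Or.inl rfl⟩
    · exact ⟨⟨_, (hr _ t.2.1).neg, h⟩, Or.inr (by simp)⟩
  choose q hq using h1
  have hinj : Function.Injective q := by
    intro t t' htt
    have a := hq t
    have b := hq t'
    rw [htt] at a
    have hc : G t.1 = G t'.1 ∨ G t.1 = G (-t'.1) := by
      rw [map_neg]
      rcases a with a | a <;> rcases b with b | b <;> rw [a, b] <;> simp
    rcases hc with hc | hc
    · exact Subtype.ext (hG hc)
    · have := hG hc
      exact (not_both t.2.1 t.2.2 (by rw [this, neg_neg]; exact t'.2.2)).elim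
  exact ⟨Equiv.ofBijective q (Finite.injective_iff_bijective.1 hinj), hq⟩

open Classical in
/-- number of positive roots on which `f` is negative -/
noncomputable def neg [Fintype (PR cs)] (f : (B →₀ ℝ) →ₗ[ℝ] ℝ) : ℕ :=
  (Finset.univ.filter (fun t : PR cs => f t.1 < 0)).card

lemma neg_sig [Fintype (PR cs)] (f : (B →₀ ℝ) →ₗ[ℝ] ℝ) (i : B) (hf : 0 < f (e i)) :
    neg cs (f ∘ₗ sig M i) = neg cs f + 1 := by
  classical
  have hss : ∀ v, sig M i (sig M i v) = v := by
    intro v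
    have := congrArg (fun f => f v) (sig_sq M i)
    simpa using this
  have ei : IsRoot cs (e i) ∧ 0 ≤ (e i : B →₀ ℝ) := ⟨isRoot_e i, e_nonneg i⟩
  have hne : ∀ t ∈ Finset.univ.filter (fun t : PR cs => f t.1 < 0), t.1 ≠ e i := by
    intro t ht h
    simp only [Finset.mem_filter] at ht
    rw [h] at ht; linarith [ht.2]
  let q : PR cs → PR cs := fun t => if h : t.1 = e i then t else ⟨sig M i t.1, sig_pos t.2.1 t.2.2 i h⟩
  have hq : ∀ t : PR cs, t.1 ≠ e i → (q t).1 = sig M i t.1 := by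
    intro t ht; simp [q, ht]
  have h1 : Finset.univ.filter (fun t : PR cs => (f ∘ₗ sig M i) t.1 < 0) =
      insert ⟨e i, ei⟩ ((Finset.univ.filter (fun t : PR cs => f t.1 < 0)).image q) := by
    ext t
    simp only [Finset.mem_filter, Finset.mem_univ, true_and, Finset.mem_insert, Finset.mem_image,
      LinearMap.comp_apply]
    constructor
    · intro h
      by_cases ht : t.1 = e i
      · left; exact Subtype.ext ht
      · right
        refine ⟨⟨sig M i t.1, sig_pos t.2.1 t.2.2 i ht⟩, h, ?_⟩
        apply Subtype.ext
        rw [hq]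
        · exact hss _
        · intro h'
          simp only at h'
          rw [h'] at h; linarith
    · rintro (rfl | ⟨t', ht', rfl⟩)
      · simp only [sig_self, map_neg]; linarith
      · rw [hq _ (hne t' (by simpa using ht')), hss]; exact ht'
  rw [neg, h1, Finset.card_insert_of_notMem, Finset.card_image_of_injOn, neg]
  · intro t ht t' ht' h
    have := congrArg Subtype.val h
    rw [hq _ (hne t ht), hq _ (hne t' ht')] at this
    have := congrArg (sig M i) this
    rw [hss, hss] at this
    exact Subtype.ext this
  · intro h
    obtain ⟨t, ht, h⟩ := Finset.mem_image.1 h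
    have := congrArg Subtype.val h
    rw [hq _ (hne t ht)] at this
    have := congrArg (sig M i) this
    rw [hss, sig_self] at this
    exact not_both t.2.1 t.2.2 (by rw [this, neg_neg]; exact e_nonneg i)

lemma comp_rho_mul (f : (B →₀ ℝ) →ₗ[ℝ] ℝ) (w : W) (i : B) :
    f ∘ₗ rho cs (w * cs.simple i) = (f ∘ₗ rho cs w) ∘ₗ sig M i := by
  apply LinearMap.ext; intro v
  simp only [LinearMap.comp_apply]
  rw [rho_mul, rho_simple]

lemma exists_chamber [Fintype (PR cs)] [Finite W] (f : (B →₀ ℝ) →ₗ[ℝ] ℝ)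
    (hf : ∀ t : PR cs, f t.1 ≠ 0) : ∃ w : W, ∀ i, 0 < f (rho cs w (e i)) := by
  obtain ⟨w, hw⟩ := Finite.exists_min (fun w : W => neg cs (f ∘ₗ rho cs w))
  refine ⟨w, fun i => ?_⟩
  by_contra hcon
  have hr : IsRoot cs (rho cs w (e i)) := (isRoot_e i).rho w
  have h0 : f (rho cs w (e i)) ≠ 0 := by
    rcases hr.pos_or with h | h
    · exact hf ⟨_, hr, h⟩
    · have := hf ⟨_, hr.neg, h⟩
      simpa using this
  have h1 : f (rho cs w (e i)) < 0 := lt_of_le_of_ne (not_lt.1 hcon) h0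
  have h2 := neg_sig cs (f ∘ₗ rho cs (w * cs.simple i)) i (by
    simp only [LinearMap.comp_apply]
    rw [rho_mul, rho_simple, sig_self, map_neg, map_neg]; linarith)
  rw [← comp_rho_mul] at h2
  simp only [simple_mul_simple_cancel_right] at h2
  have := hw (w * cs.simple i)
  omega

lemma neg_length [Fintype (PR cs)] (f : (B →₀ ℝ) →ₗ[ℝ] ℝ) (hf : ∀ i, 0 < f (e i)) :
    ∀ (n : ℕ) (w : W), cs.length w = n → neg cs (f ∘ₗ rho cs w) = n := by
  intro n
  induction n with
  | zero =>
    intro w hw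
    rw [cs.length_eq_zero_iff] at hw
    subst hw
    rw [neg, Finset.card_eq_zero, Finset.filter_eq_empty_iff]
    intro t _
    have := pos_of_simple hf t.2.2 t.2.1.ne
    simp
    linarith
  | succ n ih =>
    intro w hw
    have h1 : w ≠ 1 := by rintro rfl; simp at hw
    obtain ⟨i, hi⟩ := cs.exists_rightDescent_of_ne_one h1
    have hi' := hi
    rw [cs.isRightDescent_iff] at hi
    have hl := ih (w * cs.simple i) (by omega)
    rw [cs.isRightDescent_iff_not_isRightDescent_mul] at hi'
    have hp := rho_pos cs _ _ rfl i hi'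
    have := neg_sig cs (f ∘ₗ rho cs (w * cs.simple i)) i
      (pos_of_simple hf hp ((isRoot_e i).rho _).ne)
    rw [← comp_rho_mul, simple_mul_simple_cancel_right, hl] at this
    exact this

lemma card_sep [Fintype (PR cs)] [Finite W] (f f' : (B →₀ ℝ) →ₗ[ℝ] ℝ) (w w' : W)
    (hf : ∀ i, 0 < f (rho cs w (e i))) (hf' : ∀ i, 0 < f' (rho cs w' (e i))) :
    (Finset.univ.filter (fun t : PR cs => f t.1 * f' t.1 < 0)).card = cs.length (w⁻¹ * w') := by
  obtain ⟨p, hp⟩ := exists_perm cs (rho cs w')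
    (fun a b h => by
      have := congrArg (rho cs w'⁻¹) h
      rwa [rho_inv_rho, rho_inv_rho] at this) (fun v hv => hv.rho w')
  rw [← neg_length cs (f ∘ₗ rho cs w) hf _ (w⁻¹ * w') rfl, neg]
  symm
  apply Finset.card_equiv p
  intro t
  simp only [Finset.mem_filter, Finset.mem_univ, true_and, LinearMap.comp_apply]
  rw [← rho_mul, mul_inv_cancel_left]
  have h1 : 0 < f' (rho cs w' t.1) :=
    pos_of_simple (f := f' ∘ₗ rho cs w') hf' t.2.2 t.2.1.ne
  have h2 : f (p t).1 * f' (p t).1 = f (rho cs w' t.1) * f' (rho cs w' t.1) := by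
    rcases hp t with h | h <;> rw [h] <;> simp
  rw [h2]
  constructor
  · intro h; exact mul_neg_of_neg_of_pos h h1
  · intro h; exact (neg_iff_pos_of_mul_neg h).2 h1

end roots
end GP

namespace GP
open CoxeterSystem

section final
variable {B W : Type*} [Group W] {M : CoxeterMatrix B} (cs : CoxeterSystem M W)

lemma exists_phi [Finite W] (F : W ≃* W)
    (hF : (⇑F) '' Set.range cs.simple = Set.range cs.simple) :
    ∃ φ : B ≃ B, ∀ i, F (cs.simple i) = cs.simple (φ i) := by
  have := finite_B cs
  have h1 : ∀ i, ∃ j, F (cs.simple i) = cs.simple j := by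
    intro i
    have : F (cs.simple i) ∈ Set.range cs.simple := by
      rw [← hF]; exact ⟨_, ⟨i, rfl⟩, rfl⟩
    obtain ⟨j, hj⟩ := this
    exact ⟨j, hj.symm⟩
  choose q hq using h1
  have hinj : Function.Injective q := by
    intro i j hij
    apply simple_inj cs
    apply F.injective
    rw [hq, hq, hij]
  exact ⟨Equiv.ofBijective q (Finite.injective_iff_bijective.1 hinj), hq⟩

variable {cs} {F : W ≃* W} {φ : B ≃ B} (hφ : ∀ i, F (cs.simple i) = cs.simple (φ i))
include hφ

lemma M_phi (i j : B) : M (φ i) (φ j) = M i j := by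
  by_cases hij : i = j
  · subst hij; rw [M.diagonal, M.diagonal]
  apply Nat.dvd_antisymm
  · apply order_simple cs _ _ (fun h => hij (φ.injective h))
    rw [← hφ, ← hφ, ← map_mul, ← map_pow, cs.simple_mul_simple_pow, map_one]
  · apply order_simple cs _ _ hij
    apply F.injective
    rw [map_pow, map_mul, hφ, hφ, cs.simple_mul_simple_pow, map_one]

omit hφ in
/-- the diagram automorphism on the geometric representation -/
noncomputable def LF (φ : B ≃ B) : (B →₀ ℝ) ≃ₗ[ℝ] (B →₀ ℝ) := Finsupp.domLCongr φ

omit hφ in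
lemma LF_e (i : B) : LF φ (e i) = e (φ i) := by
  simp [LF, e]

omit hφ in
lemma LF_apply (v : B →₀ ℝ) (i : B) : LF φ v i = v (φ.symm i) := rfl

lemma phi_LF (i : B) (v : B →₀ ℝ) : phi M (φ i) (LF φ v) = phi M i v := by
  have : phi M (φ i) ∘ₗ (LF φ).toLinearMap = phi M i := by
    apply Finsupp.lhom_ext'
    intro j
    apply LinearMap.ext_ring
    change phi M (φ i) (LF φ (e j)) = phi M i (e j)
    rw [LF_e, phi_e, phi_e, M_phi hφ]
  exact congrArg (fun f => f v) this

lemma LF_sig (i : B) (v : B →₀ ℝ) : LF φ (sig M i v) = sig M (φ i) (LF φ v) := by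
  rw [sig_apply, sig_apply, map_sub, map_smul, LF_e, phi_LF hφ]

lemma LF_rho (w : W) (v : B →₀ ℝ) : LF φ (rho cs w v) = rho cs (F w) (LF φ v) := by
  induction w using cs.simple_induction_left with
  | one => simp
  | mul_simple_left x i ih =>
    rw [rho_mul, rho_simple, LF_sig hφ, ih, map_mul, rho_mul, hφ, rho_simple]

omit hφ

variable (cs) [Fintype W] [Fintype B]

/-- embedding of the root space into a Euclidean space -/
noncomputable def J : (B →₀ ℝ) →ₗ[ℝ] EuclideanSpace ℝ (W × B) where
  toFun v := WithLp.toLp 2 (fun p => rho cs p.1 v p.2)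
  map_add' v w := by ext p; simp
  map_smul' c v := by ext p; simp

lemma J_apply (v : B →₀ ℝ) (p : W × B) : J cs v p = rho cs p.1 v p.2 := rfl

lemma J_inj : Function.Injective (J cs) := by
  intro v w h
  ext i
  have := congrArg (fun x => x ((1 : W), i)) h
  simpa [J_apply] using this

/-- the isometry attached to `w F` -/
noncomputable def gg (F : W ≃* W) (φ : B ≃ B) (w : W) :
    EuclideanSpace ℝ (W × B) ≃ₗᵢ[ℝ] EuclideanSpace ℝ (W × B) :=
  LinearIsometryEquiv.piLpCongrLeft 2 ℝ ℝ
    (Equiv.prodCongr (F.toEquiv.trans (Equiv.mulRight w⁻¹)) φ)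

include hφ in
lemma gg_J (w : W) (v : B →₀ ℝ) : gg F φ w (J cs v) = J cs (rho cs w (LF φ v)) := by
  ext ⟨a, i⟩
  have h1 : gg F φ w (J cs v) (a, i) = rho cs (F.symm (a * w)) v (φ.symm i) := by
    simp [gg, J_apply, LinearIsometryEquiv.piLpCongrLeft_apply, Equiv.piCongrLeft'_apply]
  rw [h1, J_apply, ← rho_mul, ← LF_apply, LF_rho hφ]
  simp

open Classical in
/-- a point in a given chamber -/
noncomputable def pt (B : Type*) [Fintype B] (w : W) : EuclideanSpace ℝ (W × B) :=
  WithLp.toLp 2 (fun p => if p.1 = w⁻¹ then 1 else 0)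

/-- linear functional of a point -/
noncomputable def fn (x : EuclideanSpace ℝ (W × B)) : (B →₀ ℝ) →ₗ[ℝ] ℝ :=
  (innerₛₗ ℝ x) ∘ₗ J cs

lemma fn_apply (x : EuclideanSpace ℝ (W × B)) (v : B →₀ ℝ) : fn cs x v = inner ℝ x (J cs v) := rfl

lemma fn_pt (w : W) (v : B →₀ ℝ) : fn cs (pt B w) v = ∑ i, rho cs w⁻¹ v i := by
  rw [fn_apply, PiLp.inner_apply, Fintype.sum_prod_type, Finset.sum_comm]
  apply Finset.sum_congr rfl
  intro i _
  simp only [pt, J_apply]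
  rw [Fintype.sum_eq_single w⁻¹ (fun x hx => by simp [hx])]
  simp

lemma pt_chamber (w : W) (i : B) : 0 < fn cs (pt B w) (rho cs w (e i)) := by
  rw [fn_pt, rho_inv_rho]
  simp [e]

lemma exists_theP (F : W ≃* W) (φ : B ≃ B) (hφ : ∀ i, F (cs.simple i) = cs.simple (φ i)) (w : W) :
    ∃ p : Equiv.Perm (PR cs), ∀ t, (rho cs w ∘ₗ (LF φ).toLinearMap) t.1 = (p t).1 ∨
      (rho cs w ∘ₗ (LF φ).toLinearMap) t.1 = -(p t).1 := by
  apply exists_perm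
  · intro a b h
    have := congrArg (rho cs w⁻¹) h
    simp only [LinearMap.comp_apply] at this
    rw [rho_inv_rho, rho_inv_rho] at this
    exact (LF φ).injective this
  · rintro v ⟨x, i, rfl⟩
    refine ⟨w * F x, φ i, ?_⟩
    simp only [LinearMap.comp_apply, LinearEquiv.coe_coe]
    rw [LF_rho hφ, LF_e, rho_mul]

/-- the arrangement -/
noncomputable def theArr (F : W ≃* W) (φ : B ≃ B) (hφ : ∀ i, F (cs.simple i) = cs.simple (φ i))
    (w : W) : Arr (EuclideanSpace ℝ (W × B)) (PR cs) where
  α t := J cs t.1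
  g := gg F φ w
  p := (exists_theP cs F φ hφ w).choose
  hne t h := t.2.1.ne (J_inj cs (by rw [h, map_zero]))
  hlin t t' h := by
    rw [LinearIndependent.pair_iff' (fun h => t.2.1.ne (J_inj cs (by rw [h, map_zero])))]
    intro c hc
    rw [← map_smul] at hc
    exact h (Subtype.ext (t'.2.1.prop t.2.1 t'.2.2 t.2.2 c (J_inj cs hc).symm).symm)
  hp t := by
    rw [gg_J cs hφ, ← map_neg]
    rcases (exists_theP cs F φ hφ w).choose_spec t with h | h
    · left; exact congrArg (J cs) h
    · right; exact congrArg (J cs) h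

lemma gg_chamber (hφ : ∀ i, F (cs.simple i) = cs.simple (φ i)) (w x : W)
    (y : EuclideanSpace ℝ (W × B)) (h : ∀ i, 0 < fn cs y (rho cs x (e i))) (i : B) :
    0 < fn cs (gg F φ w y) (rho cs (w * F x) (e i)) := by
  have := h (φ.symm i)
  rw [rho_mul, show e i = LF φ (e (φ.symm i)) by rw [LF_e]; simp, ← LF_rho hφ, fn_apply,
    ← gg_J cs hφ, LinearIsometryEquiv.inner_map_map]
  exact this

lemma d_eq [Fintype (PR cs)] (hφ : ∀ i, F (cs.simple i) = cs.simple (φ i)) (w x : W)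
    (y : EuclideanSpace ℝ (W × B)) (h : ∀ i, 0 < fn cs y (rho cs x (e i))) :
    (theArr cs F φ hφ w).d Finset.univ y = cs.length (x⁻¹ * w * F x) := by
  have := card_sep cs (fn cs y) (fn cs (gg F φ w y)) x (w * F x) h (gg_chamber cs hφ w x y h)
  rw [mul_assoc, ← this]
  rfl

lemma chamber_generic (x : W) (y : EuclideanSpace ℝ (W × B))
    (h : ∀ i, 0 < fn cs y (rho cs x (e i))) (t : PR cs) : fn cs y t.1 ≠ 0 := by
  have hr := t.2.1.rho x⁻¹
  have key : ∀ v, IsRoot cs v → 0 ≤ v → 0 < fn cs y (rho cs x v) := fun v hv p =>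
    pos_of_simple (f := fn cs y ∘ₗ rho cs x) h p hv.ne
  rcases hr.pos_or with p | p
  · have := key _ hr p
    rw [rho_rho_inv] at this
    exact this.ne'
  · have := key _ hr.neg p
    rw [map_neg, rho_rho_inv, map_neg] at this
    intro h; rw [h] at this; simp at this

end final

theorem main {B : Type*} {W : Type*} [Group W] [Finite W] {M : CoxeterMatrix B}
    (cs : CoxeterSystem M W) (F : W ≃* W)
    (hF : (⇑F) '' Set.range cs.simple = Set.range cs.simple)
    (w : W) :
    ∃ x : W, FConj F w x ∧ (∀ z : W, FConj F w z → cs.length x ≤ cs.length z) ∧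
      Relation.ReflTransGen (CyclicShiftStep cs F) w x := by
  classical
  obtain ⟨φ, hφ⟩ := exists_phi cs F hF
  have hB := finite_B cs
  have hP := finite_PR cs
  have := Fintype.ofFinite W
  have := Fintype.ofFinite B
  have := Fintype.ofFinite (PR cs)
  obtain ⟨y, hy, hgen, hmin⟩ := Arr.arr_main (theArr cs F φ hφ w) Finset.univ (by simp) (pt B 1)
    (fun t _ => chamber_generic cs 1 _ (pt_chamber cs 1) t)
  have hind : ∃ u : W, (∀ i, 0 < fn cs y (rho cs u (e i))) ∧
      Relation.ReflTransGen (CyclicShiftStep cs F) w (u⁻¹ * w * F u) := by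
    clear hmin hgen
    induction hy with
    | refl => exact ⟨1, pt_chamber cs 1, by simp; exact Relation.ReflTransGen.refl⟩
    | @tail b c _ hst ih =>
      obtain ⟨u, hu, hr⟩ := ih
      obtain ⟨hc, hcard, hd⟩ := hst
      obtain ⟨u', hu'⟩ := exists_chamber cs (fn cs c) (fun t => hc t (Finset.mem_univ t))
      have h1 := card_sep cs (fn cs b) (fn cs c) u u' hu hu'
      have h2 : cs.length (u⁻¹ * u') ≤ 1 := by rw [← h1]; exact hcard
      rw [d_eq cs hφ w u' c hu', d_eq cs hφ w u b hu] at hd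
      refine ⟨u', hu', ?_⟩
      rcases Nat.le_one_iff_eq_zero_or_eq_one.1 h2 with h3 | h3
      · rw [cs.length_eq_zero_iff, inv_mul_eq_one] at h3
        rw [← h3]; exact hr
      · rw [cs.length_eq_one_iff] at h3
        obtain ⟨s, hs⟩ := h3
        refine hr.tail ⟨s, ?_, hd⟩
        have h4 : u' = u * cs.simple s := by rw [← hs]; group
        rw [h4, mul_inv_rev, cs.inv_simple, map_mul]
        group
  obtain ⟨u, hu, hr⟩ := hind
  refine ⟨u⁻¹ * w * F u, ⟨u, rfl⟩, ?_, hr⟩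
  rintro z ⟨v, rfl⟩
  have := hmin (pt B v) (fun t _ => chamber_generic cs v _ (pt_chamber cs v) t)
  rwa [d_eq cs hφ w u y hu, d_eq cs hφ w v _ (pt_chamber cs v)] at this

end GP

end Helpers

/-- Geck–Pfeiffer, Geck–Pfeiffer–Kim, He:  for a finite Coxeter system `(W,S)` and an
automorphism `F` of `W` with `F(S) = S`, every element `w` of an `F`-conjugacy class `O`
satisfies `w → x` for some element `x ∈ O` of minimal length in `O`. -/
theorem stmt1 {B : Type*} {W : Type*} [Group W] [Finite W] {M : CoxeterMatrix B}
    (cs : CoxeterSystem M W) (F : W ≃* W)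
    (hF : (⇑F) '' Set.range cs.simple = Set.range cs.simple)
    (w : W) :
    ∃ x : W, FConj F w x ∧ (∀ z : W, FConj F w z → cs.length x ≤ cs.length z) ∧
      Relation.ReflTransGen (CyclicShiftStep cs F) w x := by
  exact GP.main cs F hF w
end

section
/- Let (W,S) be a finite Coxeter system and F an automorphism of W with F(S) = S. If O is a cuspidal F-conjugacy class of W, then every two elements of minimal length in O are conjugate by a sequence of length-preserving cyclic shifts, i.e. for all x, y of minimal length in O one has x ≈ y. -/
/-- The `F`-conjugacy class of `w` is cuspidal: it meets no proper `F`-stable standard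
parabolic subgroup `W_I`, `I ⊊ S`. -/
def IsCuspidalClass {B : Type*} {W : Type*} [Group W] {M : CoxeterMatrix B}
    (cs : CoxeterSystem M W) (F : W ≃* W) (w : W) : Prop :=
  ∀ I : Set B, I ≠ Set.univ → (⇑F) '' (cs.simple '' I) = cs.simple '' I →
    ∀ x : W, FConj F w x → x ∉ Subgroup.closure (cs.simple '' I)

open scoped RealInnerProductSpace
open Filter Topology

section Analytic
variable {V : Type*} [NormedAddCommGroup V] [InnerProductSpace ℝ V]

/-- Generic points are dense: near any `x ∈ K` there is a point of `K` which is not orthogonal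
to any of finitely many vectors that are not orthogonal to the whole of `K`. -/
lemma exists_generic (K : Submodule ℝ V) (Ψ : Set V) (hΨ : Ψ.Finite) :
    ∀ x ∈ K, ∀ δ : ℝ, 0 < δ → ∃ y ∈ K, ‖y - x‖ < δ ∧ ∀ n ∈ Ψ, n ∉ Kᗮ → ⟪n, y⟫ ≠ 0 := by
  induction Ψ, hΨ using Set.Finite.induction_on with
  | empty => intro x hx δ hδ; exact ⟨x, hx, by simpa using hδ, by simp⟩
  | @insert n Ψ hn hfin ih =>
    intro x hx δ hδ
    obtain ⟨y, hy, hyx, hgen⟩ := ih x hx (δ / 2) (by linarith)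
    by_cases hcase : n ∈ Kᗮ ∨ ⟪n, y⟫ ≠ 0
    · refine ⟨y, hy, by linarith, ?_⟩
      intro m hm hmK
      rcases hm with rfl | hm
      · tauto
      · exact hgen m hm hmK
    · push Not at hcase
      obtain ⟨hnK, hny⟩ := hcase
      obtain ⟨z, hz, hnz⟩ : ∃ z ∈ K, ⟪n, z⟫ ≠ 0 := by
        by_contra! hcon
        apply hnK
        rw [Submodule.mem_orthogonal']
        exact hcon
      have h1 : ∀ᶠ t : ℝ in 𝓝[>] 0, ‖t • z‖ < δ / 2 := by
        apply mem_nhdsWithin_of_mem_nhds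
        have : Continuous fun t : ℝ => ‖t • z‖ := by fun_prop
        exact this.continuousAt.eventually_lt continuousAt_const (by simpa using hδ)
      have h2 : ∀ᶠ t : ℝ in 𝓝[>] 0, ∀ m ∈ Ψ, m ∉ Kᗮ → ⟪m, y + t • z⟫ ≠ 0 := by
        rw [eventually_all_finite hfin]
        intro m hm
        by_cases hmK : m ∈ Kᗮ
        · exact Eventually.of_forall fun t h => absurd hmK h
        have : Continuous fun t : ℝ => ⟪m, y + t • z⟫ := by fun_prop
        have h3 := this.continuousAt.eventually_ne (x := (0 : ℝ)) (y := 0)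
          (by simpa using hgen m hm hmK)
        exact mem_nhdsWithin_of_mem_nhds (h3.mono fun t ht _ => ht)
      have h3 : ∀ᶠ t : ℝ in 𝓝[>] 0, (0 : ℝ) < t := eventually_mem_nhdsWithin
      obtain ⟨t, ht1, ht2, ht3⟩ := (h1.and (h2.and h3)).exists
      refine ⟨y + t • z, K.add_mem hy (K.smul_mem t hz), ?_, ?_⟩
      · calc ‖y + t • z - x‖ = ‖(y - x) + t • z‖ := by congr 1; abel
          _ ≤ ‖y - x‖ + ‖t • z‖ := norm_add_le _ _
          _ < δ := by linarith
      · intro m hm hmK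
        rcases hm with rfl | hm
        · rw [inner_add_right, hny, inner_smul_right, zero_add]
          exact mul_ne_zero ht3.ne' hnz
        · exact ht2 m hm hmK

lemma inner_symm_left (g : V ≃ₗᵢ[ℝ] V) (a b : V) : ⟪g.symm a, b⟫ = ⟪a, g b⟫ := by
  rw [← g.inner_map_map (g.symm a) b, g.apply_symm_apply]

lemma inner_symm_right (g : V ≃ₗᵢ[ℝ] V) (a b : V) : ⟪a, g.symm b⟫ = ⟪g a, b⟫ := by
  rw [← g.inner_map_map a (g.symm b), g.apply_symm_apply]

/-- Top eigenspace of `g + g⁻¹` on `U`. -/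
lemma exists_top_eigen [FiniteDimensional ℝ V] (g : V ≃ₗᵢ[ℝ] V) (U : Submodule ℝ V) (hU : U ≠ ⊥)
    (hgU : ∀ v ∈ U, g v ∈ U) (hgU' : ∀ v ∈ U, g.symm v ∈ U) :
    ∃ l : ℝ, (∃ v ∈ U, v ≠ 0 ∧ g v + g.symm v = l • v) ∧
      (∀ q ∈ U, 2 * ⟪g q, q⟫ ≤ l * ⟪q, q⟫) ∧
      (∀ q ∈ U, 2 * ⟪g q, q⟫ = l * ⟪q, q⟫ → g q + g.symm q = l • q) := by
  obtain ⟨a, haU, ha0⟩ := Submodule.exists_mem_ne_zero_of_ne_bot hU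
  have hcomp : IsCompact ((U : Set V) ∩ Metric.sphere 0 1) :=
    (isCompact_sphere (0 : V) 1).inter_left U.closed_of_finiteDimensional
  have hne : ((U : Set V) ∩ Metric.sphere 0 1).Nonempty := by
    refine ⟨(‖a‖)⁻¹ • a, U.smul_mem _ haU, ?_⟩
    have : ‖a‖ ≠ 0 := by simpa using ha0
    simp [norm_smul, this]
  have hcont : ContinuousOn (fun v : V => 2 * ⟪g v, v⟫) ((U : Set V) ∩ Metric.sphere 0 1) := by
    have := g.continuous
    exact Continuous.continuousOn (by fun_prop)
  obtain ⟨v0, ⟨hv0U, hv0s⟩, hmax⟩ := hcomp.exists_isMaxOn hne hcont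
  have hv0n : ‖v0‖ = 1 := by simpa using hv0s
  have hv0i : ⟪v0, v0⟫ = (1 : ℝ) := by rw [real_inner_self_eq_norm_sq, hv0n]; norm_num
  set l := 2 * ⟪g v0, v0⟫ with hl
  have hle : ∀ q ∈ U, 2 * ⟪g q, q⟫ ≤ l * ⟪q, q⟫ := by
    intro q hq
    by_cases hq0 : q = 0
    · simp [hq0]
    have hqn : ‖q‖ ≠ 0 := by simpa using hq0
    have h := hmax (a := (‖q‖)⁻¹ • q) ⟨U.smul_mem _ hq, by simp [norm_smul, hqn]⟩
    simp only [Set.mem_ofPred_eq, map_smul, inner_smul_left, inner_smul_right] at h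
    rw [real_inner_self_eq_norm_sq]
    simp only [conj_trivial] at h
    have hpos : 0 < ‖q‖ ^ 2 := by positivity
    have h2 : 2 * (‖q‖⁻¹ * (‖q‖⁻¹ * ⟪g q, q⟫)) * ‖q‖ ^ 2 ≤ l * ‖q‖ ^ 2 :=
      mul_le_mul_of_nonneg_right h hpos.le
    have h3 : 2 * (‖q‖⁻¹ * (‖q‖⁻¹ * ⟪g q, q⟫)) * ‖q‖ ^ 2 = 2 * ⟪g q, q⟫ := by
      field_simp
    linarith
  have heq : ∀ q ∈ U, 2 * ⟪g q, q⟫ = l * ⟪q, q⟫ → g q + g.symm q = l • q := by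
    intro q hq hqe
    set z := l • q - (g q + g.symm q) with hz
    have hzU : z ∈ U := U.sub_mem (U.smul_mem _ hq) (U.add_mem (hgU q hq) (hgU' q hq))
    have hzz : ⟪z, z⟫ = l * ⟪q, z⟫ - ⟪g q, z⟫ - ⟪g z, q⟫ := by
      conv_lhs => rw [hz]
      rw [inner_sub_left, inner_add_left, inner_smul_left, inner_symm_left,
        real_inner_comm (g z) q]
      simp only [conj_trivial]
      ring
    have hquad : ∀ t : ℝ, 0 ≤ 2 * t * ⟪z, z⟫ + t ^ 2 * (l * ⟪z, z⟫ - 2 * ⟪g z, z⟫) := by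
      intro t
      have h := hle (q + t • z) (U.add_mem hq (U.smul_mem t hzU))
      simp only [map_add, map_smul, inner_add_left, inner_add_right, inner_smul_left,
        inner_smul_right, conj_trivial] at h
      rw [real_inner_comm q z] at h
      rw [hzz] at *
      nlinarith
    have hz0 : ⟪z, z⟫ = (0 : ℝ) := by
      by_contra hne
      have hpos : 0 < ⟪z, z⟫ := lt_of_le_of_ne real_inner_self_nonneg (Ne.symm hne)
      set c := l * ⟪z, z⟫ - 2 * ⟪g z, z⟫
      have hc : 0 ≤ c := by have := hle z hzU; linarith
      have h := hquad (-(⟪z, z⟫ / (c + 1)))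
      have h1 : 2 * -(⟪z, z⟫ / (c + 1)) * ⟪z, z⟫ + (-(⟪z, z⟫ / (c + 1))) ^ 2 * c
          = - (⟪z, z⟫ / (c + 1)) ^ 2 * (c + 2) := by
        field_simp; ring
      rw [h1] at h
      have : 0 < (⟪z, z⟫ / (c + 1)) ^ 2 * (c + 2) := by positivity
      linarith
    have : z = 0 := by simpa using hz0
    rw [hz, sub_eq_zero] at this
    exact this.symm
  refine ⟨l, ⟨v0, hv0U, ?_, ?_⟩, hle, heq⟩
  · rintro rfl; simp at hv0n
  · exact heq v0 hv0U (by rw [hv0i, mul_one])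

/-- Permitted directions. -/
def Permitted (g : V ≃ₗᵢ[ℝ] V) (Φ : Set V) (v h : V) : Prop :=
  ∀ n ∈ Φ, ⟪n, v⟫ = 0 → 0 < ⟪n, h⟫ → 0 < ⟪n, g v⟫ ∨ 0 < ⟪n, g.symm v⟫ ∨ g n = -n

/-- `D` can be left in no permitted direction. -/
def Inward (g : V ≃ₗᵢ[ℝ] V) (Φ : Set V) (U : Submodule ℝ V) (D : Set V) : Prop :=
  ∀ v ∈ D, ∀ h ∈ U, Permitted g Φ v h → ∃ ε : ℝ, 0 < ε ∧ ∀ t, 0 ≤ t → t ≤ ε → v + t • h ∈ D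

lemma analytic_core [FiniteDimensional ℝ V] (g : V ≃ₗᵢ[ℝ] V) (hell : ∀ v, g v = v → v = 0)
    (U : Submodule ℝ V) (hU : U ≠ ⊥)
    (hgU : ∀ v ∈ U, g v ∈ U) (hgU' : ∀ v ∈ U, g.symm v ∈ U)
    (Φ : Set V) (hΦ : Φ.Finite) (hΦU : ∀ n ∈ Φ, n ∈ U) :
    ∃ K : Submodule ℝ V, K ≤ U ∧ K ≠ ⊥ ∧ (∀ v ∈ Kᗮ, g v ∈ Kᗮ) ∧ (∀ v ∈ Kᗮ, g.symm v ∈ Kᗮ) ∧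
      ∃ k ∈ K, (∀ n ∈ Φ, ⟪n, k⟫ = 0 → n ∈ Kᗮ) ∧
        ∀ D : Set V, IsClosed D → (∀ v ∈ D, v ∈ U) → Inward g Φ U D →
          (∃ x ∈ U, ∃ δ : ℝ, 0 < δ ∧ ∀ y ∈ U, ‖y - x‖ < δ → y ∈ D) → k ∈ D := by
  obtain ⟨l, ⟨v0, hv0U, hv0, hv0e⟩, hle, heq⟩ := exists_top_eigen g U hU hgU hgU'
  let K : Submodule ℝ V :=
    { carrier := {v | v ∈ U ∧ g v + g.symm v = l • v}
      add_mem' := by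
        rintro a b ⟨ha, ha'⟩ ⟨hb, hb'⟩
        refine ⟨U.add_mem ha hb, ?_⟩
        rw [smul_add, ← ha', ← hb', map_add, map_add]; abel
      zero_mem' := ⟨U.zero_mem, by simp⟩
      smul_mem' := by
        rintro c a ⟨ha, ha'⟩
        refine ⟨U.smul_mem c ha, ?_⟩
        rw [map_smul, map_smul, ← smul_add, ha', smul_comm] }
  have hKmem : ∀ v, v ∈ K ↔ v ∈ U ∧ g v + g.symm v = l • v := fun v => Iff.rfl
  have hKg : ∀ v ∈ K, g v ∈ K := by
    rintro v ⟨hv, hv'⟩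
    refine ⟨hgU v hv, ?_⟩
    have := congrArg g hv'
    rw [map_add, map_smul, g.apply_symm_apply] at this
    rw [g.symm_apply_apply, this]
  have hKg' : ∀ v ∈ K, g.symm v ∈ K := by
    rintro v ⟨hv, hv'⟩
    refine ⟨hgU' v hv, ?_⟩
    have := congrArg g.symm hv'
    rw [map_add, map_smul, g.symm_apply_apply] at this
    rw [g.apply_symm_apply, this]
  have hKo : ∀ v ∈ Kᗮ, g v ∈ Kᗮ := by
    intro v hv
    rw [Submodule.mem_orthogonal] at hv ⊢
    intro k hk
    rw [← inner_symm_left]; exact hv _ (hKg' k hk)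
  have hKo' : ∀ v ∈ Kᗮ, g.symm v ∈ Kᗮ := by
    intro v hv
    rw [Submodule.mem_orthogonal] at hv ⊢
    intro k hk
    rw [inner_symm_right]; exact hv _ (hKg k hk)
  have hKU : K ≤ U := fun v hv => hv.1
  refine ⟨K, hKU, ?_, hKo, hKo', ?_⟩
  · intro hbot
    exact hv0 ((Submodule.mem_bot ℝ).1 (hbot ▸ (show v0 ∈ K from ⟨hv0U, hv0e⟩)))
  obtain ⟨k, hkK, -, hkgen⟩ := exists_generic K Φ hΦ 0 K.zero_mem 1 one_pos
  refine ⟨k, hkK, fun n hn h => by_contra fun hc => hkgen n hn hc h, ?_⟩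
  rintro D hDc hDU hDin ⟨x, hxU, δ, hδ, hxD⟩
  -- the auxiliary vectors
  let a : V → V := fun n => ⟪g.symm n, k⟫ • n - ⟪n, k⟫ • g.symm n
  have ha : ∀ n ∈ Φ, n ∉ Kᗮ → g n ≠ -n → a n ∉ Kᗮ := by
    intro n hn hnK hgn hcon
    set m := K.starProjection n with hm
    have hmK : m ∈ K := Submodule.starProjection_apply_mem K n
    have hnm : n - m ∈ Kᗮ := Submodule.sub_starProjection_mem_orthogonal n
    have hm0 : m ≠ 0 := by
      intro h0; apply hnK; simpa [h0] using hnm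
    have hβ : ⟪n, k⟫ ≠ 0 := hkgen n hn hnK
    have hb1 : ⟪g.symm n, k⟫ • m - ⟪n, k⟫ • g.symm m ∈ Kᗮ := by
      have h1 : ⟪g.symm n, k⟫ • m - ⟪n, k⟫ • g.symm m
          = a n - (⟪g.symm n, k⟫ • (n - m) - ⟪n, k⟫ • g.symm (n - m)) := by
        simp only [a, map_sub, smul_sub]; abel
      rw [h1]
      exact Kᗮ.sub_mem hcon (Kᗮ.sub_mem (Kᗮ.smul_mem _ hnm) (Kᗮ.smul_mem _ (hKo' _ hnm)))
    have hb2 : ⟪g.symm n, k⟫ • m - ⟪n, k⟫ • g.symm m ∈ K :=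
      K.sub_mem (K.smul_mem _ hmK) (K.smul_mem _ (hKg' _ hmK))
    have hb0 : ⟪g.symm n, k⟫ • m - ⟪n, k⟫ • g.symm m = 0 := by
      have := Submodule.inner_right_of_mem_orthogonal hb2 hb1
      simpa using this
    obtain ⟨c, hc⟩ : ∃ c : ℝ, g.symm m = c • m := by
      refine ⟨⟪n, k⟫⁻¹ * ⟪g.symm n, k⟫, ?_⟩
      rw [mul_smul, sub_eq_zero.1 hb0, smul_smul, inv_mul_cancel₀ hβ, one_smul]
    have hcn : |c| = 1 := by
      have h1 : ‖g.symm m‖ = ‖m‖ := g.symm.norm_map m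
      rw [hc, norm_smul, Real.norm_eq_abs] at h1
      have : ‖m‖ ≠ 0 := by simpa using hm0
      exact mul_right_cancel₀ this (by simpa using h1)
    rcases (abs_eq zero_le_one).1 hcn with h1 | h1
    · rw [h1, one_smul] at hc
      apply hm0; apply hell
      conv_lhs => rw [← hc]
      simp
    · rw [h1, neg_one_smul] at hc
      have hgm : g m = -m := by
        have := congrArg g hc
        rw [g.apply_symm_apply, map_neg] at this
        rw [eq_neg_iff_add_eq_zero] at this ⊢
        rw [add_comm]; exact this
      have hl2 : l = -2 := by
        have h2 := hmK.2
        rw [hc, hgm] at h2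
        have h3 : (l + 2) • m = 0 := by
          rw [add_smul, ← h2, two_smul]; abel
        rcases smul_eq_zero.1 h3 with h4 | h4
        · linarith
        · exact absurd h4 hm0
      apply hgn
      have h5 := hle n (hΦU n hn)
      have h6 : ⟪g n + n, g n + n⟫ = 2 * ⟪n, n⟫ + 2 * ⟪g n, n⟫ := by
        rw [inner_add_left, inner_add_right, inner_add_right, g.inner_map_map,
          real_inner_comm (g n) n]; ring
      have h7 : ⟪g n + n, g n + n⟫ = (0 : ℝ) :=
        le_antisymm (by rw [h6]; rw [hl2] at h5; linarith) real_inner_self_nonneg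
      exact eq_neg_of_add_eq_zero_left (by simpa using h7)
  -- generic starting point
  obtain ⟨x', hx'U, hx'x, hx'gen⟩ := exists_generic U ((fun n => K.starProjection (a n)) '' Φ)
    (hΦ.image _) x hxU δ hδ
  have hx'D : x' ∈ D := hxD x' hx'U hx'x
  set k0 := K.starProjection x' with hk0
  have hk0K : k0 ∈ K := Submodule.starProjection_apply_mem K x'
  have hgen0 : ∀ n ∈ Φ, n ∉ Kᗮ → g n ≠ -n → ⟪a n, k0⟫ ≠ 0 := by
    intro n hn hnK hgn
    have h1 := hx'gen (K.starProjection (a n)) ⟨n, hn, rfl⟩ ?_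
    · rwa [Submodule.inner_starProjection_left_eq_right] at h1
    · intro hcon
      have h2 : K.starProjection (a n) ∈ K := Submodule.starProjection_apply_mem K _
      have h3 := Submodule.inner_right_of_mem_orthogonal (hKU h2) hcon
      have h4 : K.starProjection (a n) = 0 := by simpa using h3
      apply ha n hn hnK hgn
      have := Submodule.sub_starProjection_mem_orthogonal (K := K) (a n)
      simpa [h4] using this
  -- Step 1 : `k0 ∈ D`
  have hk0D : k0 ∈ D := by
    have hcl : IsClosed (D ∩ {v | v - k0 ∈ Kᗮ}) := by
      refine hDc.inter ?_
      have : Continuous fun v : V => v - k0 := by fun_prop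
      exact (Kᗮ.closed_of_finiteDimensional).preimage this
    have hne : (D ∩ {v | v - k0 ∈ Kᗮ}).Nonempty :=
      ⟨x', hx'D, Submodule.sub_starProjection_mem_orthogonal x'⟩
    obtain ⟨v, ⟨hvD, hvK⟩, hvmin⟩ := hcl.exists_infDist_eq_dist hne k0
    simp only [Set.mem_ofPred_eq] at hvK
    set q := v - k0 with hq
    by_cases hq0 : q = 0
    · rw [sub_eq_zero] at hq0; rwa [← hq0]
    exfalso
    have hqU : q ∈ U := U.sub_mem (hDU v hvD) (hKU hk0K)
    have hlt : 2 * ⟪g q, q⟫ < l * ⟪q, q⟫ := by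
      refine lt_of_le_of_ne (hle q hqU) fun h => hq0 ?_
      have hqK : q ∈ K := ⟨hqU, heq q hqU h⟩
      have := Submodule.inner_right_of_mem_orthogonal hqK hvK
      simpa using this
    set h := g q + g.symm q - l • q with hh
    have hhv : h = g v + g.symm v - l • v := by
      have h1 : g k0 + g.symm k0 - l • k0 = 0 := sub_eq_zero.2 hk0K.2
      have h2 : h = g v + g.symm v - l • v - (g k0 + g.symm k0 - l • k0) := by
        rw [hh, hq, map_sub, map_sub, smul_sub]; abel
      rw [h2, h1, sub_zero]
    have hhU : h ∈ U := U.sub_mem (U.add_mem (hgU q hqU) (hgU' q hqU)) (U.smul_mem l hqU)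
    have hhK : h ∈ Kᗮ := Kᗮ.sub_mem (Kᗮ.add_mem (hKo q hvK) (hKo' q hvK)) (Kᗮ.smul_mem l hvK)
    obtain ⟨ε, hε, hεD⟩ := hDin v hvD h hhU (by
      intro n hn hnv hnh
      rw [hhv, inner_sub_right, inner_add_right, inner_smul_right, hnv] at hnh
      by_contra! hcon
      linarith [hcon.1, hcon.2.1])
    have hhq : ⟪h, q⟫ < 0 := by
      rw [hh, inner_sub_left, inner_add_left, inner_smul_left, inner_symm_left,
        real_inner_comm (g q) q]
      simp only [conj_trivial]; linarith
    have hev1 : ∀ᶠ t : ℝ in 𝓝[>] 0, 2 * ⟪h, q⟫ + t * ⟪h, h⟫ < 0 := by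
      apply mem_nhdsWithin_of_mem_nhds
      have : Continuous fun t : ℝ => 2 * ⟪h, q⟫ + t * ⟪h, h⟫ := by fun_prop
      exact this.continuousAt.eventually_lt continuousAt_const (by simp only [zero_mul, add_zero]; linarith)
    have hev2 : ∀ᶠ t : ℝ in 𝓝[>] 0, t ≤ ε :=
      mem_nhdsWithin_of_mem_nhds (Iic_mem_nhds hε)
    have hev3 : ∀ᶠ t : ℝ in 𝓝[>] 0, (0 : ℝ) < t := eventually_mem_nhdsWithin
    obtain ⟨t, ht1, ht2, ht3⟩ := (hev1.and (hev2.and hev3)).exists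
    have hmem : v + t • h ∈ D ∩ {v | v - k0 ∈ Kᗮ} := by
      refine ⟨hεD t ht3.le ht2, ?_⟩
      have : v + t • h - k0 = q + t • h := by rw [hq]; abel
      simp only [Set.mem_ofPred_eq, this]
      exact Kᗮ.add_mem hvK (Kᗮ.smul_mem t hhK)
    have hd := Metric.infDist_le_dist_of_mem (x := k0) hmem
    rw [hvmin, dist_comm, dist_eq_norm, dist_comm, dist_eq_norm] at hd
    have h1 : v + t • h - k0 = q + t • h := by rw [hq]; abel
    rw [h1, ← hq] at hd
    have h2 : ‖q‖ ^ 2 ≤ ‖q + t • h‖ ^ 2 := by gcongr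
    rw [← real_inner_self_eq_norm_sq, ← real_inner_self_eq_norm_sq] at h2
    simp only [inner_add_left, inner_add_right, inner_smul_left, inner_smul_right,
      conj_trivial] at h2
    rw [real_inner_comm h q] at h2
    nlinarith
  -- Step 2 : move along the segment from `k0` to `k`
  let c : ℝ → V := fun t => k0 + t • (k - k0)
  have hcc : Continuous c := by fun_prop
  have hsub : Set.Icc (0 : ℝ) 1 ⊆ c ⁻¹' D := by
    apply IsClosed.Icc_subset_of_forall_mem_nhdsWithin
    · exact (hDc.preimage hcc).inter isClosed_Icc
    · simpa [c] using hk0D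
    · rintro t ⟨htD, ht0, ht1⟩
      have hcK : c t ∈ K := K.add_mem hk0K (K.smul_mem t (K.sub_mem hkK hk0K))
      obtain ⟨ε, hε, hεD⟩ := hDin (c t) htD (k - k0) (hKU (K.sub_mem hkK hk0K)) (by
        intro n hn hnv hnh
        by_cases hgn : g n = -n
        · exact Or.inr (Or.inr hgn)
        have hnK : n ∉ Kᗮ := by
          intro hnK
          have := Submodule.inner_left_of_mem_orthogonal (K.sub_mem hkK hk0K) hnK
          linarith
        have hsum : ⟪n, g (c t)⟫ + ⟪n, g.symm (c t)⟫ = 0 := by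
          rw [← inner_add_right, hcK.2, inner_smul_right, hnv, mul_zero]
        have hne : ⟪n, g (c t)⟫ ≠ 0 := by
          intro h0
          rw [← inner_symm_left] at h0
          apply hgen0 n hn hnK hgn
          simp only [c, inner_add_right, inner_smul_right, inner_sub_right] at h0 hnv
          simp only [a, inner_sub_left, inner_smul_left, conj_trivial]
          have ht : (1 - t) ≠ 0 := by linarith
          apply mul_left_cancel₀ ht
          linear_combination ⟪g.symm n, k⟫ * hnv - ⟪n, k⟫ * h0
        rcases lt_or_gt_of_ne hne with h1 | h1
        · exact Or.inr (Or.inl (by linarith))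
        · exact Or.inl h1)
      refine mem_of_superset (Ioc_mem_nhdsGT (show t < t + ε by linarith)) ?_
      rintro s ⟨hs1, hs2⟩
      have := hεD (s - t) (by linarith) (by linarith)
      have h2 : c t + (s - t) • (k - k0) = c s := by
        simp only [c, sub_smul]; abel
      rw [h2] at this
      exact this
  have := hsub (Set.right_mem_Icc.2 zero_le_one)
  simpa [c] using this

end Analytic

section Combinatorial

/-- A geometric realization of a Coxeter system together with the automorphism `F`. -/
structure Geo {B W : Type*} [Group W] {M : CoxeterMatrix B} (cs : CoxeterSystem M W) (F : W ≃* W)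
    (ι V : Type*) [NormedAddCommGroup V] [InnerProductSpace ℝ V] where
  /-- simple reflections -/
  σ : ι → W
  σ_inj : Function.Injective σ
  hσ : Set.range σ = Set.range cs.simple
  /-- the representation -/
  ρ : W →* (V ≃ₗᵢ[ℝ] V)
  /-- simple roots -/
  e : Module.Basis ι ℝ V
  refl_self : ∀ i, ρ (σ i) (e i) = -e i
  refl : ∀ i x, ∃ a : ℝ, ρ (σ i) x = x + a • e i
  pos : ∀ w i, cs.length w < cs.length (w * σ i) → ∀ j, 0 ≤ e.repr (ρ w (e i)) j
  /-- action of `F` on simple reflections -/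
  φ : Equiv.Perm ι
  hφ : ∀ i, F (σ i) = σ (φ i)
  /-- action of `F` on the space -/
  Fv : V ≃ₗᵢ[ℝ] V
  Fv_e : ∀ i, Fv (e i) = e (φ i)
  Fv_ρ : ∀ w x, Fv (ρ w x) = ρ (F w) (Fv x)

namespace Geo
variable {B W : Type*} [Group W] {M : CoxeterMatrix B} {cs : CoxeterSystem M W} {F : W ≃* W}
    {ι V : Type*} [NormedAddCommGroup V] [InnerProductSpace ℝ V] (G : Geo cs F ι V)

/-- Nonnegative combinations of simple roots. -/
def Pos (v : V) : Prop := ∀ j, 0 ≤ G.e.repr v j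

/-- closed dominant chamber -/
def Dom (v : V) : Prop := ∀ i, 0 ≤ ⟪G.e i, v⟫

lemma ρ_mul (a b : W) (v : V) : G.ρ (a * b) v = G.ρ a (G.ρ b v) := by
  rw [map_mul]; rfl

lemma ρ_one (v : V) : G.ρ 1 v = v := by rw [map_one]; rfl

lemma ρ_inv_ρ (a : W) (v : V) : G.ρ a⁻¹ (G.ρ a v) = v := by
  rw [← ρ_mul, inv_mul_cancel, ρ_one]

lemma ρ_ρ_inv (a : W) (v : V) : G.ρ a (G.ρ a⁻¹ v) = v := by
  rw [← ρ_mul, mul_inv_cancel, ρ_one]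

lemma inner_ρ (a : W) (v w : V) : ⟪G.ρ a v, w⟫ = ⟪v, G.ρ a⁻¹ w⟫ := by
  rw [← (G.ρ a⁻¹).inner_map_map, ρ_inv_ρ]

lemma exists_simple (i : ι) : ∃ b, G.σ i = cs.simple b := by
  have : G.σ i ∈ Set.range cs.simple := G.hσ ▸ Set.mem_range_self i
  obtain ⟨b, hb⟩ := this
  exact ⟨b, hb.symm⟩

lemma exists_index (b : B) : ∃ i, G.σ i = cs.simple b := by
  have : cs.simple b ∈ Set.range G.σ := G.hσ ▸ Set.mem_range_self b
  exact this

lemma σ_mul_self (i : ι) : G.σ i * G.σ i = 1 := by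
  obtain ⟨b, hb⟩ := G.exists_simple i
  rw [hb, cs.simple_mul_simple_self]

lemma inv_σ (i : ι) : (G.σ i)⁻¹ = G.σ i := by
  obtain ⟨b, hb⟩ := G.exists_simple i
  rw [hb, cs.inv_simple]

lemma refl_formula (i : ι) (x : V) :
    ∃ a : ℝ, G.ρ (G.σ i) x = x + a • G.e i ∧ a * ⟪G.e i, G.e i⟫ = -2 * ⟪G.e i, x⟫ := by
  obtain ⟨a, ha⟩ := G.refl i x
  refine ⟨a, ha, ?_⟩
  have h := (G.ρ (G.σ i)).inner_map_map (G.e i) x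
  rw [ha, G.refl_self, inner_neg_left, inner_add_right, inner_smul_right] at h
  linarith

lemma refl_fix (i : ι) (x : V) (h : ⟪G.e i, x⟫ = 0) : G.ρ (G.σ i) x = x := by
  obtain ⟨a, ha, ha'⟩ := G.refl_formula i x
  have hne : ⟪G.e i, G.e i⟫ ≠ 0 := by
    have := G.e.ne_zero i
    simpa using this
  have : a = 0 := by
    rw [h, mul_zero] at ha'
    exact (mul_eq_zero.1 ha').resolve_right hne
  rw [ha, this, zero_smul, add_zero]

lemma lt_of_not_pos (w : W) (i : ι) (h : ¬ G.Pos (G.ρ w (G.e i))) :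
    cs.length (w * G.σ i) < cs.length w := by
  have h1 : ¬ cs.length w < cs.length (w * G.σ i) := fun h2 => h (G.pos w i h2)
  obtain ⟨b, hb⟩ := G.exists_simple i
  rw [hb] at h1 ⊢
  have := cs.length_mul_simple_ne w b
  omega

lemma neg_pos_of_lt (w : W) (i : ι) (h : cs.length (w * G.σ i) < cs.length w) :
    G.Pos (-(G.ρ w (G.e i))) := by
  have h1 := G.pos (w * G.σ i) i (by rw [mul_assoc, σ_mul_self, mul_one]; exact h)
  intro j
  have h2 := h1 j
  rwa [ρ_mul, G.refl_self, map_neg] at h2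

lemma pos_symm (p : V) (hp : G.Pos p) : G.Pos (G.Fv.symm p) := by
  intro j
  have h : ∀ p, G.e.repr (G.Fv.symm p) j = G.e.repr p (G.φ j) := by
    intro p
    have h2 : (G.e.coord j).comp G.Fv.symm.toLinearEquiv.toLinearMap = G.e.coord (G.φ j) := by
      apply G.e.ext
      intro i
      have h3 : G.Fv.symm (G.e i) = G.e (G.φ.symm i) := by
        rw [LinearIsometryEquiv.symm_apply_eq, G.Fv_e, Equiv.apply_symm_apply]
      simp only [LinearMap.comp_apply, LinearEquiv.coe_coe, Module.Basis.coord_apply,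
        LinearIsometryEquiv.coe_toLinearEquiv, h3, Module.Basis.repr_self]
      classical
      rw [Finsupp.single_apply, Finsupp.single_apply]
      simp only [Equiv.symm_apply_eq]
    exact LinearMap.congr_fun h2 p
  rw [h]
  exact hp _

lemma noinc1 (x : W) (i : ι) (h : ¬ G.Pos (G.ρ x (G.Fv (G.e i)))) :
    cs.length (G.σ i * x * F (G.σ i)) ≤ cs.length x := by
  rw [G.Fv_e] at h
  have h1 := G.lt_of_not_pos _ _ h
  rw [G.hφ, mul_assoc]
  obtain ⟨b, hb⟩ := G.exists_simple i
  have h2 := cs.length_mul_le (G.σ i) (x * G.σ (G.φ i))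
  rw [hb, cs.length_simple] at h2
  rw [hb]
  omega

lemma noinc2 (x : W) (i : ι) (h : ¬ G.Pos (G.Fv.symm (G.ρ x⁻¹ (G.e i)))) :
    cs.length (G.σ i * x * F (G.σ i)) ≤ cs.length x := by
  have h1 := G.lt_of_not_pos x⁻¹ i fun h2 => h (G.pos_symm _ h2)
  rw [cs.length_inv, ← cs.length_inv, mul_inv_rev, inv_inv, inv_σ] at h1
  have h2 := cs.length_mul_le (G.σ i * x) (F (G.σ i))
  rw [G.hφ] at *
  obtain ⟨b, hb⟩ := G.exists_simple (G.φ i)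
  rw [hb, cs.length_simple] at h2
  rw [hb]
  omega

variable [Finite ι]

lemma mem_of_dom (v : V) (hv : G.Dom v) (x : W) (hxv : G.Dom (G.ρ x v)) :
    x ∈ Subgroup.closure (G.σ '' {i | ⟪G.e i, v⟫ = 0}) ∧ G.ρ x v = v := by
  have := Fintype.ofFinite ι
  induction hn : cs.length x using Nat.strong_induction_on generalizing x with
  | _ n ih =>
  by_cases hx : x = 1
  · subst hx; exact ⟨Subgroup.one_mem _, G.ρ_one v⟩
  obtain ⟨b, hb⟩ := cs.exists_rightDescent_of_ne_one hx
  obtain ⟨i, hi⟩ := G.exists_index b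
  have hlt : cs.length (x * G.σ i) < cs.length x := by rw [hi]; exact hb
  have hp := G.neg_pos_of_lt x i hlt
  have h1 : 0 ≤ ⟪-(G.ρ x (G.e i)), G.ρ x v⟫ := by
    rw [← G.e.sum_repr (-(G.ρ x (G.e i))), sum_inner]
    refine Finset.sum_nonneg fun j _ => ?_
    rw [inner_smul_left]
    exact mul_nonneg (hp j) (hxv j)
  rw [inner_neg_left, LinearIsometryEquiv.inner_map_map] at h1
  have h2 : ⟪G.e i, v⟫ = 0 := le_antisymm (by linarith) (hv i)
  have h3 : G.ρ (x * G.σ i) v = G.ρ x v := by rw [ρ_mul, G.refl_fix i v h2]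
  obtain ⟨h4, h5⟩ := ih _ (hn ▸ hlt) (x * G.σ i) (h3.symm ▸ hxv) rfl
  refine ⟨?_, h3 ▸ h5⟩
  have h6 : x = x * G.σ i * G.σ i := by rw [mul_assoc, σ_mul_self, mul_one]
  rw [h6]
  exact Subgroup.mul_mem _ h4 (Subgroup.subset_closure ⟨i, h2, rfl⟩)

/-- The linear isometry attached to `w F`. -/
noncomputable def tw (w : W) : V ≃ₗᵢ[ℝ] V := G.Fv.trans (G.ρ w)

/-- the conjugate of `w` associated to the chamber `u` -/
def tcon (F : W ≃* W) (w u : W) : W := u⁻¹ * w * F u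

lemma tcon_mul (w u : W) (i : ι) :
    tcon F w (u * G.σ i) = G.σ i * tcon F w u * F (G.σ i) := by
  simp only [tcon, mul_inv_rev, inv_σ, map_mul, mul_assoc]

lemma tw_ρ (w u : W) (v : V) : G.ρ u (G.ρ (tcon F w u) (G.Fv v)) = G.tw w (G.ρ u v) := by
  simp only [tw, tcon, LinearIsometryEquiv.trans_apply, ρ_mul, ρ_ρ_inv, G.Fv_ρ]

lemma tw_symm_ρ (w u : W) (v : V) :
    G.ρ u (G.Fv.symm (G.ρ (tcon F w u)⁻¹ v)) = (G.tw w).symm (G.ρ u v) := by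
  rw [LinearIsometryEquiv.eq_symm_apply, ← tw_ρ, LinearIsometryEquiv.apply_symm_apply, ρ_ρ_inv]

lemma pos_inner_nonneg (U : Submodule ℝ V) (κ : V) (hκ : ∀ v ∈ U, ⟪v, κ⟫ = 0)
    (hκ' : ∀ u i, ⟪G.ρ u (G.e i), κ⟫ = 0 → G.ρ u (G.e i) ∈ U)
    (u : W) (hu : ∀ i, 0 ≤ ⟪G.ρ u (G.e i), κ⟫)
    (v : V) (hv : ∀ i, G.ρ u (G.e i) ∈ U → 0 ≤ ⟪G.ρ u (G.e i), v⟫)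
    (p : V) (hp : G.Pos p) (hpU : G.ρ u p ∈ U) : 0 ≤ ⟪G.ρ u p, v⟫ := by
  have := Fintype.ofFinite ι
  have hsum : ∀ z, ⟪G.ρ u p, z⟫ = ∑ j, G.e.repr p j * ⟪G.ρ u (G.e j), z⟫ := by
    intro z
    conv_lhs => rw [← G.e.sum_repr p, map_sum, sum_inner]
    refine Finset.sum_congr rfl fun j _ => ?_
    rw [map_smul, inner_smul_left]; rfl
  have h0 := hκ _ hpU
  rw [hsum, Finset.sum_eq_zero_iff_of_nonneg (fun j _ => mul_nonneg (hp j) (hu j))] at h0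
  rw [hsum]
  refine Finset.sum_nonneg fun j _ => ?_
  rcases mul_eq_zero.1 (h0 j (Finset.mem_univ j)) with h1 | h1
  · rw [h1, zero_mul]
  · exact mul_nonneg (hp j) (hv j (hκ' u j h1))

lemma crossing (w : W) (U : Submodule ℝ V) (hgU : ∀ v ∈ U, G.tw w v ∈ U)
    (hgU' : ∀ v ∈ U, (G.tw w).symm v ∈ U) (κ : V) (hκ : ∀ v ∈ U, ⟪v, κ⟫ = 0)
    (hκ' : ∀ u i, ⟪G.ρ u (G.e i), κ⟫ = 0 → G.ρ u (G.e i) ∈ U)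
    (u : W) (hu : ∀ i, 0 ≤ ⟪G.ρ u (G.e i), κ⟫)
    (v : V) (hv : ∀ i, G.ρ u (G.e i) ∈ U → 0 ≤ ⟪G.ρ u (G.e i), v⟫)
    (i : ι) (hi : G.ρ u (G.e i) ∈ U)
    (h : ⟪G.ρ u (G.e i), G.tw w v⟫ < 0 ∨ ⟪G.ρ u (G.e i), (G.tw w).symm v⟫ < 0 ∨
      G.tw w (G.ρ u (G.e i)) = -(G.ρ u (G.e i))) :
    cs.length (tcon F w (u * G.σ i)) ≤ cs.length (tcon F w u) := by
  rw [tcon_mul]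
  rcases h with h | h | h
  · apply G.noinc2
    intro hp
    have h1 := G.pos_inner_nonneg U κ hκ hκ' u hu v hv _ hp (by rw [tw_symm_ρ]; exact hgU' _ hi)
    rw [tw_symm_ρ, inner_symm_left] at h1
    linarith
  · apply G.noinc1
    intro hp
    have h1 := G.pos_inner_nonneg U κ hκ hκ' u hu v hv _ hp (by rw [tw_ρ]; exact hgU _ hi)
    rw [tw_ρ, ← inner_symm_right] at h1
    linarith
  · apply G.noinc1
    intro hp
    rw [← tw_ρ, ← map_neg] at h
    have h1 := (G.ρ u).injective h
    rw [h1] at hp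
    have h2 := hp i
    rw [map_neg] at h2
    simp at h2
    linarith

/-- chamber moves -/
def Stp (w : W) (u u' : W) : Prop :=
  ∃ i, u' = u * G.σ i ∧ cs.length (tcon F w u') ≤ cs.length (tcon F w u)

/-- chamber moves within a star -/
def StpU (w : W) (U : Submodule ℝ V) (u u' : W) : Prop :=
  ∃ i, u' = u * G.σ i ∧ G.ρ u (G.e i) ∈ U ∧ cs.length (tcon F w u') ≤ cs.length (tcon F w u)

lemma reach_symm (w u u' : W) (hmin : ∀ z, cs.length (tcon F w u) ≤ cs.length (tcon F w z))
    (h : Relation.ReflTransGen (G.Stp w) u u') :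
    Relation.ReflTransGen (G.Stp w) u' u ∧
      cs.length (tcon F w u') = cs.length (tcon F w u) := by
  induction h with
  | refl => exact ⟨Relation.ReflTransGen.refl, rfl⟩
  | @tail a b hab hbc ih =>
    obtain ⟨i, rfl, hle⟩ := hbc
    have h1 := hmin (a * G.σ i)
    refine ⟨Relation.ReflTransGen.head ⟨i, ?_, ?_⟩ ih.1, ?_⟩
    · rw [mul_assoc, σ_mul_self, mul_one]
    · omega
    · omega

lemma reachU_reach (w : W) (U : Submodule ℝ V) (u u' : W)
    (h : Relation.ReflTransGen (G.StpU w U) u u') : Relation.ReflTransGen (G.Stp w) u u' :=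
  h.lift id (fun _ _ ⟨i, h1, _, h3⟩ => ⟨i, h1, h3⟩)

lemma reachU_cl (w : W) (U : Submodule ℝ V) (κ : V) (hκ : ∀ v ∈ U, ⟪v, κ⟫ = 0) (u u' : W)
    (hu : ∀ i, 0 ≤ ⟪G.ρ u (G.e i), κ⟫)
    (h : Relation.ReflTransGen (G.StpU w U) u u') : ∀ i, 0 ≤ ⟪G.ρ u' (G.e i), κ⟫ := by
  induction h with
  | refl => exact hu
  | @tail a b hab hbc ih =>
    obtain ⟨i, rfl, hU, -⟩ := hbc
    intro j
    obtain ⟨c, hc⟩ := G.refl i (G.e j)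
    rw [ρ_mul, hc, map_add, map_smul, inner_add_left, inner_smul_left, hκ _ hU, mul_zero, add_zero]
    exact ih j

lemma exists_rho [FiniteDimensional ℝ V] : ∃ r : V, ∀ i, ⟪G.e i, r⟫ = (1 : ℝ) := by
  refine ⟨(InnerProductSpace.toDual ℝ V).symm
    (LinearMap.toContinuousLinearMap (G.e.constr ℝ (fun _ => (1 : ℝ)))), fun i => ?_⟩
  rw [real_inner_comm, InnerProductSpace.toDual_symm_apply]
  simp

variable [Finite W] [FiniteDimensional ℝ V]

lemma star_move (w : W) (U : Submodule ℝ V) (hgU : ∀ v ∈ U, G.tw w v ∈ U)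
    (hgU' : ∀ v ∈ U, (G.tw w).symm v ∈ U) (κ : V) (hκ : ∀ v ∈ U, ⟪v, κ⟫ = 0)
    (hκ' : ∀ u i, ⟪G.ρ u (G.e i), κ⟫ = 0 → G.ρ u (G.e i) ∈ U)
    (Φ : Set V) (hΦ : ∀ u i, G.ρ u (G.e i) ∈ U → -G.ρ u (G.e i) ∈ Φ)
    (u0 : W) (hu0 : ∀ i, 0 ≤ ⟪G.ρ u0 (G.e i), κ⟫) (v h : V)
    (hperm : Permitted (G.tw w) Φ v h)
    (u : W) (hu : Relation.ReflTransGen (G.StpU w U) u0 u)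
    (hv : ∀ i, G.ρ u (G.e i) ∈ U → 0 ≤ ⟪G.ρ u (G.e i), v⟫) :
    ∃ u', Relation.ReflTransGen (G.StpU w U) u0 u' ∧
      (∀ i, G.ρ u' (G.e i) ∈ U → 0 ≤ ⟪G.ρ u' (G.e i), v⟫) ∧
      (∀ i, G.ρ u' (G.e i) ∈ U → ⟪G.ρ u' (G.e i), v⟫ = 0 → 0 ≤ ⟪G.ρ u' (G.e i), h⟫) := by
  obtain ⟨r, hr⟩ := G.exists_rho
  let S : Set W := {u' | Relation.ReflTransGen (G.StpU w U) u0 u' ∧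
      (∀ i, G.ρ u' (G.e i) ∈ U → 0 ≤ ⟪G.ρ u' (G.e i), v⟫)}
  obtain ⟨u', ⟨hu'1, hu'2⟩, hmax⟩ := Set.exists_max_image S (fun a => ⟪G.ρ a r, h⟫)
    (Set.toFinite S) ⟨u, hu, hv⟩
  refine ⟨u', hu'1, hu'2, ?_⟩
  intro i hiU hiv
  by_contra! hneg
  have hlen : cs.length (tcon F w (u' * G.σ i)) ≤ cs.length (tcon F w u') := by
    apply G.crossing w U hgU hgU' κ hκ hκ' u' (G.reachU_cl w U κ hκ u0 u' hu0 hu'1) v hu'2 i hiU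
    have h1 := hperm _ (hΦ u' i hiU) (by rw [inner_neg_left, hiv, neg_zero])
      (by rw [inner_neg_left]; linarith)
    rw [inner_neg_left, inner_neg_left, map_neg, neg_inj, neg_pos, neg_pos] at h1
    exact h1
  have hmem : u' * G.σ i ∈ S := by
    refine ⟨hu'1.tail ⟨i, rfl, hiU, hlen⟩, ?_⟩
    intro j hj
    obtain ⟨c, hc⟩ := G.refl i (G.e j)
    rw [ρ_mul, hc, map_add, map_smul] at hj ⊢
    rw [inner_add_left, inner_smul_left, hiv, mul_zero, add_zero]
    apply hu'2
    have := U.sub_mem hj (U.smul_mem c hiU)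
    rwa [add_sub_cancel_right] at this
  have h1 := hmax _ hmem
  obtain ⟨c, hc, hc'⟩ := G.refl_formula i r
  simp only [ρ_mul, hc, map_add, map_smul, inner_add_left, inner_smul_left, conj_trivial] at h1
  have hpos : 0 < ⟪G.e i, G.e i⟫ := by
    exact real_inner_self_pos.2 (G.e.ne_zero i)
  rw [hr] at hc'
  have hcneg : c < 0 := by nlinarith
  nlinarith

theorem core (w : W) (hell : ∀ v, G.tw w v = v → v = 0) (d : ℕ) :
    ∀ (U : Submodule ℝ V) (κ : V), Module.finrank ℝ U = d → (∀ v ∈ U, G.tw w v ∈ U) →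
    (∀ v ∈ U, (G.tw w).symm v ∈ U) → (∀ v ∈ U, ⟪v, κ⟫ = 0) →
    (∀ u i, ⟪G.ρ u (G.e i), κ⟫ = 0 → G.ρ u (G.e i) ∈ U) →
    ∀ u u', (∀ z, cs.length (tcon F w u) ≤ cs.length (tcon F w z)) →
      (∀ z, cs.length (tcon F w u') ≤ cs.length (tcon F w z)) →
      (∀ i, 0 ≤ ⟪G.ρ u (G.e i), κ⟫) → (∀ i, 0 ≤ ⟪G.ρ u' (G.e i), κ⟫) →
      Relation.ReflTransGen (G.Stp w) u u' := by
  induction d using Nat.strong_induction_on with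
  | _ d ih =>
  intro U κ hd hgU hgU' hκ hκ' u u' hmin hmin' hu hu'
  by_cases hU : U = ⊥
  · -- `κ` is regular
    have hreg : ∀ u i, ⟪G.ρ u (G.e i), κ⟫ ≠ 0 := by
      intro u i h0
      have := hκ' u i h0
      rw [hU, Submodule.mem_bot] at this
      exact G.e.ne_zero i (by simpa using this)
    have h1 := G.mem_of_dom (G.ρ u'⁻¹ κ) (fun i => by rw [← inner_ρ]; exact hu' i) (u⁻¹ * u')
      (fun i => by rw [ρ_mul, ρ_ρ_inv, ← inner_ρ]; exact hu i)
    have h2 : {i | ⟪G.e i, G.ρ u'⁻¹ κ⟫ = 0} = (∅ : Set ι) := by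
      ext i
      simp only [Set.mem_ofPred_eq, Set.mem_empty_iff_false, iff_false]
      rw [← inner_ρ]; exact hreg u' i
    rw [h2, Set.image_empty, Subgroup.closure_empty, Subgroup.mem_bot] at h1
    have h3 : u = u' := by
      have := h1.1
      rwa [inv_mul_eq_one] at this
    rw [h3]
  -- the inductive step
  let roots : Set V := Set.range fun p : W × ι => G.ρ p.1 (G.e p.2)
  have hrfin : roots.Finite := Set.finite_range _
  let Φ : Set V := {n ∈ roots | n ∈ U}
  have hΦfin : Φ.Finite := hrfin.subset fun n hn => hn.1
  have hneg : ∀ u i, -G.ρ u (G.e i) ∈ roots := by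
    intro u i
    exact ⟨(u * G.σ i, i), by simp only [ρ_mul, G.refl_self, map_neg]⟩
  obtain ⟨K, hKU, hK0, hKo, hKo', k, hkK, hkreg, hkD⟩ :=
    analytic_core (G.tw w) hell U hU hgU hgU' Φ hΦfin fun n hn => hn.2
  -- every chamber of the star can be moved so that its closure contains `k`
  have hmove : ∀ u0, (∀ i, 0 ≤ ⟪G.ρ u0 (G.e i), κ⟫) →
      ∃ u1, Relation.ReflTransGen (G.StpU w U) u0 u1 ∧
        ∀ i, G.ρ u1 (G.e i) ∈ U → 0 ≤ ⟪G.ρ u1 (G.e i), k⟫ := by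
    intro u0 hu0
    let D : Set V := (U : Set V) ∩ ⋃ u1 ∈ {u1 | Relation.ReflTransGen (G.StpU w U) u0 u1},
      {v | ∀ i, G.ρ u1 (G.e i) ∈ U → 0 ≤ ⟪G.ρ u1 (G.e i), v⟫}
    have hDmem : ∀ v, v ∈ D ↔ v ∈ U ∧ ∃ u1, Relation.ReflTransGen (G.StpU w U) u0 u1 ∧
        ∀ i, G.ρ u1 (G.e i) ∈ U → 0 ≤ ⟪G.ρ u1 (G.e i), v⟫ := by
      intro v; simp [D]
    have hk : k ∈ D := by
      apply hkD
      · refine U.closed_of_finiteDimensional.inter ?_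
        refine Set.Finite.isClosed_biUnion (Set.toFinite _) fun u1 _ => ?_
        have : {v | ∀ i, G.ρ u1 (G.e i) ∈ U → 0 ≤ ⟪G.ρ u1 (G.e i), v⟫}
            = ⋂ i, ⋂ (_ : G.ρ u1 (G.e i) ∈ U), {v | 0 ≤ ⟪G.ρ u1 (G.e i), v⟫} := by
          ext v; simp
        rw [this]
        refine isClosed_iInter fun i => isClosed_iInter fun _ => ?_
        exact isClosed_le continuous_const (by fun_prop)
      · intro v hv; exact hv.1
      · intro v hv h hhU hperm
        obtain ⟨hvU, u1, hu1, hv1⟩ := (hDmem v).1 hv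
        obtain ⟨u2, hu2, hv2, hh2⟩ := G.star_move w U hgU hgU' κ hκ hκ' Φ
          (fun u i hi => ⟨hneg u i, U.neg_mem hi⟩) u0 hu0 v h hperm u1 hu1 hv1
        have hev : ∀ᶠ t : ℝ in 𝓝[≥] 0, ∀ i, G.ρ u2 (G.e i) ∈ U →
            0 ≤ ⟪G.ρ u2 (G.e i), v + t • h⟫ := by
          rw [eventually_all]
          intro i
          by_cases hi : G.ρ u2 (G.e i) ∈ U
          swap
          · exact Eventually.of_forall fun t h => absurd h hi
          rcases (hv2 i hi).lt_or_eq with hlt | heq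
          · have hc : Continuous fun t : ℝ => ⟪G.ρ u2 (G.e i), v + t • h⟫ := by fun_prop
            have := (hc.tendsto 0).eventually_const_lt (u := 0) (by simpa using hlt)
            exact mem_nhdsWithin_of_mem_nhds (this.mono fun t ht _ => ht.le)
          · have h3 : ∀ᶠ t : ℝ in 𝓝[≥] 0, (0 : ℝ) ≤ t := eventually_mem_nhdsWithin
            filter_upwards [h3] with t ht _
            rw [inner_add_right, ← heq, inner_smul_right, zero_add]
            exact mul_nonneg ht (hh2 i hi heq.symm)
        obtain ⟨ε, hε, hsub⟩ := mem_nhdsGE_iff_exists_Icc_subset.1 hev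
        refine ⟨ε, hε, fun t ht0 ht1 => ?_⟩
        rw [hDmem]
        exact ⟨U.add_mem hvU (U.smul_mem t hhU), u2, hu2, hsub ⟨ht0, ht1⟩⟩
      · obtain ⟨r, hr⟩ := G.exists_rho
        refine ⟨U.starProjection (G.ρ u0 r), Submodule.starProjection_apply_mem U _, ?_⟩
        have hev : ∀ᶠ y in 𝓝 (U.starProjection (G.ρ u0 r)), ∀ i, G.ρ u0 (G.e i) ∈ U →
            0 ≤ ⟪G.ρ u0 (G.e i), y⟫ := by
          rw [eventually_all]
          intro i
          by_cases hi : G.ρ u0 (G.e i) ∈ U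
          swap
          · exact Eventually.of_forall fun t h => absurd h hi
          have hc : Continuous fun y : V => ⟪G.ρ u0 (G.e i), y⟫ := by fun_prop
          have := (hc.tendsto (U.starProjection (G.ρ u0 r))).eventually_const_lt (u := 0)
            (by
              rw [← Submodule.inner_starProjection_left_eq_right,
                Submodule.starProjection_eq_self_iff.2 hi, LinearIsometryEquiv.inner_map_map, hr]
              exact one_pos)
          exact this.mono fun t ht _ => ht.le
        obtain ⟨δ, hδ, hball⟩ := Metric.eventually_nhds_iff.1 hev
        refine ⟨δ, hδ, fun y hy hyx => ?_⟩
        rw [hDmem]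
        exact ⟨hy, u0, Relation.ReflTransGen.refl, hball (by rwa [dist_eq_norm])⟩
    exact ((hDmem k).1 hk).2
  -- perturb `κ`
  obtain ⟨ε, hε0, hε⟩ : ∃ ε : ℝ, 0 < ε ∧ ∀ n ∈ roots, ⟪n, κ⟫ ≠ 0 → |ε * ⟪n, k⟫| < |⟪n, κ⟫| := by
    have hev : ∀ᶠ t : ℝ in 𝓝[>] 0, ∀ n ∈ roots, ⟪n, κ⟫ ≠ 0 → |t * ⟪n, k⟫| < |⟪n, κ⟫| := by
      rw [eventually_all_finite hrfin]
      intro n _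
      by_cases hn : ⟪n, κ⟫ = 0
      · exact Eventually.of_forall fun t h => absurd hn h
      have hc : Continuous fun t : ℝ => |t * ⟪n, k⟫| := by fun_prop
      have := (hc.tendsto 0).eventually_lt_const (u := |⟪n, κ⟫|)
        (by simpa using hn)
      exact mem_nhdsWithin_of_mem_nhds (this.mono fun t ht _ => ht)
    have hev3 : ∀ᶠ t : ℝ in 𝓝[>] 0, (0 : ℝ) < t := eventually_mem_nhdsWithin
    obtain ⟨t, h1, h2⟩ := (hev3.and hev).exists
    exact ⟨t, h1, h2⟩
  let U' : Submodule ℝ V := U ⊓ Kᗮ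
  have hlt : Module.finrank ℝ U' < d := by
    rw [← hd]
    apply Submodule.finrank_lt_finrank_of_lt
    refine lt_of_le_of_ne inf_le_left fun h => hK0 ?_
    rw [eq_bot_iff]
    intro z hz
    have h1 : z ∈ U' := h ▸ hKU hz
    have := Submodule.inner_right_of_mem_orthogonal hz h1.2
    simpa using this
  have hcl : ∀ u1, (∀ i, 0 ≤ ⟪G.ρ u1 (G.e i), κ⟫) →
      (∀ i, G.ρ u1 (G.e i) ∈ U → 0 ≤ ⟪G.ρ u1 (G.e i), k⟫) →
      ∀ i, 0 ≤ ⟪G.ρ u1 (G.e i), κ + ε • k⟫ := by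
    intro u1 h1 h2 i
    rw [inner_add_right, inner_smul_right]
    by_cases h0 : ⟪G.ρ u1 (G.e i), κ⟫ = 0
    · rw [h0, zero_add]
      exact mul_nonneg hε0.le (h2 i (hκ' u1 i h0))
    · have h3 := hε _ ⟨(u1, i), rfl⟩ h0
      rw [abs_of_nonneg (h1 i)] at h3
      have := (abs_lt.1 h3).1
      linarith
  obtain ⟨u1, hu1, hu1k⟩ := hmove u hu
  obtain ⟨u2, hu2, hu2k⟩ := hmove u' hu'
  have hr1 := G.reachU_reach w U _ _ hu1
  have hr2 := G.reachU_reach w U _ _ hu2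
  obtain ⟨hb1, he1⟩ := G.reach_symm w u u1 hmin hr1
  obtain ⟨hb2, he2⟩ := G.reach_symm w u' u2 hmin' hr2
  refine (hr1.trans ?_).trans hb2
  refine ih _ hlt U' (κ + ε • k) rfl ?_ ?_ ?_ ?_ u1 u2 ?_ ?_ ?_ ?_
  · rintro v ⟨h1, h2⟩; exact ⟨hgU v h1, hKo v h2⟩
  · rintro v ⟨h1, h2⟩; exact ⟨hgU' v h1, hKo' v h2⟩
  · rintro v ⟨h1, h2⟩
    rw [inner_add_right, inner_smul_right, hκ v h1,
      Submodule.inner_left_of_mem_orthogonal hkK h2, mul_zero, add_zero]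
  · intro a i h0
    rw [inner_add_right, inner_smul_right] at h0
    have h1 : ⟪G.ρ a (G.e i), κ⟫ = 0 := by
      by_contra hne
      have h3 := hε _ ⟨(a, i), rfl⟩ hne
      rw [eq_neg_of_add_eq_zero_left h0, abs_neg] at h3
      exact lt_irrefl _ h3
    have h2 : G.ρ a (G.e i) ∈ U := hκ' a i h1
    refine ⟨h2, hkreg _ ⟨⟨(a, i), rfl⟩, h2⟩ ?_⟩
    rw [h1, zero_add] at h0
    exact (mul_eq_zero.1 h0).resolve_left hε0.ne'
  · intro z; rw [he1]; exact hmin z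
  · intro z; rw [he2]; exact hmin' z
  · exact hcl u1 (G.reachU_cl w U κ hκ u u1 hu hu1) hu1k
  · exact hcl u2 (G.reachU_cl w U κ hκ u' u2 hu' hu2) hu2k

lemma exists_dom (v : V) : ∃ a : W, G.Dom (G.ρ a v) := by
  obtain ⟨r, hr⟩ := G.exists_rho
  obtain ⟨a, -, hmax⟩ := Set.exists_max_image (Set.univ : Set W) (fun a => ⟪G.ρ a v, r⟫)
    (Set.toFinite _) ⟨1, trivial⟩
  refine ⟨a, fun i => ?_⟩
  by_contra! hneg
  have h1 := hmax (G.σ i * a) trivial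
  obtain ⟨c, hc, hc'⟩ := G.refl_formula i (G.ρ a v)
  simp only [ρ_mul, hc, inner_add_left, inner_smul_left, conj_trivial, hr] at h1
  have hpos : 0 < ⟪G.e i, G.e i⟫ := real_inner_self_pos.2 (G.e.ne_zero i)
  nlinarith

lemma elliptic (w : W)
    (hcusp : ∀ I : Set B, I ≠ Set.univ → (⇑F) '' (cs.simple '' I) = cs.simple '' I →
      ∀ u : W, tcon F w u ∉ Subgroup.closure (cs.simple '' I)) :
    ∀ v, G.tw w v = v → v = 0 := by
  intro v hv
  by_contra hv0
  obtain ⟨a, ha⟩ := G.exists_dom v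
  set v0 := G.ρ a v with hv0def
  have hfix : G.ρ (tcon F w a⁻¹) (G.Fv v0) = v0 := by
    have h1 := G.tw_ρ w a⁻¹ v0
    rw [hv0def, ρ_inv_ρ, hv] at h1
    have h2 := congrArg (G.ρ a) h1
    rwa [ρ_ρ_inv] at h2
  have hFdom : G.Dom (G.Fv v0) := by
    intro i
    have : G.e i = G.Fv (G.e (G.φ.symm i)) := by rw [G.Fv_e, Equiv.apply_symm_apply]
    rw [this, LinearIsometryEquiv.inner_map_map]
    exact ha _
  obtain ⟨hmem, hfix2⟩ := G.mem_of_dom (G.Fv v0) hFdom (tcon F w a⁻¹) (hfix.symm ▸ ha)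
  rw [hfix] at hfix2
  rw [← hfix2] at hmem
  set J : Set ι := {i | ⟪G.e i, v0⟫ = 0} with hJ
  have hJφ : ∀ i, G.φ i ∈ J ↔ i ∈ J := by
    intro i
    simp only [hJ, Set.mem_ofPred_eq]
    rw [← G.Fv_e]
    conv_lhs => rw [hfix2]
    rw [LinearIsometryEquiv.inner_map_map]
  have himg : cs.simple '' (cs.simple ⁻¹' (G.σ '' J)) = G.σ '' J := by
    rw [Set.image_preimage_eq_iff, ← G.hσ]
    exact Set.image_subset_range _ _
  refine hcusp (cs.simple ⁻¹' (G.σ '' J)) ?_ ?_ a⁻¹ ?_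
  · intro huniv
    have hall : ∀ i, ⟪G.e i, v0⟫ = 0 := by
      intro i
      obtain ⟨b, hb⟩ := G.exists_simple i
      have h1 : b ∈ cs.simple ⁻¹' (G.σ '' J) := huniv ▸ Set.mem_univ b
      obtain ⟨i', hi', h2⟩ := h1
      rw [← hb] at h2
      have := G.σ_inj h2
      subst this
      exact hi'
    have h0 : v0 = 0 := by
      refine ext_inner_left ℝ fun z => ?_
      have hz : innerₛₗ ℝ v0 = 0 := G.e.ext fun i => by
        rw [innerₛₗ_apply_apply, real_inner_comm, hall i, LinearMap.zero_apply]
      have := LinearMap.congr_fun hz z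
      rw [innerₛₗ_apply_apply, LinearMap.zero_apply] at this
      rw [inner_zero_right, real_inner_comm, this]
    apply hv0
    rw [← G.ρ_inv_ρ a v, ← hv0def, h0, map_zero]
  · rw [himg]
    ext z
    constructor
    · rintro ⟨_, ⟨i, hi, rfl⟩, rfl⟩
      exact ⟨G.φ i, (hJφ i).2 hi, (G.hφ i).symm⟩
    · rintro ⟨i, hi, rfl⟩
      refine ⟨_, ⟨G.φ.symm i, (hJφ _).1 (by rwa [Equiv.apply_symm_apply]), rfl⟩, ?_⟩
      rw [G.hφ, Equiv.apply_symm_apply]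
  · rw [himg]; exact hmem

lemma reach_of_min (G : Geo cs F ι V) (w : W)
    (hcusp : ∀ I : Set B, I ≠ Set.univ → (⇑F) '' (cs.simple '' I) = cs.simple '' I →
      ∀ u : W, tcon F w u ∉ Subgroup.closure (cs.simple '' I)) (a b : W)
    (ha : ∀ z, cs.length (tcon F w a) ≤ cs.length (tcon F w z))
    (hb : ∀ z, cs.length (tcon F w b) ≤ cs.length (tcon F w z)) :
    Relation.ReflTransGen (fun x y => ∃ s : B, y = cs.simple s * x * F (cs.simple s) ∧
      cs.length y ≤ cs.length x) (tcon F w a) (tcon F w b) := by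
  have h := G.core w (G.elliptic w hcusp) _ ⊤ 0 rfl (fun _ _ => trivial) (fun _ _ => trivial)
    (fun v _ => inner_zero_right v) (fun _ _ _ => trivial) a b ha hb
    (fun i => (inner_zero_right (𝕜 := ℝ) _).ge) (fun i => (inner_zero_right (𝕜 := ℝ) _).ge)
  refine h.lift (tcon F w) ?_
  rintro p q ⟨i, rfl, hle⟩
  obtain ⟨s, hs⟩ := G.exists_simple i
  exact ⟨s, by rw [tcon_mul, hs], hle⟩

end Geo
end Combinatorial


section Tits
open Real

/-- Dihedral computation. -/
lemma dihedral {V : Type*} [AddCommGroup V] [Module ℝ V] (Ra Rc : V →ₗ[ℝ] V) (a c : V) (θ : ℝ)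
    (h1 : Ra a = -a) (h2 : Rc c = -c) (h3 : Ra c = c + (2 * cos θ) • a)
    (h4 : Rc a = a + (2 * cos θ) • c) (j : ℕ) :
    sin θ • ((Ra * Rc) ^ j) a = sin ((2 * j + 1) * θ) • a + sin ((2 * j) * θ) • c ∧
    sin θ • Rc (((Ra * Rc) ^ j) a) =
      sin ((2 * j + 1) * θ) • a + sin ((2 * j + 2) * θ) • c := by
  have key : ∀ x : ℝ, sin (x + θ) = 2 * cos θ * sin x - sin (x - θ) := by
    intro x; rw [sin_add, sin_sub]; ring
  have second : ∀ j : ℕ,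
      sin θ • ((Ra * Rc) ^ j) a = sin ((2 * j + 1) * θ) • a + sin ((2 * j) * θ) • c →
      sin θ • Rc (((Ra * Rc) ^ j) a) =
        sin ((2 * j + 1) * θ) • a + sin ((2 * j + 2) * θ) • c := by
    intro j hj
    rw [← map_smul, hj, map_add, map_smul, map_smul, h2, h4]
    have h5 := key ((2 * j + 1) * θ)
    rw [show ((2 * (j : ℝ) + 1) * θ + θ) = (2 * j + 2) * θ by ring,
      show ((2 * (j : ℝ) + 1) * θ - θ) = (2 * j) * θ by ring] at h5
    rw [h5]
    module
  have first : sin θ • ((Ra * Rc) ^ j) a = sin ((2 * j + 1) * θ) • a + sin ((2 * j) * θ) • c := by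
    induction j with
    | zero => simp
    | succ j ih =>
      have h6 := second j ih
      rw [pow_succ', Module.End.mul_apply, Module.End.mul_apply, ← map_smul, h6, map_add, map_smul,
        map_smul, h1, h3]
      have h5 := key ((2 * j + 2) * θ)
      rw [show ((2 * (j : ℝ) + 2) * θ + θ) = (2 * ((j + 1 : ℕ) : ℝ) + 1) * θ by push_cast; ring,
        show ((2 * (j : ℝ) + 2) * θ - θ) = (2 * j + 1) * θ by ring] at h5
      rw [h5, show (2 * ((j + 1 : ℕ) : ℝ)) * θ = (2 * j + 2) * θ by push_cast; ring]
      module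
  exact ⟨first, second j first⟩

variable {B W : Type*} [Group W] [Finite W] {M : CoxeterMatrix B} (cs : CoxeterSystem M W)

/-- the set of simple reflections -/
abbrev TT := ↥(Set.range cs.simple)

noncomputable instance : Fintype (TT cs) := Fintype.ofFinite _

/-- the coefficients of the Tits form -/
noncomputable def bb (s t : TT cs) : ℝ := -cos (π / orderOf ((s : W) * t))

/-- simple root -/
noncomputable def er (s : TT cs) : TT cs → ℝ := by
  classical exact Pi.single s 1

/-- pairing with a simple root -/
noncomputable def bl (s : TT cs) : (TT cs → ℝ) →ₗ[ℝ] ℝ :=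
  ∑ t, bb cs s t • LinearMap.proj t

/-- the reflection -/
noncomputable def RR (s : TT cs) : (TT cs → ℝ) →ₗ[ℝ] (TT cs → ℝ) :=
  LinearMap.id - ((2 : ℝ) • bl cs s).smulRight (er cs s)

lemma RR_apply (s : TT cs) (x : TT cs → ℝ) : RR cs s x = x - (2 * bl cs s x) • er cs s := by
  simp [RR]

lemma bl_er (s t : TT cs) : bl cs s (er cs t) = bb cs s t := by
  classical
  simp only [bl, er, LinearMap.sum_apply, LinearMap.smul_apply, LinearMap.proj_apply, smul_eq_mul]
  rw [Finset.sum_eq_single t]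
  · simp
  · intro b _ hb; simp [hb]
  · simp

lemma TT_mul_self (s : TT cs) : (s : W) * s = 1 := by
  obtain ⟨_, i, rfl⟩ := s
  exact cs.simple_mul_simple_self i

lemma TT_inv (s : TT cs) : (s : W)⁻¹ = s := inv_eq_of_mul_eq_one_left (TT_mul_self cs s)

lemma TT_length (s : TT cs) : cs.length (s : W) = 1 := by
  obtain ⟨_, i, rfl⟩ := s
  exact cs.length_simple i

lemma order_comm (s t : TT cs) : orderOf ((t : W) * s) = orderOf ((s : W) * t) := by
  rw [← orderOf_inv, mul_inv_rev, TT_inv, TT_inv]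

lemma bb_self (s : TT cs) : bb cs s s = 1 := by
  simp [bb, TT_mul_self]

lemma bb_comm (s t : TT cs) : bb cs s t = bb cs t s := by
  rw [bb, bb, order_comm]

lemma RR_self (s : TT cs) : RR cs s (er cs s) = -er cs s := by
  rw [RR_apply, bl_er, bb_self]; module

lemma RR_other (s t : TT cs) : RR cs s (er cs t) =
    er cs t + (2 * cos (π / orderOf ((s : W) * t))) • er cs s := by
  rw [RR_apply, bl_er, bb]; module

lemma RR_sq (s : TT cs) : RR cs s * RR cs s = 1 := by
  ext1 x
  rw [Module.End.mul_apply, Module.End.one_apply, RR_apply, RR_apply, map_sub, map_smul, bl_er,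
    bb_self]
  simp only [smul_eq_mul]
  module

lemma two_le_order (s t : TT cs) (h : s ≠ t) : 2 ≤ orderOf ((s : W) * t) := by
  have h0 : 0 < orderOf ((s : W) * t) := orderOf_pos _
  have h1 : orderOf ((s : W) * t) ≠ 1 := by
    rw [Ne, orderOf_eq_one_iff]
    intro h1
    apply h
    apply Subtype.ext
    rw [← TT_inv cs s]
    exact inv_eq_of_mul_eq_one_right h1
  omega

lemma sin_order_pos (m : ℕ) (h : 2 ≤ m) : 0 < sin (π / m) := by
  have hm : (2 : ℝ) ≤ m := by exact_mod_cast h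
  apply sin_pos_of_pos_of_lt_pi
  · positivity
  · rw [div_lt_iff₀ (by linarith)]
    nlinarith [pi_pos]

lemma RR_pow_er (s t : TT cs) (h : s ≠ t) :
    ((RR cs s * RR cs t) ^ (orderOf ((s : W) * t))) (er cs s) = er cs s := by
  set m := orderOf ((s : W) * t) with hm
  have hm2 := two_le_order cs s t h
  have hs := sin_order_pos m hm2
  have hm0 : (m : ℝ) ≠ 0 := by
    have : m ≠ 0 := by omega
    exact_mod_cast this
  have := (dihedral (RR cs s) (RR cs t) (er cs s) (er cs t) (π / m) (RR_self cs s) (RR_self cs t)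
    (RR_other cs s t) (by rw [RR_other, order_comm]) m).1
  rw [show (2 * (m : ℝ) + 1) * (π / m) = π / m + 2 * π by field_simp; ring,
    show (2 * (m : ℝ)) * (π / m) = 2 * π by field_simp, sin_add_two_pi, sin_two_pi, zero_smul,
    add_zero] at this
  exact smul_right_injective _ hs.ne' this

lemma RR_rel (s t : TT cs) : (RR cs s * RR cs t) ^ (orderOf ((s : W) * t)) = 1 := by
  by_cases h : s = t
  · subst h
    rw [RR_sq, one_pow]
  set m := orderOf ((s : W) * t) with hm
  have hm2 := two_le_order cs s t h
  have hs := sin_order_pos m hm2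
  have e1 := RR_pow_er cs s t h
  have e2 : ((RR cs s * RR cs t) ^ m) (er cs t) = er cs t := by
    have h1 := RR_pow_er cs t s (Ne.symm h)
    rw [order_comm, ← hm] at h1
    have h2 : (RR cs s * RR cs t) ^ m * (RR cs t * RR cs s) ^ m = 1 := by
      have hc : (RR cs s * RR cs t) * (RR cs t * RR cs s) = 1 := by
        rw [mul_assoc, ← mul_assoc (RR cs t), RR_sq, one_mul, RR_sq]
      have hc' : (RR cs t * RR cs s) * (RR cs s * RR cs t) = 1 := by
        rw [mul_assoc, ← mul_assoc (RR cs s), RR_sq, one_mul, RR_sq]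
      have hcom : Commute (RR cs s * RR cs t) (RR cs t * RR cs s) := by
        rw [Commute, SemiconjBy, hc, hc']
      rw [← hcom.mul_pow, hc, one_pow]
    have h3 := LinearMap.congr_fun h2 (er cs t)
    rwa [Module.End.mul_apply, h1, Module.End.one_apply] at h3
  have e3 : ∀ z, bl cs s z = 0 → bl cs t z = 0 → ∀ k : ℕ, ((RR cs s * RR cs t) ^ k) z = z := by
    intro z h1 h2 k
    induction k with
    | zero => simp
    | succ k ih =>
      rw [pow_succ', Module.End.mul_apply, ih, Module.End.mul_apply, RR_apply cs t, h2]
      simp [RR_apply, h1]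
  ext1 x
  rw [Module.End.one_apply]
  set c := cos (π / m) with hc
  have hdet : 1 - c ^ 2 ≠ 0 := by
    have := sin_sq_add_cos_sq (π / m)
    have h2 : 0 < sin (π / m) ^ 2 := by positivity
    intro h3; rw [← hc] at this; linarith
  have hst : bb cs s t = -c := rfl
  have hts : bb cs t s = -c := by rw [bb_comm]; exact hst
  set p := (bl cs s x + c * bl cs t x) / (1 - c ^ 2) with hp
  set q := (bl cs t x + c * bl cs s x) / (1 - c ^ 2) with hq
  have hx : x = (x - p • er cs s - q • er cs t) + p • er cs s + q • er cs t := by abel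
  have hz := e3 (x - p • er cs s - q • er cs t)
    (by
      simp only [map_sub, map_smul, bl_er, bb_self, hst, smul_eq_mul, hp, hq]
      field_simp; ring)
    (by
      simp only [map_sub, map_smul, bl_er, bb_self, hts, smul_eq_mul, hp, hq]
      field_simp; ring) m
  rw [hx, map_add, map_add, hz, map_smul, map_smul, e1, e2]

/-- the Tits representation -/
noncomputable def tits : W →* Module.End ℝ (TT cs → ℝ) :=
  cs.lift ⟨fun i => RR cs ⟨cs.simple i, i, rfl⟩, by
    intro i j
    have h1 : orderOf (cs.simple i * cs.simple j) ∣ M i j :=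
      orderOf_dvd_of_pow_eq_one (cs.simple_mul_simple_pow i j)
    obtain ⟨k, hk⟩ := h1
    have h2 := RR_rel cs ⟨cs.simple i, i, rfl⟩ ⟨cs.simple j, j, rfl⟩
    simp only at h2
    rw [hk, pow_mul, h2, one_pow]⟩

lemma tits_simple (s : TT cs) : tits cs (s : W) = RR cs s := by
  obtain ⟨_, i, rfl⟩ := s
  exact cs.lift_apply_simple _ i

/-- alternating words -/
def altw (t s : W) : ℕ → W
  | 0 => 1
  | k + 1 => altw t s k * (if k % 2 = 0 then t else s)

lemma altw_even (t s : W) (j : ℕ) : altw t s (2 * j) = (t * s) ^ j := by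
  induction j with
  | zero => simp [altw]
  | succ j ih =>
    rw [show 2 * (j + 1) = 2 * j + 1 + 1 by ring, altw, altw, ih, if_pos (by omega),
      if_neg (by omega), pow_succ, mul_assoc]

lemma altw_odd (t s : W) (j : ℕ) : altw t s (2 * j + 1) = (t * s) ^ j * t := by
  rw [altw, altw_even, if_pos (by omega)]

lemma altw_length (s t : TT cs) (k : ℕ) : cs.length (altw (t : W) s k) ≤ k := by
  induction k with
  | zero => simp [altw]
  | succ k ih =>
    rw [altw]
    refine (cs.length_mul_le _ _).trans ?_
    split_ifs <;> rw [TT_length] <;> omega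

lemma altw_rel (s t : TT cs) (m : ℕ) (hm : 1 ≤ m) (hrel : ((t : W) * s) ^ m = 1) :
    (s : W) * altw (t : W) s m = altw (t : W) s (m - 1) := by
  have hs := TT_mul_self cs s
  have ht := TT_mul_self cs t
  have hconj : ∀ j : ℕ, (s : W) * ((t : W) * s) ^ j * s = (((t : W) * s) ^ j)⁻¹ := by
    intro j
    have h1 := conj_pow (i := j) (a := (s : W)) (b := (t : W) * s)
    rw [TT_inv] at h1
    rw [← h1, ← inv_pow, mul_inv_rev, TT_inv, TT_inv, mul_assoc, mul_assoc, hs, mul_one]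
  rcases Nat.even_or_odd' m with ⟨j, rfl | rfl⟩
  · obtain ⟨i, rfl⟩ : ∃ i, j = i + 1 := ⟨j - 1, by omega⟩
    rw [show 2 * (i + 1) - 1 = 2 * i + 1 by omega, altw_even, altw_odd]
    have h1 : (((t : W) * s) ^ (i + 1))⁻¹ = ((t : W) * s) ^ (i + 1) := by
      rw [inv_eq_iff_mul_eq_one, ← pow_add, ← two_mul, hrel]
    have h2 := hconj (i + 1)
    rw [h1] at h2
    have h3 : (s : W) * ((t : W) * s) ^ (i + 1) = ((t : W) * s) ^ (i + 1) * s := by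
      rw [← h2, mul_assoc _ (s : W) (s : W), hs, mul_one, h2]
    rw [h3, pow_succ, mul_assoc, mul_assoc, hs, mul_one]
  · rw [show 2 * j + 1 - 1 = 2 * j by omega, altw_even, altw_odd]
    have h2 := hconj j
    have h3 : (s : W) * ((t : W) * s) ^ j = (((t : W) * s) ^ j)⁻¹ * s := by
      rw [← h2, mul_assoc _ (s : W) (s : W), hs, mul_one]
    rw [← mul_assoc, h3, mul_assoc, inv_mul_eq_iff_eq_mul, ← pow_add, ← two_mul]
    rw [pow_succ] at hrel
    have h4 := eq_inv_of_mul_eq_one_left hrel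
    rw [h4, mul_inv_rev, TT_inv, TT_inv]


lemma altw_long (s t : TT cs) (m : ℕ) (hm : 1 ≤ m) (hrel : ((t : W) * s) ^ m = 1) (k : ℕ)
    (hk : m ≤ k) : cs.length ((s : W) * altw (t : W) s k) ≤ k - 1 := by
  induction k, hk using Nat.le_induction with
  | base =>
    rw [altw_rel cs s t m hm hrel]
    exact altw_length cs s t _
  | succ k hk ih =>
    rw [altw, ← mul_assoc]
    refine (cs.length_mul_le _ _).trans ?_
    split_ifs <;> rw [TT_length] <;> omega

lemma tits_altw_pos (s t : TT cs) (h : s ≠ t) (k : ℕ) (hk : k < orderOf ((s : W) * t)) :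
    ∃ p q : ℝ, 0 ≤ p ∧ 0 ≤ q ∧
      tits cs (altw (t : W) s k)⁻¹ (er cs s) = p • er cs s + q • er cs t := by
  set m := orderOf ((s : W) * t) with hm
  have hm2 := two_le_order cs s t h
  have hs := sin_order_pos m hm2
  have hm0 : (0 : ℝ) < m := by
    have : 0 < m := by omega
    exact_mod_cast this
  have hsin : ∀ x : ℝ, 0 ≤ x → x ≤ m → 0 ≤ sin (x * (π / m)) := by
    intro x hx hx'
    apply sin_nonneg_of_nonneg_of_le_pi
    · positivity
    · rw [← mul_div_assoc, div_le_iff₀ hm0]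
      nlinarith [pi_pos]
  have key : ∀ (v : TT cs → ℝ) (p q : ℝ), sin (π / m) • v = p • er cs s + q • er cs t →
      v = (p / sin (π / m)) • er cs s + (q / sin (π / m)) • er cs t := by
    intro v p q hv
    apply smul_right_injective _ hs.ne'
    simp only
    rw [hv, smul_add, smul_smul, smul_smul, mul_div_cancel₀ _ hs.ne', mul_div_cancel₀ _ hs.ne']
  have hd := fun j => dihedral (RR cs s) (RR cs t) (er cs s) (er cs t) (π / m) (RR_self cs s)
    (RR_self cs t) (RR_other cs s t) (by rw [RR_other, order_comm]) j
  have hk' : (k : ℝ) + 1 ≤ m := by exact_mod_cast hk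
  have hk0 : (0 : ℝ) ≤ k := Nat.cast_nonneg k
  rcases Nat.even_or_odd' k with ⟨j, rfl | rfl⟩
  · have h1 : tits cs (altw (t : W) s (2 * j))⁻¹ = (RR cs s * RR cs t) ^ j := by
      rw [altw_even, ← inv_pow, mul_inv_rev, TT_inv, TT_inv, map_pow, map_mul, tits_simple,
        tits_simple]
    rw [h1]
    push_cast at hk' hk0
    exact ⟨_, _, div_nonneg (hsin _ (by linarith) (by linarith)) hs.le,
      div_nonneg (hsin _ (by linarith) (by linarith)) hs.le, key _ _ _ (hd j).1⟩
  · have h1 : tits cs (altw (t : W) s (2 * j + 1))⁻¹ = RR cs t * (RR cs s * RR cs t) ^ j := by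
      rw [altw_odd, mul_inv_rev, ← inv_pow, mul_inv_rev, TT_inv, TT_inv, map_mul, map_pow, map_mul,
        tits_simple, tits_simple]
    rw [h1]
    push_cast at hk' hk0
    exact ⟨_, _, div_nonneg (hsin _ (by linarith) (by linarith)) hs.le,
      div_nonneg (hsin _ (by linarith) (by linarith)) hs.le, key _ _ _ (hd j).2⟩

lemma TT_length_mul (w : W) (s : TT cs) :
    cs.length (w * s) = cs.length w + 1 ∨ cs.length (w * s) + 1 = cs.length w := by
  obtain ⟨_, i, rfl⟩ := s
  exact cs.length_mul_simple w i

lemma tits_pos (n : ℕ) : ∀ (w : W), cs.length w = n → ∀ (s : TT cs),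
    cs.length w < cs.length (w * s) → ∀ j, 0 ≤ tits cs w (er cs s) j := by
  induction n using Nat.strong_induction_on with
  | _ n ih =>
  intro w hw s hws j
  by_cases hw1 : w = 1
  · subst hw1
    classical
    rw [map_one, Module.End.one_apply, er]
    by_cases hj : j = s
    · subst hj; simp
    · simp [hj]
  obtain ⟨i, hi⟩ := cs.exists_rightDescent_of_ne_one hw1
  set t : TT cs := ⟨cs.simple i, i, rfl⟩ with ht
  have hwt : cs.length (w * t) < cs.length w := hi
  have hst : s ≠ t := by
    rintro h; rw [h] at hws; omega
  set a := altw (t : W) (s : W) with ha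
  set P : ℕ → Prop := fun k => cs.length (w * a k) + k = cs.length w with hP
  classical
  have hP1 : P 1 := by
    have h1 : a 1 = t := by simp [ha, altw]
    have := TT_length_mul cs w t
    simp only [hP, h1]; omega
  have hn1 : 1 ≤ cs.length w := by omega
  set k := Nat.findGreatest P (cs.length w) with hk
  have hk1 : 1 ≤ k := Nat.le_findGreatest hn1 hP1
  have hPk : P k := Nat.findGreatest_spec hn1 hP1
  have hPk1 : ¬ P (k + 1) := by
    intro h
    have h2 : k + 1 ≤ cs.length w := by
      have : cs.length (w * a (k + 1)) + (k + 1) = cs.length w := h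
      omega
    have := Nat.le_findGreatest h2 h
    omega
  have hPk' : cs.length (w * a k) + k = cs.length w := hPk
  have hPk1' : ¬ (cs.length (w * a (k + 1)) + (k + 1) = cs.length w) := hPk1
  have hnext : ∀ r : TT cs, a (k + 1) = a k * r →
      cs.length (w * a k) < cs.length (w * a k * r) := by
    intro r hr
    rw [hr, ← mul_assoc] at hPk1'
    rcases TT_length_mul cs (w * a k) r with h | h <;> omega
  have hlast : ∀ r : TT cs, a k = a (k - 1) * r →
      cs.length (w * a k) < cs.length (w * a k * r) := by
    intro r hr
    have h1 : w * a k * r = w * a (k - 1) := by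
      rw [hr, mul_assoc, mul_assoc, TT_mul_self, mul_one]
    have h2 : cs.length w ≤ cs.length (w * a (k - 1)) + (k - 1) := by
      have h3 := cs.length_mul_le (w * a (k - 1)) (a (k - 1))⁻¹
      rw [mul_inv_cancel_right, cs.length_inv] at h3
      have := altw_length cs s t (k - 1)
      rw [← ha] at this
      omega
    rw [h1]; omega
  have hk2 : ∀ k', a (k' + 1) = a k' * (if k' % 2 = 0 then (t : W) else s) := fun k' => rfl
  obtain ⟨k', hk'⟩ : ∃ k', k = k' + 1 := ⟨k - 1, by omega⟩
  have both : cs.length (w * a k) < cs.length (w * a k * s) ∧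
      cs.length (w * a k) < cs.length (w * a k * t) := by
    rcases Nat.mod_two_eq_zero_or_one k with h | h
    · refine ⟨hlast s ?_, hnext t ?_⟩
      · rw [hk', Nat.add_sub_cancel, hk2, if_neg (by omega)]
      · rw [hk2, if_pos h]
    · refine ⟨hnext s ?_, hlast t ?_⟩
      · rw [hk2, if_neg (by omega)]
      · rw [hk', Nat.add_sub_cancel, hk2, if_pos (by omega)]
  have hkm : k < orderOf ((s : W) * t) := by
    by_contra hcon
    push Not at hcon
    have hm1 : 1 ≤ orderOf ((s : W) * t) := orderOf_pos _
    have hlong := altw_long cs s t _ hm1 (by rw [← order_comm]; exact pow_orderOf_eq_one _) k hcon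
    have h3 := cs.length_mul_le (w * a k) ((s : W) * a k)⁻¹
    rw [cs.length_inv, mul_inv_rev, TT_inv, ← mul_assoc, mul_inv_cancel_right] at h3
    rw [← ha] at hlong
    omega
  obtain ⟨p, q, hp, hq, hpq⟩ := tits_altw_pos cs s t hst k hkm
  have h1 := ih (cs.length (w * a k)) (by omega) (w * a k) rfl s both.1 j
  have h2 := ih (cs.length (w * a k)) (by omega) (w * a k) rfl t both.2 j
  have h3 : tits cs w (er cs s) = p • tits cs (w * a k) (er cs s) +
      q • tits cs (w * a k) (er cs t) := by
    rw [← map_smul, ← map_smul, ← map_add, ← hpq, ← Module.End.mul_apply, ← map_mul, ← ha,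
      mul_inv_cancel_right]
  rw [h3]
  simp only [Pi.add_apply, Pi.smul_apply, smul_eq_mul]
  positivity

end Tits


section Assembly
variable {B W : Type*} [Group W] {M : CoxeterMatrix B}

lemma reach_abs [Finite W] (cs : CoxeterSystem M W) (F : W ≃* W) {ι V : Type*} [Finite ι]
    [AddCommGroup V] [Module ℝ V] (c : InnerProductSpace.Core ℝ V)
    (σ : ι → W) (σ_inj : Function.Injective σ) (hσ : Set.range σ = Set.range cs.simple)
    (ρ : W →* Module.End ℝ V) (hinv : ∀ w x y, c.inner (ρ w x) (ρ w y) = c.inner x y)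
    (e : Module.Basis ι ℝ V) (refl_self : ∀ i, ρ (σ i) (e i) = -e i)
    (refl : ∀ i x, ∃ a : ℝ, ρ (σ i) x = x + a • e i)
    (pos : ∀ w i, cs.length w < cs.length (w * σ i) → ∀ j, 0 ≤ e.repr (ρ w (e i)) j)
    (φ : Equiv.Perm ι) (hφ : ∀ i, F (σ i) = σ (φ i)) (Fv : V ≃ₗ[ℝ] V)
    (hFv : ∀ x y, c.inner (Fv x) (Fv y) = c.inner x y) (Fv_e : ∀ i, Fv (e i) = e (φ i))
    (Fv_ρ : ∀ w x, Fv (ρ w x) = ρ (F w) (Fv x)) (w : W)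
    (hcusp : ∀ I : Set B, I ≠ Set.univ → (⇑F) '' (cs.simple '' I) = cs.simple '' I →
      ∀ u : W, Geo.tcon F w u ∉ Subgroup.closure (cs.simple '' I)) (a b : W)
    (ha : ∀ z, cs.length (Geo.tcon F w a) ≤ cs.length (Geo.tcon F w z))
    (hb : ∀ z, cs.length (Geo.tcon F w b) ≤ cs.length (Geo.tcon F w z)) :
    Relation.ReflTransGen (fun x y => ∃ s : B, y = cs.simple s * x * F (cs.simple s) ∧
      cs.length y ≤ cs.length x) (Geo.tcon F w a) (Geo.tcon F w b) := by
  letI : NormedAddCommGroup V := c.toNormedAddCommGroup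
  letI : InnerProductSpace ℝ V := InnerProductSpace.ofCore c.toCore
  haveI : FiniteDimensional ℝ V := Module.Finite.of_basis e
  have hmul : ∀ w x, ρ w (ρ w⁻¹ x) = x := by
    intro w x
    rw [← Module.End.mul_apply, ← map_mul, mul_inv_cancel, map_one, Module.End.one_apply]
  have hmul' : ∀ w x, ρ w⁻¹ (ρ w x) = x := by
    intro w x
    rw [← Module.End.mul_apply, ← map_mul, inv_mul_cancel, map_one, Module.End.one_apply]
  let ρ' : W →* (V ≃ₗᵢ[ℝ] V) :=
    { toFun := fun w => LinearEquiv.isometryOfInner (LinearEquiv.ofLinear (ρ w) (ρ w⁻¹)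
        (LinearMap.ext (hmul w)) (LinearMap.ext (hmul' w))) (hinv w)
      map_one' := by
        ext x
        change ρ 1 x = x
        rw [map_one, Module.End.one_apply]
      map_mul' := by
        intro a b
        ext x
        change ρ (a * b) x = ρ a (ρ b x)
        rw [map_mul, Module.End.mul_apply] }
  let G : Geo cs F ι V :=
    { σ := σ, σ_inj := σ_inj, hσ := hσ, ρ := ρ', e := e, refl_self := refl_self, refl := refl
      pos := pos, φ := φ, hφ := hφ, Fv := LinearEquiv.isometryOfInner Fv hFv, Fv_e := Fv_e
      Fv_ρ := Fv_ρ }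
  exact G.reach_of_min w hcusp a b ha hb

/-- the standard dot product -/
noncomputable def dotT [Finite W] (cs : CoxeterSystem M W) (x y : TT cs → ℝ) : ℝ :=
  ∑ t, x t * y t

/-- the averaged inner product -/
noncomputable def coreT [Fintype W] (cs : CoxeterSystem M W) :
    InnerProductSpace.Core ℝ (TT cs → ℝ) where
  inner x y := ∑ w : W, dotT cs (tits cs w x) (tits cs w y)
  conj_inner_symm x y := by
    simp only [dotT, conj_trivial]
    exact Finset.sum_congr rfl fun w _ => Finset.sum_congr rfl fun t _ => mul_comm _ _
  re_inner_nonneg x := by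
    simp only [dotT, RCLike.re_to_real]
    exact Finset.sum_nonneg fun w _ => Finset.sum_nonneg fun t _ => mul_self_nonneg _
  add_left x y z := by
    simp only [dotT, map_add, Pi.add_apply, add_mul, Finset.sum_add_distrib]
  smul_left x y r := by
    simp only [dotT, map_smul, Pi.smul_apply, smul_eq_mul, mul_assoc, ← Finset.mul_sum,
      conj_trivial]
  definite x hx := by
    simp only [dotT] at hx
    rw [Finset.sum_eq_zero_iff_of_nonneg
      fun w _ => Finset.sum_nonneg fun t _ => mul_self_nonneg _] at hx
    have h1 := hx 1 (Finset.mem_univ _)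
    rw [Finset.sum_eq_zero_iff_of_nonneg fun t _ => mul_self_nonneg _] at h1
    funext t
    have h2 := h1 t (Finset.mem_univ _)
    rw [map_one, Module.End.one_apply] at h2
    exact mul_self_eq_zero.1 h2

lemma coreT_inv [Fintype W] (cs : CoxeterSystem M W) (w : W) (x y : TT cs → ℝ) :
    (coreT cs).inner (tits cs w x) (tits cs w y) = (coreT cs).inner x y := by
  change ∑ u : W, dotT cs (tits cs u (tits cs w x)) (tits cs u (tits cs w y)) =
    ∑ u : W, dotT cs (tits cs u x) (tits cs u y)
  rw [← Equiv.sum_comp (Equiv.mulRight w) fun u => dotT cs (tits cs u x) (tits cs u y)]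
  refine Finset.sum_congr rfl fun u _ => ?_
  rw [Equiv.coe_mulRight, map_mul, Module.End.mul_apply, Module.End.mul_apply]

lemma exists_phi (cs : CoxeterSystem M W) (F : W ≃* W)
    (hF : (⇑F) '' Set.range cs.simple = Set.range cs.simple) :
    ∃ φ : Equiv.Perm (TT cs), ∀ i : TT cs, F (i : W) = (φ i : W) := by
  have h := (F.injective.injOn (s := Set.range cs.simple)).bijOn_image
  rw [hF] at h
  exact ⟨h.equiv, fun i => rfl⟩

section Fv
variable [Finite W] (cs : CoxeterSystem M W) (φ : Equiv.Perm (TT cs))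

/-- coordinate permutation -/
noncomputable def FvT : (TT cs → ℝ) ≃ₗ[ℝ] (TT cs → ℝ) := LinearEquiv.funCongrLeft ℝ ℝ φ.symm

lemma FvT_apply (x : TT cs → ℝ) (t : TT cs) : FvT cs φ x t = x (φ.symm t) := rfl

lemma FvT_er (s : TT cs) : FvT cs φ (er cs s) = er cs (φ s) := by
  classical
  funext t
  rw [FvT_apply, er, er]
  by_cases h : t = φ s
  · subst h; simp
  · have : φ.symm t ≠ s := fun h2 => h (by rw [← h2, Equiv.apply_symm_apply])
    rw [Pi.single_eq_of_ne this, Pi.single_eq_of_ne h]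

variable {cs φ}

lemma bb_phi {F : W ≃* W} (hφ : ∀ i : TT cs, F (i : W) = (φ i : W)) (s t : TT cs) :
    bb cs (φ s) (φ t) = bb cs s t := by
  rw [bb, bb, ← hφ, ← hφ, ← map_mul, MulEquiv.orderOf_eq]

lemma FvT_RR {F : W ≃* W} (hφ : ∀ i : TT cs, F (i : W) = (φ i : W)) (s : TT cs)
    (x : TT cs → ℝ) : FvT cs φ (RR cs s x) = RR cs (φ s) (FvT cs φ x) := by
  rw [RR_apply, RR_apply, map_sub, map_smul, FvT_er]
  congr 3
  simp only [bl, LinearMap.sum_apply, LinearMap.smul_apply, LinearMap.proj_apply, smul_eq_mul]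
  rw [← Equiv.sum_comp φ fun t => bb cs (φ s) t * FvT cs φ x t]
  refine Finset.sum_congr rfl fun t _ => ?_
  rw [bb_phi hφ, FvT_apply, Equiv.symm_apply_apply]

lemma FvT_tits {F : W ≃* W} (hφ : ∀ i : TT cs, F (i : W) = (φ i : W)) (w : W) :
    ∀ x : TT cs → ℝ, FvT cs φ (tits cs w x) = tits cs (F w) (FvT cs φ x) := by
  induction w using cs.simple_induction_left with
  | one => intro x; rw [map_one, map_one, map_one]; rfl
  | mul_simple_left w i ih =>
    intro x
    have h1 := tits_simple cs ⟨cs.simple i, i, rfl⟩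
    have h2 := tits_simple cs (φ ⟨cs.simple i, i, rfl⟩)
    rw [← hφ] at h2
    simp only at h1 h2
    rw [map_mul, map_mul, map_mul, Module.End.mul_apply, Module.End.mul_apply, ← ih, h1, h2,
      FvT_RR hφ]

end Fv

lemma coreT_Fv [Fintype W] (cs : CoxeterSystem M W) (F : W ≃* W) (φ : Equiv.Perm (TT cs))
    (hφ : ∀ i : TT cs, F (i : W) = (φ i : W)) (x y : TT cs → ℝ) :
    (coreT cs).inner (FvT cs φ x) (FvT cs φ y) = (coreT cs).inner x y := by
  change ∑ u : W, dotT cs (tits cs u (FvT cs φ x)) (tits cs u (FvT cs φ y)) =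
    ∑ u : W, dotT cs (tits cs u x) (tits cs u y)
  rw [← Equiv.sum_comp F.toEquiv
    fun u => dotT cs (tits cs u (FvT cs φ x)) (tits cs u (FvT cs φ y))]
  refine Finset.sum_congr rfl fun u _ => ?_
  change dotT cs (tits cs (F u) (FvT cs φ x)) (tits cs (F u) (FvT cs φ y)) = _
  rw [← FvT_tits hφ, ← FvT_tits hφ, dotT, dotT]
  exact Equiv.sum_comp φ.symm fun t => tits cs u x t * tits cs u y t

lemma reach_final [Finite W] (cs : CoxeterSystem M W) (F : W ≃* W)
    (hF : (⇑F) '' Set.range cs.simple = Set.range cs.simple) (w : W)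
    (hcusp : ∀ I : Set B, I ≠ Set.univ → (⇑F) '' (cs.simple '' I) = cs.simple '' I →
      ∀ u : W, Geo.tcon F w u ∉ Subgroup.closure (cs.simple '' I)) (a b : W)
    (ha : ∀ z, cs.length (Geo.tcon F w a) ≤ cs.length (Geo.tcon F w z))
    (hb : ∀ z, cs.length (Geo.tcon F w b) ≤ cs.length (Geo.tcon F w z)) :
    Relation.ReflTransGen (fun x y => ∃ s : B, y = cs.simple s * x * F (cs.simple s) ∧
      cs.length y ≤ cs.length x) (Geo.tcon F w a) (Geo.tcon F w b) := by
  classical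
  cases nonempty_fintype W
  obtain ⟨φ, hφ⟩ := exists_phi cs F hF
  have he : ∀ s, Pi.basisFun ℝ (TT cs) s = er cs s := by
    intro s
    rw [Pi.basisFun_apply, er]
  refine reach_abs cs F (coreT cs) (fun s : TT cs => (s : W)) Subtype.val_injective
    Subtype.range_coe (tits cs) (coreT_inv cs) (Pi.basisFun ℝ (TT cs)) ?_ ?_ ?_ φ hφ (FvT cs φ)
    (coreT_Fv cs F φ hφ) ?_ (FvT_tits hφ) w hcusp a b ha hb
  · intro s; rw [tits_simple, he, RR_self]
  · intro s x
    refine ⟨-(2 * bl cs s x), ?_⟩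
    rw [tits_simple, he, RR_apply]; module
  · intro u s hs j
    rw [he, Pi.basisFun_repr]
    exact tits_pos cs _ u rfl s hs j
  · intro s; rw [he, he, FvT_er]

end Assembly

/-- He–Nie: if `O` is a cuspidal `F`-conjugacy class of a finite Coxeter group `W`
(`F` an automorphism with `F(S) = S`), then any two elements of minimal length in `O`
are conjugate by a sequence of length-preserving cyclic shifts, i.e. `x ≈ y`. -/
theorem stmt2 {B : Type*} {W : Type*} [Group W] [Finite W] {M : CoxeterMatrix B}
    (cs : CoxeterSystem M W) (F : W ≃* W)
    (hF : (⇑F) '' Set.range cs.simple = Set.range cs.simple)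
    (w : W) (hcusp : IsCuspidalClass cs F w)
    (x y : W) (hx : FConj F w x) (hy : FConj F w y)
    (hxmin : ∀ z : W, FConj F w z → cs.length x ≤ cs.length z)
    (hymin : ∀ z : W, FConj F w z → cs.length y ≤ cs.length z) :
    Relation.ReflTransGen (CyclicShiftStep cs F) x y ∧
      Relation.ReflTransGen (CyclicShiftStep cs F) y x := by
  obtain ⟨a, rfl⟩ := hx
  obtain ⟨b, rfl⟩ := hy
  have hc : ∀ I : Set B, I ≠ Set.univ → (⇑F) '' (cs.simple '' I) = cs.simple '' I →
      ∀ u : W, Geo.tcon F w u ∉ Subgroup.closure (cs.simple '' I) :=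
    fun I h1 h2 u => hcusp I h1 h2 _ ⟨u, rfl⟩
  have ha : ∀ z, cs.length (Geo.tcon F w a) ≤ cs.length (Geo.tcon F w z) :=
    fun z => hxmin _ ⟨z, rfl⟩
  have hb : ∀ z, cs.length (Geo.tcon F w b) ≤ cs.length (Geo.tcon F w z) :=
    fun z => hymin _ ⟨z, rfl⟩
  exact ⟨reach_final cs F hF w hc a b ha hb, reach_final cs F hF w hc b a hb ha⟩
end

section
/- Let n ≥ 2 and r ≥ 1 be integers with 2r ≤ n. In the symmetric group 𝔖_n, the 2r-cycle σ_{2r} := (1, n, 2, n−1, 3, n−2, …, r, n−r+1) (so σ_{2r} maps 1 ↦ n, n ↦ 2, 2 ↦ n−1, …, r ↦ n−r+1, n−r+1 ↦ 1, and fixes all other points) satisfies σ_{2r} = s₁ s₂ ⋯ s_{r−1} · w₀ · w_{I}, where I = {r+1, r+2, …, n−1−r}. -/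
theorem swapProd_apply (m k : ℕ) :
    ((List.range m).map fun i => Equiv.swap (i + 1) (i + 2)).prod k =
      if 1 ≤ k ∧ k ≤ m then k + 1 else if k = m + 1 then 1 else k := by
  induction m generalizing k with
  | zero => simp; grind
  | succ m ih =>
    rw [List.range_succ, List.map_append, List.prod_append, Equiv.Perm.mul_apply]
    simp only [List.map_cons, List.map_nil, List.prod_cons, List.prod_nil, mul_one]
    rw [ih, Equiv.swap_apply_def]
    grind

/-- In the symmetric group `𝔖_n` (realized as permutations of `ℕ` supported on `{1,…,n}`,
with products composed as functions), the `2r`-cycle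
`σ_{2r} = (1, n, 2, n−1, 3, …, r, n−r+1)` equals
`s₁ s₂ ⋯ s_{r−1} · w₀ · w_I` where `I = {r+1, …, n−1−r}`.
Here `s_i = (i, i+1)`, `w₀` is the longest element (`i ↦ n+1−i` on `{1,…,n}`), and
`w_I` is the longest element of the parabolic subgroup generated by `{s_i : i ∈ I}`,
i.e. the reversal `j ↦ n+1−j` of the interval `{r+1, …, n−r}`. -/
theorem stmt5 (n r : ℕ) (hn : 2 ≤ n) (hr1 : 1 ≤ r) (hr : 2 * r ≤ n)
    (σ w₀ wI : Equiv.Perm ℕ)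
    (hw₀ : ∀ i : ℕ, (1 ≤ i ∧ i ≤ n → w₀ i = n + 1 - i) ∧ (¬(1 ≤ i ∧ i ≤ n) → w₀ i = i))
    (hwI : ∀ j : ℕ, (r + 1 ≤ j ∧ j ≤ n - r → wI j = n + 1 - j) ∧
      (¬(r + 1 ≤ j ∧ j ≤ n - r) → wI j = j))
    (hσ₁ : ∀ i : ℕ, 1 ≤ i → i ≤ r → σ i = n + 1 - i)
    (hσ₂ : ∀ i : ℕ, 1 ≤ i → i ≤ r - 1 → σ (n + 1 - i) = i + 1)
    (hσ₃ : σ (n + 1 - r) = 1)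
    (hσ₄ : ∀ i : ℕ, ¬(1 ≤ i ∧ i ≤ r) → ¬(n + 1 - r ≤ i ∧ i ≤ n) → σ i = i) :
    σ = ((List.range (r - 1)).map fun i => Equiv.swap (i + 1) (i + 2)).prod * w₀ * wI := by
  ext i
  rw [Equiv.Perm.mul_apply, Equiv.Perm.mul_apply, swapProd_apply]
  by_cases h1 : 1 ≤ i ∧ i ≤ r
  · rw [hσ₁ i h1.1 h1.2, (hwI i).2 (by omega), (hw₀ i).1 (by omega)]
    split_ifs <;> omega
  by_cases h2 : n + 1 - r ≤ i ∧ i ≤ n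
  · rw [(hwI i).2 (by omega), (hw₀ i).1 (by omega)]
    by_cases h3 : i = n + 1 - r
    · subst h3
      rw [hσ₃]
      split_ifs <;> omega
    · have := hσ₂ (n + 1 - i) (by omega) (by omega)
      rw [show n + 1 - (n + 1 - i) = i by omega] at this
      rw [this]
      split_ifs <;> omega
  rw [hσ₄ i h1 h2]
  by_cases h3 : r + 1 ≤ i ∧ i ≤ n - r
  · rw [(hwI i).1 h3, (hw₀ _).1 (by omega)]
    split_ifs <;> omega
  · rw [(hwI i).2 h3, (hw₀ _).2 (by omega)]
    split_ifs <;> omega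
end
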